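/- For all 1 <= i, j <= N, all k, m in Z, and every P in N_q^-, one has Omega_{phi_j}(k)(x^-_{i,m} P) = delta_ij delta_{k,-m} gamma^{-k} P + sum_{r>=0} g_{i,j}(r) gamma^r x^-_{i,m-r} (Omega_{phi_j}(k+r)(P)), where only finitely many summands are nonzero. -/

import Mathlib

/-!
STATEMENT 9: the commutation rule of `Ω_{φ_j}(k)` with left multiplication by
`x^-_{i,m}` on `N_q^-`.
-/


noncomputable section
open scoped BigOperators

/-- The base field `ℚ(q^{1/2})`. -/
abbrev Fq : Type := RatFunc ℚ

/-- `q^{1/2}`. -/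
def sqq : Fq := RatFunc.X

/-- `q`. -/
def qq : Fq := sqq ^ 2

/-- Generators of the quantum affine algebra `U_q(ĝ)` in the Drinfeld realization. -/
inductive Gen (N : ℕ) : Type
  | xp (i : Fin N) (r : ℤ)
  | xm (i : Fin N) (r : ℤ)
  | h  (i : Fin N) (s : ℤ)
  | K (i : Fin N)
  | Kinv (i : Fin N)
  | g2
  | g2inv
  | D
  | Dinv

open Gen

/-- The free algebra on the Drinfeld generators. -/
abbrev FA (N : ℕ) : Type := FreeAlgebra Fq (Gen N)

variable {N : ℕ}

def e (x : Gen N) : FA N := FreeAlgebra.ι Fq x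

variable (d : Fin N → ℤ) (A : Fin N → Fin N → ℤ)

/-- `q_i = q^{d_i}`. -/
def qi (i : Fin N) : Fq := qq ^ (d i)

/-- `q^{(α_i|α_j)} = q^{d_i a_{ij}}`. -/
def qp (i j : Fin N) : Fq := qq ^ (d i * A i j)

/-- The quantum integer `[n]_i`. -/
def qint (i : Fin N) (n : ℤ) : Fq := (qi d i ^ n - qi d i ^ (-n)) / (qi d i - (qi d i)⁻¹)

/-- `[n]_i!`. -/
def qfact (i : Fin N) : ℕ → Fq
  | 0 => 1
  | n + 1 => qint d i (n + 1) * qfact i n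

/-- The `q_i`-binomial coefficient `[n choose r]_{q_i}`. -/
def qbinom (i : Fin N) (n r : ℕ) : Fq := qfact d i n / (qfact d i r * qfact d i (n - r))

/-- `γ^{m/2}` as a (noncommutative) word in the free algebra. -/
def gammaHalf (m : ℤ) : FA N := if 0 ≤ m then (e g2) ^ m.toNat else (e g2inv) ^ (-m).toNat

/-- `γ^{k}`. -/
def gammaPow (k : ℤ) : FA N := gammaHalf (2 * k)

/-- The Schur-like polynomials `S_k((q_i - q_i^{-1}) h_{i,1}, (q_i - q_i^{-1}) h_{i,2}, …)`
appearing in `ψ_{i,k} = K_i S_k`, defined by the recursion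
`k S_k = ∑_{l=1}^{k} l x_l S_{k-l}` for `exp(∑ x_l z^l) = ∑ S_k z^k`. -/
def Ppos (i : Fin N) : ℕ → FA N
  | 0 => 1
  | k + 1 =>
      ((k + 1 : Fq))⁻¹ •
        ∑ l ∈ Finset.range (k + 1),
          (((l + 1 : ℕ) : Fq) * (qi d i - (qi d i)⁻¹)) •
            (e (h i ((l : ℤ) + 1)) * Ppos i (k - l))

/-- The analogous polynomials in the `h_{i,-l}`, `l > 0`, with coefficient
`-(q_i - q_i^{-1})`, appearing in `φ_{i,-k} = K_i^{-1} S_k`. -/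
def Pneg (i : Fin N) : ℕ → FA N
  | 0 => 1
  | k + 1 =>
      ((k + 1 : Fq))⁻¹ •
        ∑ l ∈ Finset.range (k + 1),
          (((l + 1 : ℕ) : Fq) * (-(qi d i - (qi d i)⁻¹))) •
            (e (h i (-((l : ℤ) + 1))) * Pneg i (k - l))

/-- The element `ψ_{i,m}` (zero for `m < 0`). -/
def psiEl (i : Fin N) (m : ℤ) : FA N := if 0 ≤ m then e (K i) * Ppos d i m.toNat else 0

/-- The element `φ_{i,m}` (zero for `m > 0`). -/
def phiEl (i : Fin N) (m : ℤ) : FA N := if m ≤ 0 then e (Kinv i) * Pneg d i (-m).toNat else 0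

/-- A summand of the Drinfeld–Serre relation:
`x_{i,k_{σ(1)}} ⋯ x_{i,k_{σ(r)}} x_{j,l} x_{i,k_{σ(r+1)}} ⋯ x_{i,k_{σ(n)}}`
(`pm = true` for the `x^+` relation, `pm = false` for `x^-`). -/
def dsTerm (pm : Bool) (i j : Fin N) (n' : ℕ) (ks : Fin n' → ℤ) (l : ℤ)
    (σ : Equiv.Perm (Fin n')) (r : ℕ) : FA N :=
  (((List.finRange n').take r).map fun t =>
      e (if pm then xp i (ks (σ t)) else xm i (ks (σ t)))).prod *
    e (if pm then xp j l else xm j l) *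
  (((List.finRange n').drop r).map fun t =>
      e (if pm then xp i (ks (σ t)) else xm i (ks (σ t)))).prod

/-- The defining relations of the quantum affine algebra `U_q(ĝ)`
(Drinfeld realization). -/
inductive QRel (N : ℕ) (d : Fin N → ℤ) (A : Fin N → Fin N → ℤ) : FA N → FA N → Prop
  | K_Kinv (i : Fin N) : QRel N d A (e (K i) * e (Kinv i)) 1
  | Kinv_K (i : Fin N) : QRel N d A (e (Kinv i) * e (K i)) 1
  | D_Dinv : QRel N d A (e D * e Dinv) 1
  | Dinv_D : QRel N d A (e Dinv * e D) 1
  | g_ginv : QRel N d A (e g2 * e g2inv) 1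
  | ginv_g : QRel N d A (e g2inv * e g2) 1
  | g2_comm (x : Gen N) : QRel N d A (e g2 * e x) (e x * e g2)
  | g2inv_comm (x : Gen N) : QRel N d A (e g2inv * e x) (e x * e g2inv)
  | K_comm_K (i j : Fin N) : QRel N d A (e (K i) * e (K j)) (e (K j) * e (K i))
  | K_comm_D (i : Fin N) : QRel N d A (e (K i) * e D) (e D * e (K i))
  | K_comm_h (i j : Fin N) (s : ℤ) :
      QRel N d A (e (K i) * e (h j s)) (e (h j s) * e (K i))
  | h_zero (i : Fin N) : QRel N d A (e (h i 0)) 0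
  | D_h (i : Fin N) (s : ℤ) :
      QRel N d A (e D * e (h i s) * e Dinv) ((qq ^ s) • e (h i s))
  | D_xp (i : Fin N) (r : ℤ) :
      QRel N d A (e D * e (xp i r) * e Dinv) ((qq ^ r) • e (xp i r))
  | D_xm (i : Fin N) (r : ℤ) :
      QRel N d A (e D * e (xm i r) * e Dinv) ((qq ^ r) • e (xm i r))
  | K_xp (i j : Fin N) (r : ℤ) :
      QRel N d A (e (K i) * e (xp j r) * e (Kinv i)) (qp d A i j • e (xp j r))
  | K_xm (i j : Fin N) (r : ℤ) :
      QRel N d A (e (K i) * e (xm j r) * e (Kinv i)) ((qp d A i j)⁻¹ • e (xm j r))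
  | h_h (i j : Fin N) (k l : ℤ) (hk : k ≠ 0) (hl : l ≠ 0) :
      QRel N d A (e (h i k) * e (h j l) - e (h j l) * e (h i k))
        (if l = -k then
          ((k : Fq)⁻¹ * qint d i (k * A i j) * (qi d j - (qi d j)⁻¹)⁻¹) •
            (gammaPow k - gammaPow (-k))
         else 0)
  | h_xp (i j : Fin N) (k l : ℤ) (hk : k ≠ 0) :
      QRel N d A (e (h i k) * e (xp j l) - e (xp j l) * e (h i k))
        (((k : Fq)⁻¹ * qint d i (k * A i j)) • (gammaHalf (-|k|) * e (xp j (k + l))))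
  | h_xm (i j : Fin N) (k l : ℤ) (hk : k ≠ 0) :
      QRel N d A (e (h i k) * e (xm j l) - e (xm j l) * e (h i k))
        ((-((k : Fq)⁻¹ * qint d i (k * A i j))) • (gammaHalf |k| * e (xm j (k + l))))
  | serre_p (i j : Fin N) (k l : ℤ) :
      QRel N d A
        (e (xp i (k+1)) * e (xp j l) - qp d A i j • (e (xp j l) * e (xp i (k+1))))
        (qp d A i j • (e (xp i k) * e (xp j (l+1))) - e (xp j (l+1)) * e (xp i k))
  | serre_m (i j : Fin N) (k l : ℤ) :
      QRel N d A
        (e (xm i (k+1)) * e (xm j l) - (qp d A i j)⁻¹ • (e (xm j l) * e (xm i (k+1))))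
        ((qp d A i j)⁻¹ • (e (xm i k) * e (xm j (l+1))) - e (xm j (l+1)) * e (xm i k))
  | xp_xm (i j : Fin N) (k l : ℤ) :
      QRel N d A (e (xp i k) * e (xm j l) - e (xm j l) * e (xp i k))
        (if i = j then
          ((qi d i - (qi d i)⁻¹)⁻¹) •
            (gammaHalf (k - l) * psiEl d i (k + l) - gammaHalf (l - k) * phiEl d i (k + l))
         else 0)
  | dserre (pm : Bool) (i j : Fin N) (hij : i ≠ j)
      (ks : Fin (1 - A i j).toNat → ℤ) (l : ℤ) :
      QRel N d A
        (∑ σ : Equiv.Perm (Fin (1 - A i j).toNat),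
          ∑ r ∈ Finset.range ((1 - A i j).toNat + 1),
            ((-1 : Fq) ^ r * qbinom d i (1 - A i j).toNat r) •
              dsTerm pm i j (1 - A i j).toNat ks l σ r)
        0

/-- The quantum affine algebra `U_q(ĝ)` (Drinfeld realization). -/
abbrev Uq (N : ℕ) (d : Fin N → ℤ) (A : Fin N → Fin N → ℤ) : Type := RingQuot (QRel N d A)

/-- The image of a generator in `U_q(ĝ)`. -/
def G (x : Gen N) : Uq N d A := RingQuot.mkAlgHom Fq (QRel N d A) (e x)

/-- The image of `ψ_{i,m}` in `U_q(ĝ)`. -/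
def psiU (i : Fin N) (m : ℤ) : Uq N d A := RingQuot.mkAlgHom Fq (QRel N d A) (psiEl d i m)

/-- The image of `φ_{i,m}` in `U_q(ĝ)`. -/
def phiU (i : Fin N) (m : ℤ) : Uq N d A := RingQuot.mkAlgHom Fq (QRel N d A) (phiEl d i m)

/-- The image of `γ^{m/2}` in `U_q(ĝ)`. -/
def gU (m : ℤ) : Uq N d A := RingQuot.mkAlgHom Fq (QRel N d A) (gammaHalf m)


/-- The generating set of the subalgebra `N_q^-`. -/
def NqSet : Set (Uq N d A) :=
  {G d A Gen.g2, G d A Gen.g2inv} ∪ Set.range (fun p : Fin N × ℤ => G d A (Gen.xm p.1 p.2))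

/-- The subalgebra `N_q^-` of `U_q(ĝ)` generated by `γ^{±1/2}` and the `x^-_{i,l}`. -/
def Nq : Subalgebra Fq (Uq N d A) := Algebra.adjoin Fq (NqSet d A)

/-- `γ^{1/2}` as an element of `N_q^-`. -/
def g2N : Nq d A :=
  ⟨G d A Gen.g2, Algebra.subset_adjoin (Set.mem_union_left _ (Set.mem_insert _ _))⟩

/-- `γ^{-1/2}` as an element of `N_q^-`. -/
def g2invN : Nq d A :=
  ⟨G d A Gen.g2inv, Algebra.subset_adjoin (Set.mem_union_left _ (Set.mem_insert_of_mem _ rfl))⟩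

/-- `x^-_{i,m}` as an element of `N_q^-`. -/
def xmN (i : Fin N) (m : ℤ) : Nq d A :=
  ⟨G d A (Gen.xm i m), Algebra.subset_adjoin (Set.mem_union_right _ ⟨(i, m), rfl⟩)⟩

/-- `γ^{m/2}` as an element of `N_q^-`. -/
def gN (m : ℤ) : Nq d A :=
  if 0 ≤ m then (g2N d A) ^ m.toNat else (g2invN d A) ^ (-m).toNat

/-- The characterizing property of the family of operators
`Ω_{ψ_i}(m), Ω_{φ_i}(m) : N_q^- → N_q^-`: they vanish for small (resp. large) index, and
`[x^+_{i,k}, P] = (q_i - q_i^{-1})^{-1} (∑_{p ≥ 0} ψ_{i,p} γ^{p/2} Ω_{ψ_i}(k-p)(P)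
   - ∑_{r ≥ 0} φ_{i,-r} γ^{r/2} Ω_{φ_i}(k+r)(P))`,
both sums having only finitely many nonzero terms.  (By the commutator lemma there is a
unique such family.) -/
def IsOmegaFamily (Ωψ Ωφ : Fin N → ℤ → ((Nq d A) →ₗ[Fq] (Nq d A))) : Prop :=
  (∀ (i : Fin N) (P : Nq d A), ∃ b : ℤ, ∀ m : ℤ, m ≤ b → Ωψ i m P = 0) ∧
  (∀ (i : Fin N) (P : Nq d A), ∃ b : ℤ, ∀ m : ℤ, b ≤ m → Ωφ i m P = 0) ∧
  (∀ (i : Fin N) (k : ℤ) (P : Nq d A), ∃ M : ℕ,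
    (∀ p : ℕ, M < p → Ωψ i (k - (p : ℤ)) P = 0 ∧ Ωφ i (k + (p : ℤ)) P = 0) ∧
    G d A (Gen.xp i k) * (P : Uq N d A) - (P : Uq N d A) * G d A (Gen.xp i k) =
      ((qi d i - (qi d i)⁻¹)⁻¹) •
        ((∑ p ∈ Finset.range (M + 1),
            psiU d A i (p : ℤ) * gU d A (p : ℤ) *
              ((Ωψ i (k - (p : ℤ)) P : Nq d A) : Uq N d A)) -
         (∑ r ∈ Finset.range (M + 1),
            phiU d A i (-(r : ℤ)) * gU d A (r : ℤ) *
              ((Ωφ i (k + (r : ℤ)) P : Nq d A) : Uq N d A))))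

/-- The Taylor coefficients at `t = 0` of `(a t - 1)/(t - a)` (for `a = q^{(α_i|α_j)}`
this is the series `g_{i,j}(t)`; for `a = q^{-(α_i|α_j)}` it is `g_{i,j,q^{-1}}(t)`). -/
def gcoef (a : Fq) : ℕ → Fq
  | 0 => a⁻¹
  | r + 1 => a ^ (-(r : ℤ) - 2) - a ^ (-(r : ℤ))

namespace DrinfeldSerre

variable {F : Type*} [Field F]

/-- The Gaussian binomial coefficient, symmetric under `q ↦ q⁻¹`. -/
def gaussBinom (q : F) : ℕ → ℕ → F
  | _, 0 => 1
  | 0, _ + 1 => 0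
  | n + 1, r + 1 => q ^ (-((r : ℤ) + 1)) * gaussBinom q n (r + 1)
      + q ^ ((n : ℤ) - r) * gaussBinom q n r

/-- The numerator `q ^ n - q ^ (-n)` of a quantum integer. -/
def qdiff (q : F) (n : ℤ) : F := q ^ n - q ^ (-n)

@[simp] theorem gaussBinom_zero_right (q : F) (n : ℕ) : gaussBinom q n 0 = 1 := by
  cases n <;> rfl

theorem gaussBinom_succ_succ (q : F) (n r : ℕ) :
    gaussBinom q (n + 1) (r + 1) = q ^ (-((r : ℤ) + 1)) * gaussBinom q n (r + 1)
      + q ^ ((n : ℤ) - r) * gaussBinom q n r := rfl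

theorem gaussBinom_eq_zero (q : F) {n r : ℕ} (h : n < r) : gaussBinom q n r = 0 := by
  induction n generalizing r with
  | zero => obtain ⟨r, rfl⟩ := Nat.exists_eq_add_of_lt h; simp [gaussBinom]
  | succ n ih =>
    obtain ⟨r, rfl⟩ : ∃ s, r = s + 1 := ⟨r - 1, by omega⟩
    rw [gaussBinom_succ_succ, ih (by omega), ih (by omega)]; simp

theorem qdiff_succ_mul_gaussBinom {q : F} (hq : q ≠ 0) (n r : ℕ) :
    qdiff q (r + 1) * gaussBinom q n (r + 1) = qdiff q (n - r) * gaussBinom q n r := by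
  induction n generalizing r with
  | zero =>
    cases r with
    | zero => simp [gaussBinom, qdiff]
    | succ r => simp [gaussBinom]
  | succ n ih =>
    have key : ∀ s : ℕ, qdiff q (s + 1) * gaussBinom q (n + 1) (s + 1)
        = qdiff q (n + 1) * gaussBinom q n s := by
      intro s
      rw [gaussBinom_succ_succ, mul_add, mul_left_comm, ih s]
      have : q ^ (-((s : ℤ) + 1)) * qdiff q (n - s) + qdiff q (s + 1) * q ^ ((n : ℤ) - s)
          = qdiff q (n + 1) := by
        simp only [qdiff, mul_sub, sub_mul, ← zpow_add₀ hq]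
        ring_nf
      rw [← this]; ring
    rw [key r]
    cases r with
    | zero => simp
    | succ r =>
      rw [gaussBinom_succ_succ, mul_add, mul_left_comm (qdiff q _) (q ^ _) (gaussBinom q n r)]
      have h2 := ih r
      have e1 : ((n + 1 : ℕ) : ℤ) - ((r + 1 : ℕ) : ℤ) = n - r := by push_cast; ring
      rw [e1, ← h2]
      have : q ^ (-((r : ℤ) + 1)) * qdiff q (n - r) + qdiff q (r + 1) * q ^ ((n : ℤ) - r)
          = qdiff q (n + 1) := by
        simp only [qdiff, mul_sub, sub_mul, ← zpow_add₀ hq]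
        ring_nf
      rw [← this]; ring

theorem qdiff_succ_mul_gaussBinom_succ {q : F} (hq : q ≠ 0) (n r : ℕ) :
    qdiff q (r + 1) * gaussBinom q (n + 1) (r + 1) = qdiff q (n + 1) * gaussBinom q n r := by
  rw [gaussBinom_succ_succ, mul_add, mul_left_comm, qdiff_succ_mul_gaussBinom hq]
  have : q ^ (-((r : ℤ) + 1)) * qdiff q (n - r) + qdiff q (r + 1) * q ^ ((n : ℤ) - r)
      = qdiff q (n + 1) := by
    simp only [qdiff, mul_sub, sub_mul, ← zpow_add₀ hq]
    ring_nf
  rw [← this]; ring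

theorem qdiff_sub_mul_gaussBinom_succ {q : F} (hq : q ≠ 0) (n r : ℕ) :
    qdiff q (n + 1 - r) * gaussBinom q (n + 1) r = qdiff q (n + 1) * gaussBinom q n r := by
  have h := qdiff_succ_mul_gaussBinom hq (n + 1) r
  push_cast at h
  rw [← h, qdiff_succ_mul_gaussBinom_succ hq]

variable {S : Type*} [Ring S] [Algebra F S]

/-- `∑ (-1)^r [n r] x^r v x^(n-r)`. -/
def serreSum (q : F) (n : ℕ) (x v : S) : S :=
  ∑ r ∈ Finset.range (n + 1), ((-1) ^ r * gaussBinom q n r) • (x ^ r * v * x ^ (n - r))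

/-- `∑ (-c)^r [k r] y^r x^(k-r)`. -/
def twistedSum (q c : F) (k : ℕ) (x y : S) : S :=
  ∑ r ∈ Finset.range (k + 1), ((-c) ^ r * gaussBinom q k r) • (y ^ r * x ^ (k - r))

theorem twistedSum_succ {q : F} (hq : q ≠ 0) (c : F) (k : ℕ) (x y : S) :
    twistedSum q (q * c) (k + 1) x y
      = twistedSum q c k x y * x - (c * q ^ (k + 1)) • (y * twistedSum q c k x y) := by
  have h1 : twistedSum q c k x y * x = ∑ r ∈ Finset.range (k + 2),
      ((-c) ^ r * gaussBinom q k r) • (y ^ r * x ^ (k + 1 - r)) := by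
    rw [Finset.sum_range_succ, gaussBinom_eq_zero q (Nat.lt_succ_self k)]
    simp only [mul_zero, zero_smul, add_zero, twistedSum, Finset.sum_mul]
    refine Finset.sum_congr rfl fun r hr => ?_
    rw [Finset.mem_range] at hr
    rw [Nat.sub_add_comm (by omega), pow_succ, smul_mul_assoc, mul_assoc]
  rw [h1, Finset.sum_range_succ', twistedSum, Finset.sum_range_succ', twistedSum,
    Finset.mul_sum, Finset.smul_sum]
  have : ∀ a b c d : S, a = b - d → a + c = b + c - d := by intros; subst_vars; abel
  simp only [gaussBinom_zero_right, pow_zero]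
  refine this _ _ _ _ ?_
  rw [← Finset.sum_sub_distrib]
  refine Finset.sum_congr rfl fun r hr => ?_
  rw [Finset.mem_range] at hr
  rw [mul_smul_comm, smul_smul, ← mul_assoc y, ← pow_succ' y, Nat.add_sub_add_right, ← sub_smul,
    gaussBinom_succ_succ]
  congr 1
  have e1 : (-(q * c)) ^ (r + 1) = (-c) ^ (r + 1) * q ^ (r + 1) := by
    rw [← mul_pow]; ring_nf
  have e2 : q ^ (r + 1) * q ^ (-((r : ℤ) + 1)) = 1 := by
    rw [← zpow_natCast, ← zpow_add₀ hq]; simp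
  have e3 : q ^ (r + 1) * q ^ ((k : ℤ) - r) = q ^ (k + 1) := by
    rw [← zpow_natCast, ← zpow_add₀ hq, ← zpow_natCast]; congr 1; push_cast; ring
  rw [e1]
  calc _ = (-c) ^ (r + 1) * ((q ^ (r + 1) * q ^ (-((r : ℤ) + 1))) * gaussBinom q k (r + 1)
        + (q ^ (r + 1) * q ^ ((k : ℤ) - r)) * gaussBinom q k r) := by ring
    _ = _ := by rw [e2, e3]; ring

theorem pow_mul_of_qcomm {Q : F} {X Z : S} (hZX : Z * X = Q • (X * Z)) (k : ℕ) :
    Z * X ^ k = Q ^ k • (X ^ k * Z) := by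
  induction k with
  | zero => simp
  | succ k ih =>
    rw [pow_succ, ← mul_assoc, ih, smul_mul_assoc, mul_assoc, hZX, mul_smul_comm, smul_smul,
      ← mul_assoc, pow_succ]

theorem exists_twistedSum_eq {q : F} (hq : q ≠ 0) (c a : F) (hac : a * (c * q) = 1)
    {X Z : S} (hZX : Z * X = (q ^ 2)⁻¹ • (X * Z)) (k : ℕ) :
    ∃ μ : F, twistedSum q (q ^ k * c) k (a • X - Z) (X - a • Z) = μ • X ^ k ∧
      (∀ m, k = m + 1 → a = q ^ m → μ = 0) := by
  induction k with
  | zero => exact ⟨1, by simp [twistedSum], by simp⟩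
  | succ k ih =>
    obtain ⟨μ, h, -⟩ := ih
    refine ⟨μ * (a - c * q ^ (2 * k + 1)), ?_, ?_⟩
    · have := twistedSum_succ hq (q ^ k * c) k (a • X - Z) (X - a • Z)
      rw [← mul_assoc, ← pow_succ'] at this
      rw [this, h]
      have hz := pow_mul_of_qcomm hZX k
      have e1 : (q ^ k * c * q ^ (k + 1)) = c * q ^ (2 * k + 1) := by ring
      have e2 : (c * q ^ (2 * k + 1)) * (a * ((q ^ 2)⁻¹) ^ k) = 1 := by
        have : q ^ (2 * k) * ((q ^ 2)⁻¹) ^ k = 1 := by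
          rw [pow_mul, ← mul_pow, mul_inv_cancel₀ (pow_ne_zero _ hq), one_pow]
        calc _ = (a * (c * q)) * (q ^ (2 * k) * ((q ^ 2)⁻¹) ^ k) := by ring
          _ = 1 := by rw [hac, this, one_mul]
      rw [e1]
      simp only [sub_mul, mul_sub, smul_mul_assoc, mul_smul_comm, hz, smul_sub, smul_smul]
      rw [← pow_succ', ← pow_succ X k]
      rw [show c * q ^ (2 * k + 1) * (μ * (a * (q ^ 2)⁻¹ ^ k))
        = μ * (c * q ^ (2 * k + 1) * (a * ((q ^ 2)⁻¹) ^ k)) by ring, e2]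
      module
    · intro m hm ha
      obtain rfl : k = m := by omega
      have : q ^ k * (c * q) = 1 := ha ▸ hac
      have : c * q ^ (2 * k + 1) = q ^ k := by
        calc _ = q ^ k * (q ^ k * (c * q)) := by ring
          _ = _ := by rw [this, mul_one]
      rw [this, ha, sub_self, mul_zero]

/-- The Serre combination vanishes on an element twisted-commuting with a current. -/
theorem serreSum_eq_zero_of_twist {q : F} (hq : q ≠ 0) (m : ℕ) {X Z η : S}
    (hZX : Z * X = (q ^ 2)⁻¹ • (X * Z))
    (hη : (q ^ m • X - Z) * η = η * (X - q ^ m • Z)) :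
    serreSum q (m + 1) (q ^ m • X - Z) η = 0 := by
  have hc : q ^ m * ((q ^ (m + 1))⁻¹ * q) = 1 := by
    rw [pow_succ]; field_simp
  obtain ⟨μ, h, hμ⟩ := exists_twistedSum_eq hq (q ^ (m + 1))⁻¹ (q ^ m) hc hZX (m + 1)
  rw [hμ m rfl rfl, zero_smul, mul_inv_cancel₀ (pow_ne_zero _ hq)] at h
  have hpow : ∀ r : ℕ, (q ^ m • X - Z) ^ r * η = η * (X - q ^ m • Z) ^ r := by
    intro r
    induction r with
    | zero => simp
    | succ r ih => rw [pow_succ, mul_assoc, hη, ← mul_assoc, ih, mul_assoc, pow_succ]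
  calc _ = η * twistedSum q 1 (m + 1) (q ^ m • X - Z) (X - q ^ m • Z) := by
        rw [serreSum, twistedSum, Finset.mul_sum]
        refine Finset.sum_congr rfl fun r _ => ?_
        rw [hpow, mul_smul_comm, mul_assoc]
    _ = 0 := by rw [h, mul_zero]

end DrinfeldSerre

namespace DrinfeldSerre

variable {F : Type*} [Field F] {S : Type*} [Ring S] [Algebra F S]

/-- The element `x + ε y` of the dual numbers. -/
def dual (x y : S) : DualNumber S := TrivSqZeroExt.inl x + TrivSqZeroExt.inr y

@[simp] theorem fst_dual (x y : S) : (dual x y).fst = x := by simp [dual]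
@[simp] theorem snd_dual (x y : S) : (dual x y).snd = y := by simp [dual]

@[simp] theorem fst_dual_pow (x y : S) (r : ℕ) : ((dual x y) ^ r).fst = x ^ r := by
  rw [TrivSqZeroExt.fst_pow, fst_dual]

theorem snd_dual_pow_succ (x y : S) (r : ℕ) :
    ((dual x y) ^ (r + 1)).snd = x ^ r * y + ((dual x y) ^ r).snd * x := by
  rw [pow_succ, DualNumber.snd_mul, fst_dual_pow, fst_dual, snd_dual]

theorem snd_dual_pow_succ' (x y : S) (r : ℕ) :
    ((dual x y) ^ (r + 1)).snd = x * ((dual x y) ^ r).snd + y * x ^ r := by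
  rw [pow_succ', DualNumber.snd_mul, fst_dual_pow, fst_dual, snd_dual]

section Twist

variable {Q : F} {X Z : S}

theorem pow_succ_twist (hZX : Z * X = Q • (X * Z)) (k : ℕ) :
    (Q • X - Z) ^ (k + 1) = (Q ^ (k + 1) • X - Z) * (X - Z) ^ k := by
  induction k with
  | zero => simp
  | succ k ih =>
    have h : (Q • X - Z) * (Q ^ (k + 1) • X - Z) = (Q ^ (k + 2) • X - Z) * (X - Z) := by
      simp only [sub_mul, mul_sub, smul_mul_assoc, mul_smul_comm, hZX]
      module
    rw [pow_succ', ih, ← mul_assoc, h, mul_assoc, ← pow_succ']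

theorem pow_succ_twist' (hZX : Z * X = Q • (X * Z)) (k : ℕ) :
    (X - Q • Z) ^ (k + 1) = (X - Z) ^ k * (X - Q ^ (k + 1) • Z) := by
  induction k with
  | zero => simp
  | succ k ih =>
    have h : (X - Q ^ (k + 1) • Z) * (X - Q • Z) = (X - Z) * (X - Q ^ (k + 2) • Z) := by
      simp only [sub_mul, mul_sub, smul_mul_assoc, mul_smul_comm, hZX]
      module
    rw [pow_succ, ih, mul_assoc, h, ← mul_assoc, ← pow_succ]

theorem pow_twist (hZX : Z * X = Q • (X * Z)) (k : ℕ) :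
    (Q • X - Z) ^ k = Q ^ k • (X - Z) ^ k - (1 - Q ^ k) • (Z * (X - Z) ^ (k - 1)) := by
  cases k with
  | zero => simp
  | succ k =>
    rw [pow_succ_twist hZX, Nat.add_sub_cancel, pow_succ' (X - Z)]
    simp only [sub_mul, smul_mul_assoc]
    module

theorem pow_twist' (hZX : Z * X = Q • (X * Z)) (k : ℕ) :
    (X - Q • Z) ^ k = (X - Z) ^ k + (1 - Q ^ k) • ((X - Z) ^ (k - 1) * Z) := by
  cases k with
  | zero => simp
  | succ k =>
    rw [pow_succ_twist' hZX, Nat.add_sub_cancel, pow_succ (X - Z)]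
    simp only [mul_sub, mul_smul_comm]
    module

theorem pow_mul_twist {x x' η : S} (h : x * η = η * x') (r : ℕ) :
    x ^ r * η = η * x' ^ r := by
  induction r with
  | zero => simp
  | succ r ih => rw [pow_succ, mul_assoc, h, ← mul_assoc, ih, mul_assoc, pow_succ]

theorem smul_snd_dual_pow (hZX : Z * X = Q • (X * Z)) {η : S}
    (hη : (Q • X - Z) * η = η * (X - Q • Z)) (r : ℕ) :
    (1 - Q) • ((dual (Q • X - Z) η) ^ r).snd = (1 - Q ^ r) • (η * (X - Z) ^ (r - 1)) := by
  induction r with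
  | zero => simp
  | succ r ih =>
    rw [snd_dual_pow_succ', smul_add, ← mul_smul_comm, ih, mul_smul_comm, ← mul_assoc, hη,
      Nat.add_sub_cancel]
    cases r with
    | zero => simp
    | succ r =>
      have h : (1 - Q ^ (r + 1)) • (X - Q • Z) + (1 - Q) • (Q ^ (r + 1) • X - Z)
          = (1 - Q ^ (r + 1 + 1)) • (X - Z) := by module
      calc _ = η * (((1 - Q ^ (r + 1)) • (X - Q • Z) + (1 - Q) • (Q ^ (r + 1) • X - Z))
            * (X - Z) ^ r) := by
            rw [pow_succ_twist hZX]
            simp only [add_mul, mul_add, smul_mul_assoc, mul_smul_comm, mul_assoc,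
              Nat.add_sub_cancel]
        _ = _ := by rw [h, pow_succ' (X - Z), smul_mul_assoc, mul_smul_comm]

end Twist

theorem sum_shift {q : F} (hq : q ≠ 0) (m : ℕ) (s Y : S) :
    ∑ r ∈ Finset.range (m + 1), ((-1) ^ r * gaussBinom q m r * qdiff q r) •
        (s ^ (r - 1) * Y * s ^ (m - r))
      = -∑ r ∈ Finset.range (m + 1), ((-1) ^ r * gaussBinom q m r * qdiff q (m - r)) •
        (s ^ r * Y * s ^ (m - r - 1)) := by
  rw [Finset.sum_range_succ', Finset.sum_range_succ]
  simp only [qdiff, Nat.cast_zero, neg_zero, sub_self, mul_zero, zero_smul, add_zero]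
  rw [← Finset.sum_neg_distrib]
  refine Finset.sum_congr rfl fun r _ => ?_
  have := qdiff_succ_mul_gaussBinom hq m r
  simp only [qdiff] at this
  rw [← neg_smul, Nat.add_sub_cancel, Nat.sub_sub]
  congr 1
  push_cast
  rw [pow_succ]
  linear_combination (-(-1) ^ r) * this

theorem linearized_sum_eq_zero {q : F} (hq : q ≠ 0) (m : ℕ) {X Z V W : S}
    (hZX : Z * X = (q⁻¹ ^ 2) • (X * Z))
    (hVW : Z * V + W * X = q ^ m • (V * Z + X * W)) :
    ∑ r ∈ Finset.range (m + 1), ((-1) ^ r * gaussBinom q m r) •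
      (q⁻¹ ^ (m - r) • ((X - q⁻¹ ^ 2 • Z) ^ r * (V - q ^ m • W) * (X - Z) ^ (m - r))
        - q⁻¹ ^ r • ((X - Z) ^ r * (q ^ m • V - W) * (q⁻¹ ^ 2 • X - Z) ^ (m - r))) = 0 := by
  set s := X - Z with hs
  set v := q ^ m • V - W with hv
  set v' := V - q ^ m • W with hv'
  have hpq : q⁻¹ * q = 1 := inv_mul_cancel₀ hq
  have hdiff : ∀ k : ℕ, qdiff q k = q ^ k - q⁻¹ ^ k := by intro k; simp [qdiff]
  have hpow : ∀ k : ℕ, q⁻¹ ^ k * q ^ k = 1 := by intro k; rw [← mul_pow, hpq, one_pow]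
  have h1 : ∀ r ∈ Finset.range (m + 1), ((-1) ^ r * gaussBinom q m r) •
      (q⁻¹ ^ (m - r) • ((X - q⁻¹ ^ 2 • Z) ^ r * v' * s ^ (m - r))
        - q⁻¹ ^ r • (s ^ r * v * (q⁻¹ ^ 2 • X - Z) ^ (m - r)))
      = ((-1) ^ r * gaussBinom q m r) • (s ^ r * (q⁻¹ ^ (m - r) • v'
          - (q⁻¹ ^ r * (q⁻¹ ^ 2) ^ (m - r)) • v) * s ^ (m - r))
        + q⁻¹ ^ m • (((-1) ^ r * gaussBinom q m r * qdiff q (m - r)) •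
            (s ^ r * (v * Z) * s ^ (m - r - 1))
          + ((-1) ^ r * gaussBinom q m r * qdiff q r) •
            (s ^ (r - 1) * (Z * v') * s ^ (m - r))) := by
    intro r hr
    rw [Finset.mem_range] at hr
    obtain ⟨k, rfl⟩ : ∃ k, m = r + k := ⟨m - r, by omega⟩
    rw [Nat.add_sub_cancel_left]
    have ek : (((r + k : ℕ) : ℤ) - r) = (k : ℕ) := by push_cast; ring
    rw [ek, hdiff, hdiff, pow_twist hZX, pow_twist' hZX]
    have a1 : q⁻¹ ^ (r + k) * (q ^ k - q⁻¹ ^ k) = q⁻¹ ^ r * (1 - (q⁻¹ ^ 2) ^ k) := by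
      rw [← pow_mul, pow_add]
      linear_combination q⁻¹ ^ r * hpow k
    have a2 : q⁻¹ ^ (r + k) * (q ^ r - q⁻¹ ^ r) = q⁻¹ ^ k * (1 - (q⁻¹ ^ 2) ^ r) := by
      rw [← pow_mul, pow_add]
      linear_combination q⁻¹ ^ k * hpow r
    simp only [smul_add, smul_smul, mul_left_comm (q⁻¹ ^ (r + k)), a1, a2]
    rw [← hs]
    simp only [add_mul, mul_sub, sub_mul, smul_mul_assoc, mul_smul_comm, smul_sub,
      smul_add, smul_smul, mul_assoc]
    module
  rw [Finset.sum_congr rfl h1, Finset.sum_add_distrib, ← Finset.smul_sum, Finset.sum_add_distrib,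
    sum_shift hq, ← sub_eq_add_neg, ← Finset.sum_sub_distrib]
  have hkey : v * Z - Z * v' = W * s - q ^ m • (s * W) := by
    rw [hv, hv', hs]
    simp only [mul_sub, sub_mul, smul_mul_assoc, mul_smul_comm, smul_sub]
    have := hVW
    rw [smul_add] at this
    rw [eq_comm, ← sub_eq_zero] at this
    rw [← sub_eq_zero, ← this]; abel
  have h2 : ∑ r ∈ Finset.range (m + 1),
      (((-1) ^ r * gaussBinom q m r * qdiff q (m - r)) • (s ^ r * (v * Z) * s ^ (m - r - 1))
        - ((-1) ^ r * gaussBinom q m r * qdiff q (m - r)) • (s ^ r * (Z * v') * s ^ (m - r - 1)))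
      = ∑ r ∈ Finset.range (m + 1), ((-1) ^ r * gaussBinom q m r
          * (qdiff q (m - r) + q ^ m * qdiff q r)) • (s ^ r * W * s ^ (m - r)) := by
    have h3 : ∀ r ∈ Finset.range (m + 1),
        (((-1) ^ r * gaussBinom q m r * qdiff q (m - r)) • (s ^ r * (v * Z) * s ^ (m - r - 1))
          - ((-1) ^ r * gaussBinom q m r * qdiff q (m - r)) •
            (s ^ r * (Z * v') * s ^ (m - r - 1)))
        = ((-1) ^ r * gaussBinom q m r * qdiff q (m - r)) • (s ^ r * W * s ^ (m - r))
          - q ^ m • (((-1) ^ r * gaussBinom q m r * qdiff q (m - r)) •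
            (s ^ r * (s * W) * s ^ (m - r - 1))) := by
      intro r hr
      rw [Finset.mem_range] at hr
      rw [← smul_sub, ← sub_mul, ← mul_sub, hkey, smul_comm, ← smul_sub]
      rcases Nat.eq_or_lt_of_le (Nat.lt_succ_iff.mp hr) with rfl | hlt
      · simp [qdiff]
      · congr 1
        rw [mul_sub, sub_mul, ← mul_assoc, mul_assoc _ s, ← pow_succ', mul_smul_comm,
          smul_mul_assoc, show m - r - 1 + 1 = m - r by omega]
    rw [Finset.sum_congr rfl h3, Finset.sum_sub_distrib, ← Finset.smul_sum, sub_eq_add_neg,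
      ← smul_neg, ← sum_shift hq, Finset.smul_sum, ← Finset.sum_add_distrib]
    refine Finset.sum_congr rfl fun r _ => ?_
    cases r with
    | zero => simp [qdiff]
    | succ r =>
      rw [Nat.add_sub_cancel, ← mul_assoc (s ^ r), ← pow_succ]
      module
  rw [h2, Finset.smul_sum, ← Finset.sum_add_distrib]
  refine Finset.sum_eq_zero fun r hr => ?_
  rw [Finset.mem_range] at hr
  obtain ⟨k, rfl⟩ : ∃ k, m = r + k := ⟨m - r, by omega⟩
  rw [Nat.add_sub_cancel_left]
  have ek : (((r + k : ℕ) : ℤ) - r) = (k : ℕ) := by push_cast; ring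
  rw [ek, hdiff, hdiff, smul_smul, mul_left_comm,
    mul_smul ((-1) ^ r * gaussBinom q (r + k) r), ← smul_add]
  convert smul_zero _
  rw [← smul_mul_assoc, ← mul_smul_comm, ← add_mul, ← mul_add]
  convert zero_mul _
  convert mul_zero _
  rw [hv, hv', smul_sub, smul_sub, smul_smul, smul_smul]
  have c1 : q⁻¹ ^ r * (q⁻¹ ^ 2) ^ k * q ^ (r + k) = q⁻¹ ^ k := by
    rw [← pow_mul, pow_add, two_mul, pow_add]
    linear_combination q⁻¹ ^ k * (hpow r * (q⁻¹ ^ k * q ^ k) + hpow k)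
  have c2 : q⁻¹ ^ (r + k) * (q ^ k - q⁻¹ ^ k + q ^ (r + k) * (q ^ r - q⁻¹ ^ r))
      = q⁻¹ ^ k * q ^ (r + k) - q⁻¹ ^ r * (q⁻¹ ^ 2) ^ k := by
    rw [← pow_mul, two_mul]
    simp only [pow_add]
    linear_combination (q⁻¹ ^ r + q ^ r - q⁻¹ ^ r - q ^ r ) * hpow k
      + (q⁻¹ ^ k * q ^ k * (q ^ r - q⁻¹ ^ r)) * hpow r
  rw [c1, c2]
  module

/-- The Serre combination is annihilated by a derivation whose value on the repeated current
twisted-commutes with both currents. -/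
theorem snd_serreSum_dual_eq_zero {q : F} (hq : q ≠ 0) (hq2 : q ^ 2 ≠ 1) (m : ℕ) {X Z V W η : S}
    (hZX : Z * X = (q⁻¹ ^ 2) • (X * Z))
    (hVW : Z * V + W * X = q ^ m • (V * Z + X * W))
    (hxη : (q⁻¹ ^ 2 • X - Z) * η = η * (X - q⁻¹ ^ 2 • Z))
    (hvη : (q ^ m • V - W) * η = η * (V - q ^ m • W)) :
    (serreSum q (m + 1) (dual (q⁻¹ ^ 2 • X - Z) η) (dual (q ^ m • V - W) 0)).snd = 0 := by
  have hQ : (1 - q⁻¹ ^ 2) ≠ 0 := by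
    intro h
    apply hq2
    rw [sub_eq_zero, inv_pow, eq_comm, inv_eq_one] at h
    exact h
  have hF := linearized_sum_eq_zero hq m hZX hVW
  set s := X - Z with hs
  set x := q⁻¹ ^ 2 • X - Z with hx
  set x' := X - q⁻¹ ^ 2 • Z with hx'
  set v := q ^ m • V - W with hv
  set v' := V - q ^ m • W with hv'
  have hdual := smul_snd_dual_pow hZX hxη
  have h0 : (1 - q⁻¹ ^ 2) • (serreSum q (m + 1) (dual x η) (dual v 0)).snd =
      η * ∑ r ∈ Finset.range (m + 2), ((-1) ^ r * gaussBinom q (m + 1) r) •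
        ((1 - (q⁻¹ ^ 2) ^ (m + 1 - r)) • (x' ^ r * v' * s ^ (m + 1 - r - 1)) +
          (1 - (q⁻¹ ^ 2) ^ r) • (s ^ (r - 1) * v * x ^ (m + 1 - r))) := by
    rw [serreSum, ← TrivSqZeroExt.sndHom_apply, map_sum, Finset.smul_sum, Finset.mul_sum]
    refine Finset.sum_congr rfl fun r _ => ?_
    rw [TrivSqZeroExt.sndHom_apply, TrivSqZeroExt.snd_smul, DualNumber.snd_mul,
      DualNumber.snd_mul, TrivSqZeroExt.fst_mul, fst_dual_pow, fst_dual_pow, fst_dual, snd_dual,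
      mul_zero, zero_add, smul_comm, smul_add, ← mul_smul_comm, hdual,
      ← smul_mul_assoc (1 - q⁻¹ ^ 2), ← smul_mul_assoc (1 - q⁻¹ ^ 2), hdual,
        mul_smul_comm, mul_smul_comm]
    congr 1
    rw [mul_add, mul_smul_comm, mul_smul_comm, smul_mul_assoc]
    congr 2
    · rw [← mul_assoc, mul_assoc _ v, hvη, ← mul_assoc, pow_mul_twist hxη]
      simp only [mul_assoc, hs]
    · simp only [mul_assoc, smul_mul_assoc, hs]
  have h1 : ∑ r ∈ Finset.range (m + 2), ((-1) ^ r * gaussBinom q (m + 1) r) •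
        ((1 - (q⁻¹ ^ 2) ^ (m + 1 - r)) • (x' ^ r * v' * s ^ (m + 1 - r - 1)) +
          (1 - (q⁻¹ ^ 2) ^ r) • (s ^ (r - 1) * v * x ^ (m + 1 - r)))
      = (q⁻¹ * qdiff q (m + 1)) • ∑ r ∈ Finset.range (m + 1), ((-1) ^ r * gaussBinom q m r) •
      (q⁻¹ ^ (m - r) • (x' ^ r * v' * s ^ (m - r)) - q⁻¹ ^ r • (s ^ r * v * x ^ (m - r))) := by
    simp only [smul_add, smul_sub]
    rw [Finset.sum_add_distrib, Finset.sum_range_succ, Finset.sum_range_succ' (n := m + 1)]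
    simp only [Nat.sub_self, pow_zero, sub_self, zero_smul, smul_zero, add_zero]
    rw [← Finset.sum_add_distrib, Finset.smul_sum]
    refine Finset.sum_congr rfl fun r hr => ?_
    rw [Finset.mem_range] at hr
    have hpow : ∀ k : ℕ, q⁻¹ ^ k * q ^ k = 1 := by
      intro k; rw [← mul_pow, inv_mul_cancel₀ hq, one_pow]
    have hdiff : ∀ k : ℕ, (1 - (q⁻¹ ^ 2) ^ k) = q⁻¹ ^ k * qdiff q k := by
      intro k
      simp only [qdiff, zpow_natCast, zpow_neg, ← inv_pow]
      rw [← pow_mul, two_mul, pow_add]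
      linear_combination -(hpow k)
    obtain ⟨k, rfl⟩ : ∃ k, m = r + k := ⟨m - r, by omega⟩
    rw [show r + k + 1 - r = k + 1 by omega, show r + k + 1 - (r + 1) = k by omega,
      Nat.add_sub_cancel, Nat.add_sub_cancel, Nat.add_sub_cancel_left, hdiff, hdiff]
    have g1 := qdiff_succ_mul_gaussBinom_succ hq (r + k) r
    have g2 := qdiff_sub_mul_gaussBinom_succ hq (r + k) r
    rw [show (((r + k : ℕ) : ℤ) + 1 - r) = ((k + 1 : ℕ) : ℤ) by push_cast; ring] at g2
    rw [smul_sub, sub_eq_add_neg]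
    simp only [smul_smul]
    rw [← neg_smul]
    congr 2
    · rw [pow_succ]; push_cast at g2 ⊢; linear_combination ((-1) ^ r * q⁻¹ ^ k * q⁻¹) * g2
    · rw [pow_succ, pow_succ]; push_cast at g1 ⊢
      linear_combination (-(-1) ^ r * q⁻¹ ^ r * q⁻¹) * g1
  rw [h1, hF, smul_zero, mul_zero] at h0
  exact (smul_eq_zero.mp h0).resolve_left hQ

end DrinfeldSerre

namespace DrinfeldSerre

section Polarization

variable {F : Type*} [Field F]

theorem sum_perm_multilinear {M M' : Type*} [AddCommGroup M] [Module F M] [AddCommGroup M']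
    [Module F M'] {n : ℕ} (f : MultilinearMap F (fun _ : Fin n => M) M') (x : Fin n → M) :
    ∑ σ : Equiv.Perm (Fin n), f (fun t => x (σ t))
      = ∑ U : Finset (Fin n), (-1 : ℤ) ^ U.card • f (fun _ => ∑ s ∈ Uᶜ, x s) := by
  have h1 : ∀ U : Finset (Fin n), f (fun _ => ∑ s ∈ Uᶜ, x s)
      = ∑ g : Fin n → Fin n, if U ⊆ (Finset.univ.image g)ᶜ then f (fun t => x (g t)) else 0 := by
    intro U
    rw [f.map_sum_finset (fun _ s => x s) (fun _ => Uᶜ), ← Finset.sum_filter]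
    refine Finset.sum_congr ?_ fun _ _ => rfl
    ext g
    simp only [Fintype.mem_piFinset, Finset.mem_compl, Finset.mem_filter, Finset.mem_univ,
      true_and, Finset.subset_iff, Finset.mem_image, not_exists]
    constructor
    · intro h u hu t ht; exact h t (ht ▸ hu)
    · intro h t ht; exact h ht t rfl
  simp only [h1, Finset.smul_sum]
  rw [Finset.sum_comm]
  have h2 : ∀ g : Fin n → Fin n, (∑ U : Finset (Fin n), (-1 : ℤ) ^ U.card •
      (if U ⊆ (Finset.univ.image g)ᶜ then f (fun t => x (g t)) else 0))
      = if Function.Surjective g then f (fun t => x (g t)) else 0 := by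
    intro g
    have : ∀ U : Finset (Fin n), (-1 : ℤ) ^ U.card •
      (if U ⊆ (Finset.univ.image g)ᶜ then f (fun t => x (g t)) else 0)
        = if U ∈ ((Finset.univ.image g)ᶜ).powerset then
          (-1 : ℤ) ^ U.card • f (fun t => x (g t)) else 0 := by
      intro U; simp only [Finset.mem_powerset]; split_ifs <;> simp
    simp only [this]
    rw [Finset.sum_ite_mem, Finset.univ_inter, ← Finset.sum_smul,
      Finset.sum_powerset_neg_one_pow_card]
    have hs : (Finset.univ.image g)ᶜ = ∅ ↔ Function.Surjective g := by
      rw [Finset.compl_eq_empty_iff, Finset.eq_univ_iff_forall]; simp [Function.Surjective]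
    by_cases h : Function.Surjective g
    · rw [if_pos h, if_pos (hs.mpr h), one_smul]
    · rw [if_neg h, if_neg (fun h' => h (hs.mp h')), zero_smul]
  simp only [h2]
  rw [← Finset.sum_filter]
  refine Finset.sum_bij (fun σ _ => (σ : Fin n → Fin n)) ?_ ?_ ?_ ?_
  · intro σ _; simp [σ.surjective]
  · intro σ _ τ _ h; exact Equiv.coe_fn_injective h
  · intro g hg
    rw [Finset.mem_filter] at hg
    exact ⟨Equiv.ofBijective g ⟨Finite.injective_iff_surjective.mpr hg.2, hg.2⟩,
      Finset.mem_univ _, rfl⟩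
  · intros; rfl

theorem ofFn_insertNth {T : Type*} {n : ℕ} (p : Fin (n + 1)) (v : T) (y : Fin n → T) :
    List.ofFn (p.insertNth (α := fun _ => T) v y) = ((List.finRange n).take p).map y ++
      v :: ((List.finRange n).drop p).map y := by
  have hp := p.isLt
  refine List.ext_getElem ?_ fun i h1 h2 => ?_
  · simp; omega
  · rw [List.getElem_ofFn]
    have hi : i < n + 1 := by simpa using h1
    rw [List.getElem_append]
    rcases lt_trichotomy i p with h | h | h
    · rw [dif_pos (by simp; omega), Fin.insertNth_apply_below (by simpa [Fin.lt_def] using h)]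
      simp
      rfl
    · rw [dif_neg (by simp; omega)]
      have : (⟨i, hi⟩ : Fin (n + 1)) = p := Fin.ext h
      rw [this, Fin.insertNth_apply_same]
      simp [h, min_eq_left (Nat.lt_succ_iff.mp hp)]
    · rw [dif_neg (by simp; omega), Fin.insertNth_apply_above (by simpa [Fin.lt_def] using h)]
      obtain ⟨k, rfl⟩ := Nat.exists_eq_add_of_lt h
      simp only [List.length_map, List.length_take, List.length_finRange,
        min_eq_left (Nat.lt_succ_iff.mp hp), show (p : ℕ) + k + 1 - p = k + 1 by omega,
        List.getElem_cons_succ, List.getElem_map, List.getElem_drop, List.getElem_finRange,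
        eq_rec_constant]
      rfl

variable {T : Type*} [Ring T] [Algebra F T]

/-- The multilinear map `y ↦ y₁ ⋯ y_p v y_{p+1} ⋯ y_n`. -/
def insertProd (F : Type*) [Field F] {T : Type*} [Ring T] [Algebra F T] {n : ℕ} (p : Fin (n + 1))
    (v : T) : MultilinearMap F (fun _ : Fin n => T) T :=
  MultilinearMap.curryMid p (MultilinearMap.mkPiAlgebraFin F (n + 1) T) v

theorem insertProd_apply {n : ℕ} (p : Fin (n + 1)) (v : T) (y : Fin n → T) :
    insertProd F p v y = (((List.finRange n).take p).map y).prod * v *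
      (((List.finRange n).drop p).map y).prod := by
  have : insertProd F p v y = (List.ofFn (p.insertNth (α := fun _ => T) v y)).prod := by
    rw [insertProd, MultilinearMap.curryMid_apply_apply, MultilinearMap.mkPiAlgebraFin_apply]
  rw [this, ofFn_insertNth, List.prod_append, List.prod_cons, mul_assoc]

/-- The symmetrized Drinfeld-Serre combination of `x₁, …, x_n` and `v`. -/
def permSum (q : F) (n : ℕ) (x : Fin n → T) (v : T) : T :=
  ∑ σ : Equiv.Perm (Fin n), ∑ r ∈ Finset.range (n + 1), ((-1) ^ r * gaussBinom q n r) •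
    ((((List.finRange n).take r).map fun t => x (σ t)).prod * v *
      (((List.finRange n).drop r).map fun t => x (σ t)).prod)

theorem permSum_eq (q : F) (n : ℕ) (x : Fin n → T) (v : T) :
    permSum q n x v
      = ∑ U : Finset (Fin n), (-1 : ℤ) ^ U.card • serreSum q n (∑ s ∈ Uᶜ, x s) v := by
  rw [permSum, Finset.sum_comm]
  simp only [serreSum, Finset.smul_sum]
  rw [Finset.sum_comm (s := Finset.univ)]
  refine Finset.sum_congr rfl fun r hr => ?_
  rw [Finset.mem_range] at hr
  have h := sum_perm_multilinear (insertProd F ⟨r, hr⟩ v) x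
  simp only [insertProd_apply, List.map_const', List.prod_replicate, List.length_take,
    List.length_drop, List.length_finRange, min_eq_left (Nat.lt_succ_iff.mp hr)] at h
  rw [← Finset.smul_sum, h, Finset.smul_sum]
  refine Finset.sum_congr rfl fun U _ => ?_
  rw [smul_comm]

end Polarization

end DrinfeldSerre

namespace DrinfeldSerre

open PowerSeries

variable {F : Type*} [Field F] {R : Type*} [Ring R] [Algebra F R]

/-- The quadratic exchange relation between two currents. -/
def QC (b : F) (x y : ℤ → R) : Prop :=
  ∀ k l, x (k + 1) * y l + y (l + 1) * x k = b • (y l * x (k + 1) + x k * y (l + 1))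

theorem QC.symm {b : F} {x y : ℤ → R} (h : QC b x y) : QC b y x := fun k l => by
  rw [add_comm, h l k, add_comm]

theorem QC.shift {b : F} {x y : ℤ → R} (h : QC b x y) (m n : ℤ) :
    QC b (fun k => x (m + k)) (fun k => y (n + k)) := fun k l => by
  simpa only [add_assoc] using h (m + k) (n + l)

theorem QC.neg {b : F} (hb : b ≠ 0) {x y : ℤ → R} (h : QC b x y) :
    QC b⁻¹ (fun k => x (-k)) (fun k => y (-k)) := fun k l => by
  have := h (-(k + 1)) (-(l + 1))
  rw [neg_add_cancel_right', neg_add_cancel_right'] at this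
  rw [add_comm, eq_inv_smul_iff₀ hb, add_comm (y (-l) * _), ← this, add_comm]
where
  neg_add_cancel_right' {a : ℤ} : -(a + 1) + 1 = -a := by ring

theorem QC.sum {ι κ : Type*} {b : F} (s : Finset ι) (t : Finset κ) {x : ι → ℤ → R} {y : κ → ℤ → R}
    (h : ∀ i j, QC b (x i) (y j)) :
    QC b (fun k => ∑ i ∈ s, x i k) (fun k => ∑ j ∈ t, y j k) := fun k l => by
  simp only [Finset.sum_mul_sum]
  rw [Finset.sum_comm (s := t), Finset.sum_comm (s := t)]
  simp only [← Finset.sum_add_distrib, Finset.smul_sum]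
  exact Finset.sum_congr rfl fun i _ => Finset.sum_congr rfl fun j _ => h i j k l

/-- The formal series `∑ α^(-1-r) x_{k+r} t^r`. -/
def ser (α : F) (x : ℤ → R) (k : ℤ) : R⟦X⟧ :=
  PowerSeries.mk fun r => α⁻¹ ^ (r + 1) • x (k + r)

theorem C_eq_ser {α : F} (hα : α ≠ 0) (x : ℤ → R) (k : ℤ) :
    C (x k) = α • ser α x k - X * ser α x (k + 1) := by
  ext n
  cases n with
  | zero => simp [ser, smul_smul, hα]
  | succ n =>
    rw [coeff_C, if_neg (Nat.succ_ne_zero n), map_sub, coeff_succ_X_mul, coeff_smul, ser, ser,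
      coeff_mk, coeff_mk, smul_smul, pow_succ' α⁻¹ (n + 1), ← mul_assoc, mul_inv_cancel₀ hα,
      one_mul]
    rw [show k + ((n + 1 : ℕ) : ℤ) = k + 1 + n by push_cast; ring, sub_self]

theorem mul_X_mul (p q : R⟦X⟧) : p * (X * q) = X * (p * q) := by
  rw [← mul_assoc, ← X_mul, mul_assoc]

theorem C_mul_mk {α : F} (hα : α ≠ 0) {x y : ℤ → R} (h : QC α x y) (hy : ∀ l < 0, y l = 0)
    (k : ℤ) :
    C (x k) * PowerSeries.mk (fun n : ℕ => y n)
      = PowerSeries.mk (fun n : ℕ => y n) * (ser α x k - α • (X * ser α x (k + 1))) := by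
  set η : R⟦X⟧ := PowerSeries.mk (fun n : ℕ => y n) with hη
  set U : ℤ → R⟦X⟧ := fun k => C (x k) * η - η * (ser α x k - α • (X * ser α x (k + 1))) with hU
  have h1 : ∀ k, α • (C (x k) * η) - X * (C (x (k + 1)) * η)
      = η * C (x k) - α • (X * (η * C (x (k + 1)))) := by
    intro k
    ext n
    cases n with
    | zero =>
      have := h k (-1)
      simp only [hy (-1) (by norm_num), neg_add_cancel, mul_zero, zero_mul, zero_add] at this
      simp [hη, this]
    | succ n =>
      have := h k n
      simp only [map_sub, coeff_smul, coeff_succ_X_mul, coeff_C_mul, coeff_mul_C, hη, coeff_mk]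
      push_cast
      rw [smul_add] at this
      rw [sub_eq_sub_iff_add_eq_add, add_comm, add_comm (_ * _), ← sub_eq_zero]
      rw [← sub_eq_zero] at this
      rw [← neg_eq_zero, ← this]
      abel
  have h2 : ∀ k, α • U k = X * U (k + 1) := by
    intro k
    have e1 : α • (η * (ser α x k - α • (X * ser α x (k + 1))))
        - X * (η * (ser α x (k + 1) - α • (X * ser α x (k + 1 + 1))))
        = η * C (x k) - α • (X * (η * C (x (k + 1)))) := by
      rw [C_eq_ser hα x k, C_eq_ser hα x (k + 1)]
      simp only [mul_sub, smul_sub, mul_smul_comm, mul_X_mul]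
      abel
    rw [hU]
    simp only [smul_sub α (C (x k) * η), mul_sub X]
    rw [← sub_eq_zero, ← sub_eq_zero.mpr ((h1 k).trans e1.symm)]
    abel
  have h3 : ∀ n : ℕ, ∀ k, coeff n (U k) = 0 := by
    intro n
    induction n with
    | zero =>
      intro k
      have := congrArg (coeff 0) (h2 k)
      rw [coeff_smul, coeff_zero_X_mul] at this
      exact (smul_eq_zero.mp this).resolve_left hα
    | succ n ih =>
      intro k
      have := congrArg (coeff (n + 1)) (h2 k)
      rw [coeff_smul, coeff_succ_X_mul, ih] at this
      exact (smul_eq_zero.mp this).resolve_left hα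
  have : U k = 0 := by ext n; simpa using h3 n k
  exact sub_eq_zero.mp this

theorem ser_exchange {b α β : F} {x v : ℤ → R} (h : QC b x v) :
    (X * ser α x 1) * ser β v 0 + (X * ser β v 1) * ser α x 0
      = b • (ser β v 0 * (X * ser α x 1) + ser α x 0 * (X * ser β v 1)) := by
  have key : ser α x 1 * ser β v 0 + ser β v 1 * ser α x 0
      = b • (ser β v 0 * ser α x 1 + ser α x 0 * ser β v 1) := by
    ext n
    simp only [map_add, coeff_smul]
    rw [coeff_mul, coeff_mul, coeff_mul, coeff_mul]
    rw [← Finset.Nat.sum_antidiagonal_swap (f := fun p => coeff p.1 (ser β v 1) * _),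
      ← Finset.Nat.sum_antidiagonal_swap (f := fun p => coeff p.1 (ser β v 0) * _),
      ← Finset.sum_add_distrib, ← Finset.sum_add_distrib, Finset.smul_sum]
    refine Finset.sum_congr rfl fun p _ => ?_
    have := h p.1 p.2
    simp only [ser, coeff_mk, Prod.fst_swap, Prod.snd_swap, smul_mul_smul_comm, zero_add,
      add_comm (1 : ℤ)]
    rw [mul_comm (β⁻¹ ^ _), ← smul_add, ← smul_add, this, smul_comm]
  rw [mul_X_mul, mul_X_mul, mul_assoc, mul_assoc, ← mul_add, ← mul_add, key, mul_smul_comm]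

theorem ser_self_exchange [CharZero F] {b α : F} {x : ℤ → R} (h : QC b x x) :
    (X * ser α x 1) * ser α x 0 = b • (ser α x 0 * (X * ser α x 1)) := by
  have := ser_exchange (α := α) (β := α) h
  rw [← two_smul F, ← two_smul F (ser α x 0 * _), smul_comm] at this
  exact smul_right_injective _ (two_ne_zero' F) this

theorem coeff_serreSum (q : F) (n : ℕ) (a : R) (η : R⟦X⟧) (l : ℕ) :
    coeff l (serreSum q n (C a) η) = serreSum q n a (coeff l η) := by
  rw [serreSum, serreSum, map_sum]
  refine Finset.sum_congr rfl fun r _ => ?_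
  rw [coeff_smul, ← map_pow, ← map_pow, coeff_mul_C, coeff_C_mul]

theorem coeff_snd_dual_pow (a : R) (η : R⟦X⟧) (l r : ℕ) :
    coeff l ((dual (C a) η) ^ r).snd = ((dual a (coeff l η)) ^ r).snd := by
  induction r with
  | zero => simp
  | succ r ih =>
    rw [snd_dual_pow_succ, snd_dual_pow_succ, map_add, ← map_pow, coeff_C_mul, coeff_mul_C, ih]

theorem coeff_snd_serreSum_dual (q : F) (n : ℕ) (a v : R) (η : R⟦X⟧) (l : ℕ) :
    coeff l (serreSum q n (dual (C a) η) (dual (C v) 0)).snd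
      = (serreSum q n (dual a (coeff l η)) (dual v 0)).snd := by
  rw [serreSum, serreSum, ← TrivSqZeroExt.sndHom_apply, ← TrivSqZeroExt.sndHom_apply, map_sum,
    map_sum, map_sum]
  refine Finset.sum_congr rfl fun r _ => ?_
  simp only [TrivSqZeroExt.sndHom_apply, TrivSqZeroExt.snd_smul, DualNumber.snd_mul,
    TrivSqZeroExt.fst_mul, fst_dual_pow, fst_dual, snd_dual, mul_zero, zero_add, coeff_smul,
    map_add]
  rw [← map_pow, ← map_pow]
  simp only [mul_assoc, coeff_C_mul, coeff_snd_dual_pow]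
  rw [← map_mul, coeff_mul_C, coeff_snd_dual_pow]

theorem gaussBinom_inv {q : F} (hq : q ≠ 0) (n r : ℕ) :
    gaussBinom q⁻¹ n r = gaussBinom q n r := by
  induction n generalizing r with
  | zero => cases r <;> rfl
  | succ n ih =>
    cases r with
    | zero => simp
    | succ r =>
      rw [gaussBinom_succ_succ, gaussBinom_succ_succ, ih, ih, inv_zpow', inv_zpow']
      have := qdiff_succ_mul_gaussBinom hq n r
      simp only [qdiff] at this
      rw [neg_neg]
      linear_combination this

theorem serreSum_inv {q : F} (hq : q ≠ 0) (n : ℕ) (x v : R) :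
    serreSum q⁻¹ n x v = serreSum q n x v := by
  simp only [serreSum, gaussBinom_inv hq]

section Bounded

variable [CharZero F] {q : F} {m : ℕ} {x v y : ℤ → R}

theorem serreSum_eq_zero_of_bddBelow (hq : q ≠ 0) (hxx : QC (q⁻¹ ^ 2) x x)
    (hxy : QC (q ^ m) x y) (hy : ∃ b, ∀ l < b, y l = 0) (l : ℤ) :
    serreSum q (m + 1) (x 0) (y l) = 0 := by
  obtain ⟨b, hb⟩ := hy
  rcases lt_or_ge l b with h | h
  · simp [hb l h, serreSum]
  obtain ⟨n, rfl⟩ := Int.le.dest h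
  have hα := pow_ne_zero m hq
  have h1 := C_mul_mk hα (y := fun k => y (b + k)) (by simpa using hxy.shift 0 b)
    (fun l hl => hb _ (by omega)) 0
  rw [C_eq_ser hα, zero_add] at h1
  have h2 := serreSum_eq_zero_of_twist hq m (by
    rw [← inv_pow]; exact ser_self_exchange (α := q ^ m) hxx) h1
  have h3 := C_eq_ser hα x 0
  rw [zero_add] at h3
  rw [← h3] at h2
  simpa [coeff_serreSum] using congrArg (coeff n) h2

theorem snd_serreSum_eq_zero_of_bddBelow (hq : q ≠ 0) (hq2 : q ^ 2 ≠ 1)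
    (hxx : QC (q⁻¹ ^ 2) x x) (hxv : QC (q ^ m) x v)
    (hxy : QC (q⁻¹ ^ 2) x y) (hvy : QC (q ^ m) v y) (hy : ∃ b, ∀ l < b, y l = 0) (l : ℤ) :
    (serreSum q (m + 1) (dual (x 0) (y l)) (dual (v 0) 0)).snd = 0 := by
  obtain ⟨b, hb⟩ := hy
  rcases lt_or_ge l b with h | h
  · have : ∀ r, ((dual (x 0) (y l)) ^ r).snd = 0 := by
      intro r
      induction r with
      | zero => simp
      | succ r ih => rw [snd_dual_pow_succ, ih, hb l h]; simp
    rw [serreSum, ← TrivSqZeroExt.sndHom_apply, map_sum]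
    refine Finset.sum_eq_zero fun r _ => ?_
    simp [this]
  obtain ⟨n, rfl⟩ := Int.le.dest h
  have hα := pow_ne_zero m hq
  have hβ : q⁻¹ ^ 2 ≠ 0 := pow_ne_zero 2 (inv_ne_zero hq)
  have h1 := C_mul_mk hβ (y := fun k => y (b + k)) (by simpa using hxy.shift 0 b)
    (fun l hl => hb _ (by omega)) 0
  have h2 := C_mul_mk hα (y := fun k => y (b + k)) (by simpa using hvy.shift 0 b)
    (fun l hl => hb _ (by omega)) 0
  have h3 := C_eq_ser hβ x 0
  have h4 := C_eq_ser hα v 0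
  rw [h3, zero_add] at h1
  rw [h4, zero_add] at h2
  have h5 := snd_serreSum_dual_eq_zero hq hq2 m (ser_self_exchange hxx) (ser_exchange hxv) h1 h2
  rw [zero_add] at h3 h4
  rw [← h3, ← h4] at h5
  simpa [coeff_snd_serreSum_dual] using congrArg (coeff n) h5

theorem serreSum_eq_zero_of_bddAbove (hq : q ≠ 0) (hxx : QC (q⁻¹ ^ 2) x x)
    (hxy : QC (q ^ m) x y) (hy : ∃ b, ∀ l > b, y l = 0) (l : ℤ) :
    serreSum q (m + 1) (x 0) (y l) = 0 := by
  obtain ⟨b, hb⟩ := hy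
  have h := serreSum_eq_zero_of_bddBelow (inv_ne_zero hq) (m := m) (x := fun k => x (-k))
    (y := fun k => y (-k)) (by simpa using hxx.neg (pow_ne_zero _ (inv_ne_zero hq)))
    (by simpa using hxy.neg (pow_ne_zero _ hq)) ⟨-b, fun l hl => hb _ (by omega)⟩ (-l)
  rwa [serreSum_inv hq, neg_zero, neg_neg] at h

theorem snd_serreSum_eq_zero_of_bddAbove (hq : q ≠ 0) (hq2 : q ^ 2 ≠ 1)
    (hxx : QC (q⁻¹ ^ 2) x x) (hxv : QC (q ^ m) x v)
    (hxy : QC (q⁻¹ ^ 2) x y) (hvy : QC (q ^ m) v y) (hy : ∃ b, ∀ l > b, y l = 0) (l : ℤ) :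
    (serreSum q (m + 1) (dual (x 0) (y l)) (dual (v 0) 0)).snd = 0 := by
  obtain ⟨b, hb⟩ := hy
  have h := snd_serreSum_eq_zero_of_bddBelow (inv_ne_zero hq) (m := m)
    (by rwa [inv_pow, inv_ne_one])
    (x := fun k => x (-k)) (v := fun k => v (-k)) (y := fun k => y (-k))
    (by simpa using hxx.neg (pow_ne_zero _ (inv_ne_zero hq)))
    (by simpa using hxv.neg (pow_ne_zero _ hq))
    (by simpa using hxy.neg (pow_ne_zero _ (inv_ne_zero hq)))
    (by simpa using hvy.neg (pow_ne_zero _ hq)) ⟨-b, fun l hl => hb _ (by omega)⟩ (-l)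
  rwa [serreSum_inv hq, neg_zero, neg_neg] at h

end Bounded

end DrinfeldSerre

namespace DrinfeldSerre

section Currents

variable {F : Type*} [Field F] {R : Type*} [Ring R] [Algebra F R]

theorem QC.smul {b : F} {x y : ℤ → R} (h : QC b x y) (c : F) : QC b x (fun k => c • y k) :=
  fun k l => by
    simp only [smul_mul_assoc, mul_smul_comm]
    rw [← smul_add, h k l, smul_comm, smul_add]

theorem snd_dual_add_pow (x y y' : R) (r : ℕ) :
    ((dual x (y + y')) ^ r).snd = ((dual x y) ^ r).snd + ((dual x y') ^ r).snd := by
  induction r with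
  | zero => simp
  | succ r ih => simp only [snd_dual_pow_succ, ih, mul_add, add_mul]; abel

theorem snd_serreSum_dual_left_add (q : F) (n : ℕ) (x y y' v : R) :
    (serreSum q n (dual x (y + y')) (dual v 0)).snd
      = (serreSum q n (dual x y) (dual v 0)).snd + (serreSum q n (dual x y') (dual v 0)).snd := by
  simp only [serreSum, ← TrivSqZeroExt.sndHom_apply (R := R), map_sum, ← Finset.sum_add_distrib]
  refine Finset.sum_congr rfl fun r _ => ?_
  simp only [TrivSqZeroExt.sndHom_apply, TrivSqZeroExt.snd_smul, DualNumber.snd_mul,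
    TrivSqZeroExt.fst_mul, fst_dual_pow, fst_dual, snd_dual, mul_zero, zero_add, snd_dual_add_pow,
    mul_add, add_mul, ← smul_add]
  congr 1
  abel

theorem snd_dual_zero_pow (x : R) (r : ℕ) : ((dual x 0) ^ r).snd = 0 := by
  induction r with
  | zero => simp
  | succ r ih => rw [snd_dual_pow_succ, ih]; simp

theorem snd_serreSum_dual_right (q : F) (n : ℕ) (x v y : R) :
    (serreSum q n (dual x 0) (dual v y)).snd = serreSum q n x y := by
  simp only [serreSum, ← TrivSqZeroExt.sndHom_apply (R := R), map_sum]
  refine Finset.sum_congr rfl fun r _ => ?_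
  simp [snd_dual_zero_pow]

theorem serreSum_add_right (q : F) (n : ℕ) (x y y' : R) :
    serreSum q n x (y + y') = serreSum q n x y + serreSum q n x y' := by
  simp only [serreSum, mul_add, add_mul, smul_add, Finset.sum_add_distrib]

theorem sum_dual {ι : Type*} (s : Finset ι) (x y : ι → R) :
    ∑ i ∈ s, dual (x i) (y i) = dual (∑ i ∈ s, x i) (∑ i ∈ s, y i) := by
  simp only [dual, Finset.sum_add_distrib, TrivSqZeroExt.inl_sum, TrivSqZeroExt.inr_sum]

theorem bddBelow_shift_sum {ι : Type*} (s : Finset ι) (ks : ι → ℤ) {y : ℤ → R}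
    (hy : ∃ b, ∀ l < b, y l = 0) : ∃ b, ∀ l < b, ∑ i ∈ s, y (ks i + l) = 0 := by
  obtain ⟨b, hb⟩ := hy
  obtain ⟨M, hM⟩ := (s.image ks).bddAbove
  refine ⟨b - M, fun l hl => Finset.sum_eq_zero fun i hi => hb _ ?_⟩
  have := hM (Finset.mem_coe.mpr (Finset.mem_image_of_mem ks hi))
  omega

theorem bddAbove_shift_sum {ι : Type*} (s : Finset ι) (ks : ι → ℤ) {y : ℤ → R}
    (hy : ∃ b, ∀ l > b, y l = 0) : ∃ b, ∀ l > b, ∑ i ∈ s, y (ks i + l) = 0 := by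
  obtain ⟨b, hb⟩ := hy
  obtain ⟨M, hM⟩ := (s.image ks).bddBelow
  refine ⟨b - M, fun l hl => Finset.sum_eq_zero fun i hi => hb _ ?_⟩
  have := hM (Finset.mem_coe.mpr (Finset.mem_image_of_mem ks hi))
  omega

theorem QC.shift_sum {ι κ : Type*} {b : F} (s : Finset ι) (t : Finset κ) (ks : ι → ℤ) (ls : κ → ℤ)
    {x y : ℤ → R} (h : QC b x y) :
    QC b (fun k => ∑ i ∈ s, x (ks i + k)) (fun k => ∑ j ∈ t, y (ls j + k)) :=
  QC.sum s t fun i j => h.shift (ks i) (ls j)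

theorem QC.shift_sum_left {ι : Type*} {b : F} (s : Finset ι) (ks : ι → ℤ) (m : ℤ)
    {x y : ℤ → R} (h : QC b x y) :
    QC b (fun k => ∑ i ∈ s, x (ks i + k)) (fun k => y (m + k)) := by
  simpa using h.shift_sum s {()} ks fun _ => m

theorem permSum_inv {q : F} (hq : q ≠ 0) {T : Type*} [Ring T] [Algebra F T] (n : ℕ) (x : Fin n → T)
    (v : T) : permSum q⁻¹ n x v = permSum q n x v := by
  simp only [permSum, gaussBinom_inv hq]

theorem map_permSum (q : F) {S T : Type*} [Ring S] [Algebra F S] [Ring T] [Algebra F T]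
    (f : S →ₐ[F] T)
    (n : ℕ) (x : Fin n → S) (v : S) :
    f (permSum q n x v) = permSum q n (fun s => f (x s)) (f v) := by
  simp only [permSum, map_sum, map_smul, map_mul, map_list_prod, List.map_map, Function.comp_def]

variable [CharZero F] {q : F} {m : ℕ} {x v y y' : ℤ → R}

/-- Deforming the repeated current of a Drinfeld-Serre combination. -/
theorem snd_permSum_left_eq_zero (hq : q ≠ 0) (hq2 : q ^ 2 ≠ 1)
    (hxx : QC (q⁻¹ ^ 2) x x) (hxv : QC (q ^ m) x v)
    (hxy : QC (q⁻¹ ^ 2) x y) (hvy : QC (q ^ m) v y) (hy : ∃ b, ∀ l < b, y l = 0)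
    (hxy' : QC (q⁻¹ ^ 2) x y') (hvy' : QC (q ^ m) v y') (hy' : ∃ b, ∀ l > b, y' l = 0)
    (ks : Fin (m + 1) → ℤ) (l : ℤ) :
    (permSum q (m + 1) (fun s => dual (x (ks s)) (y (ks s) + y' (ks s))) (dual (v l) 0)).snd
      = 0 := by
  rw [permSum_eq, ← TrivSqZeroExt.sndHom_apply, map_sum]
  refine Finset.sum_eq_zero fun U _ => ?_
  rw [map_zsmul, TrivSqZeroExt.sndHom_apply, sum_dual, Finset.sum_add_distrib,
    snd_serreSum_dual_left_add]
  have h1 := snd_serreSum_eq_zero_of_bddBelow hq hq2 (hxx.shift_sum Uᶜ Uᶜ ks ks)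
    (hxv.shift_sum_left Uᶜ ks l) (hxy.shift_sum Uᶜ Uᶜ ks ks)
    (hvy.symm.shift_sum_left Uᶜ ks l).symm (bddBelow_shift_sum Uᶜ ks hy) 0
  have h2 := snd_serreSum_eq_zero_of_bddAbove hq hq2 (hxx.shift_sum Uᶜ Uᶜ ks ks)
    (hxv.shift_sum_left Uᶜ ks l) (hxy'.shift_sum Uᶜ Uᶜ ks ks)
    (hvy'.symm.shift_sum_left Uᶜ ks l).symm (bddAbove_shift_sum Uᶜ ks hy') 0
  simp only [add_zero] at h1 h2
  rw [h1, h2, add_zero, smul_zero]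

/-- Deforming the single current of a Drinfeld-Serre combination. -/
theorem snd_permSum_right_eq_zero (hq : q ≠ 0) (hxx : QC (q⁻¹ ^ 2) x x)
    (hxy : QC (q ^ m) x y) (hy : ∃ b, ∀ l < b, y l = 0)
    (hxy' : QC (q ^ m) x y') (hy' : ∃ b, ∀ l > b, y' l = 0)
    (ks : Fin (m + 1) → ℤ) (l : ℤ) (v : R) :
    (permSum q (m + 1) (fun s => dual (x (ks s)) 0) (dual v (y l + y' l))).snd = 0 := by
  rw [permSum_eq, ← TrivSqZeroExt.sndHom_apply, map_sum]
  refine Finset.sum_eq_zero fun U _ => ?_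
  rw [map_zsmul, TrivSqZeroExt.sndHom_apply, sum_dual, Finset.sum_const_zero,
    snd_serreSum_dual_right, serreSum_add_right]
  have h1 := serreSum_eq_zero_of_bddBelow hq (hxx.shift_sum Uᶜ Uᶜ ks ks)
    (hxy.shift_sum_left Uᶜ ks 0) (by simpa using hy) l
  have h2 := serreSum_eq_zero_of_bddAbove hq (hxx.shift_sum Uᶜ Uᶜ ks ks)
    (hxy'.shift_sum_left Uᶜ ks 0) (by simpa using hy') l
  simp only [add_zero, zero_add] at h1 h2
  rw [h1, h2, add_zero, smul_zero]

end Currents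

end DrinfeldSerre

namespace DrinfeldSerre

theorem qq_ne_zero : qq ≠ 0 := pow_ne_zero _ RatFunc.X_ne_zero

theorem sqq_zpow_ne_one {n : ℤ} (hn : n ≠ 0) : sqq ^ n ≠ 1 := by
  have h : ∀ n : ℕ, n ≠ 0 → sqq ^ n ≠ 1 := fun n hn h => by
    have h1 : algebraMap (Polynomial ℚ) (RatFunc ℚ) (Polynomial.X ^ n)
        = algebraMap (Polynomial ℚ) (RatFunc ℚ) 1 := by
      rw [map_pow, RatFunc.algebraMap_X, map_one]; exact h
    have h2 := congrArg Polynomial.natDegree (RatFunc.algebraMap_injective ℚ h1)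
    rw [Polynomial.natDegree_X_pow, Polynomial.natDegree_one] at h2
    exact hn h2
  obtain ⟨k, rfl | rfl⟩ := n.eq_nat_or_neg
  · rw [zpow_natCast]; exact h k (by omega)
  · rw [zpow_neg, zpow_natCast, inv_ne_one]; exact h k (by omega)

theorem qi_ne_zero (i : Fin N) : qi d i ≠ 0 := zpow_ne_zero _ qq_ne_zero

theorem qp_ne_zero (i j : Fin N) : qp d A i j ≠ 0 := zpow_ne_zero _ qq_ne_zero

theorem qp_eq (i j : Fin N) : qp d A i j = qi d i ^ A i j := zpow_mul _ _ _

variable {d} in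
theorem qi_zpow_ne_one {i : Fin N} (hd : 0 < d i) {n : ℤ} (hn : n ≠ 0) : qi d i ^ n ≠ 1 := by
  rw [qi, qq, ← zpow_natCast, ← zpow_mul, ← zpow_mul]
  exact sqq_zpow_ne_one (by positivity)

variable {d} in
theorem qi_sub_inv_ne_zero {i : Fin N} (hd : 0 < d i) : qi d i - (qi d i)⁻¹ ≠ 0 := fun h => by
  have h1 := mul_eq_one_iff_eq_inv₀ (qi_ne_zero d i) |>.mpr (sub_eq_zero.mp h)
  exact qi_zpow_ne_one hd two_ne_zero (by rw [zpow_two, h1])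

variable {d} in
theorem qfact_ne_zero {i : Fin N} (hd : 0 < d i) (n : ℕ) : qfact d i n ≠ 0 := by
  induction n with
  | zero => exact one_ne_zero
  | succ n ih =>
    refine mul_ne_zero (div_ne_zero (fun h => ?_) (qi_sub_inv_ne_zero hd)) ih
    rw [zpow_neg] at h
    have h1 := mul_eq_one_iff_eq_inv₀ (zpow_ne_zero _ (qi_ne_zero d i)) |>.mpr (sub_eq_zero.mp h)
    rw [← zpow_add₀ (qi_ne_zero d i)] at h1
    exact qi_zpow_ne_one hd (by omega) h1

variable {d} in
theorem qfact_mul_qfact_mul_gaussBinom (i : Fin N) {n r : ℕ} (h : r ≤ n) :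
    qfact d i r * qfact d i (n - r) * gaussBinom (qi d i) n r = qfact d i n := by
  induction n generalizing r with
  | zero => obtain rfl : r = 0 := by omega
            simp [qfact]
  | succ n ih =>
    cases r with
    | zero => simp [qfact]
    | succ r =>
      have := qdiff_succ_mul_gaussBinom_succ (qi_ne_zero d i) n r
      simp only [qdiff] at this
      rw [Nat.add_sub_add_right, qfact, qfact, ← ih (Nat.le_of_succ_le_succ h), qint, qint]
      linear_combination (qi d i - (qi d i)⁻¹)⁻¹ * qfact d i r * qfact d i (n - r) * this

variable {d} in
theorem qbinom_eq {i : Fin N} (hd : 0 < d i) {n r : ℕ} (h : r ≤ n) :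
    qbinom d i n r = gaussBinom (qi d i) n r := by
  rw [qbinom, ← qfact_mul_qfact_mul_gaussBinom i h, mul_div_cancel_left₀]
  exact mul_ne_zero (qfact_ne_zero hd _) (qfact_ne_zero hd _)

variable {d} in
/-- The left side of the Drinfeld-Serre relation. -/
theorem sum_dsTerm_eq {i : Fin N} (hd : 0 < d i) (pm : Bool) (j : Fin N) (n : ℕ) (ks : Fin n → ℤ)
    (l : ℤ) : ∑ σ : Equiv.Perm (Fin n), ∑ r ∈ Finset.range (n + 1),
        ((-1 : Fq) ^ r * qbinom d i n r) • dsTerm pm i j n ks l σ r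
      = permSum (qi d i) n (fun s => e (if pm then xp i (ks s) else xm i (ks s)))
        (e (if pm then xp j l else xm j l)) := by
  refine Finset.sum_congr rfl fun σ _ => Finset.sum_congr rfl fun r hr => ?_
  rw [qbinom_eq hd (Nat.lt_succ_iff.mp (Finset.mem_range.mp hr))]
  rfl

end DrinfeldSerre

namespace DrinfeldSerre

section ExpSeries

open PowerSeries

variable {F : Type*} [Field F] {R : Type*} [Ring R] [Algebra F R]

/-- The formal derivative of a power series over a noncommutative ring. -/
def deriv' (U : R⟦X⟧) : R⟦X⟧ := PowerSeries.mk fun n => (n + 1) • coeff (n + 1) U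

theorem coeff_deriv' (U : R⟦X⟧) (n : ℕ) : coeff n (deriv' U) = (n + 1) • coeff (n + 1) U :=
  coeff_mk _ _

theorem deriv'_mul (U V : R⟦X⟧) : deriv' (U * V) = deriv' U * V + U * deriv' V := by
  ext n
  rw [coeff_deriv', map_add, coeff_mul, coeff_mul, coeff_mul, Finset.smul_sum]
  have h : ∀ p ∈ Finset.HasAntidiagonal.antidiagonal (n + 1), (n + 1) • (coeff p.1 U * coeff p.2 V)
      = (p.1 • coeff p.1 U) * coeff p.2 V + coeff p.1 U * (p.2 • coeff p.2 V) := by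
    intro p hp
    rw [← Finset.HasAntidiagonal.mem_antidiagonal.mp hp, add_smul, smul_mul_assoc, mul_smul_comm]
  rw [Finset.sum_congr rfl h, Finset.sum_add_distrib, Finset.Nat.sum_antidiagonal_succ,
    Finset.Nat.sum_antidiagonal_succ']
  simp [coeff_deriv']

theorem eq_of_deriv'_eq [CharZero F] {H U V : R⟦X⟧} (hU : deriv' U = H * U) (hV : deriv' V = H * V)
    (h0 : coeff 0 U = coeff 0 V) : U = V := by
  ext n
  induction n using Nat.strong_induction_on with
  | _ n ih =>
    cases n with
    | zero => exact h0
    | succ n =>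
      have h : (n + 1) • coeff (n + 1) U = (n + 1) • coeff (n + 1) V := by
        rw [← coeff_deriv', ← coeff_deriv', hU, hV, coeff_mul, coeff_mul]
        refine Finset.sum_congr rfl fun p hp => ?_
        rw [ih _ (by have := Finset.HasAntidiagonal.mem_antidiagonal.mp hp; omega)]
      rw [← Nat.cast_smul_eq_nsmul F, ← Nat.cast_smul_eq_nsmul F] at h
      exact smul_right_injective _ (Nat.cast_ne_zero.mpr (Nat.succ_ne_zero n)) h

/-- The recursion `k P_k = ∑ l η H_l P_{k-l}` of `P(z) = exp(η ∑ H_l z^l)`, the coefficient of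
`z^(l+1)` being indexed by `l` in `H`. -/
def IsExpSeq (η : F) (H P : ℕ → R) : Prop :=
  P 0 = 1 ∧ ∀ k : ℕ, P (k + 1) = ((k + 1 : F))⁻¹ •
    ∑ l ∈ Finset.range (k + 1), (((l + 1 : ℕ) : F) * η) • (H l * P (k - l))

/-- The coefficients of `(1 - b⁻¹ t) / (1 - b t)`. -/
def twistCoeff (b : F) : ℕ → F
  | 0 => 1
  | s + 1 => b ^ ((s : ℤ) + 1) - b ^ ((s : ℤ) - 1)

theorem twistCoeff_succ {b : F} (hb : b ≠ 0) (s : ℕ) :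
    twistCoeff b (s + 1) = b * twistCoeff b s - if s = 0 then b⁻¹ else 0 := by
  cases s with
  | zero => simp [twistCoeff]
  | succ s =>
    simp only [twistCoeff, mul_sub, ← zpow_one_add₀ hb]
    push_cast
    simp
    ring_nf

theorem sum_twistCoeff {b : F} (hb : b ≠ 0) (t n : ℕ) :
    ∑ s ∈ Finset.range (n + 1), (b ^ ((t : ℤ) - s + 1) - b ^ (-((t : ℤ) - s + 1))) * twistCoeff b s
      = n * (b ^ ((t : ℤ) + 1) - b ^ ((t : ℤ) - 1)) - b ^ (2 * (n : ℤ) - t - 1)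
        + b ^ ((t : ℤ) + 1) := by
  induction n with
  | zero =>
    simp [twistCoeff]
    ring_nf
  | succ n ih =>
    rw [Finset.sum_range_succ, ih, twistCoeff]
    simp only [sub_mul, mul_sub, ← zpow_add₀ hb]
    push_cast
    ring_nf

theorem add_one_mul_twistCoeff {b : F} (hb : b ≠ 0) (t : ℕ) :
    ∑ p ∈ Finset.HasAntidiagonal.antidiagonal t,
        (b ^ ((p.1 : ℤ) + 1) - b ^ (-((p.1 : ℤ) + 1))) * twistCoeff b p.2
      = (t + 1) * twistCoeff b (t + 1) := by
  have h := sum_twistCoeff hb t t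
  rw [show 2 * (t : ℤ) - t - 1 = t - 1 by ring] at h
  rw [← Finset.Nat.sum_antidiagonal_swap, Finset.Nat.sum_antidiagonal_eq_sum_range_succ_mk,
    twistCoeff, add_mul, one_mul, ← add_sub_assoc, add_sub_right_comm, ← h]
  refine Finset.sum_congr rfl fun s hs => ?_
  simp [Nat.cast_sub (Nat.lt_succ_iff.mp (Finset.mem_range.mp hs))]

variable [CharZero F] {η : F} {H P : ℕ → R}

theorem IsExpSeq.deriv' (h : IsExpSeq η H P) :
    deriv' (PowerSeries.mk P)
      = PowerSeries.mk (fun l => (((l + 1 : ℕ) : F) * η) • H l) * PowerSeries.mk P := by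
  ext n
  rw [coeff_deriv', coeff_mk, h.2, coeff_mul, Finset.Nat.sum_antidiagonal_eq_sum_range_succ_mk,
    ← Nat.cast_smul_eq_nsmul F, Nat.cast_succ, smul_inv_smul₀ (Nat.cast_add_one_ne_zero n)]
  simp

/-- Moving an element through an exponential. -/
theorem IsExpSeq.mul_C (h : IsExpSeq η H P) {S : R⟦X⟧}
    (hS : DrinfeldSerre.deriv' S = PowerSeries.mk (fun l => (((l + 1 : ℕ) : F) * η) • H l) * S
      - S * PowerSeries.mk (fun l => (((l + 1 : ℕ) : F) * η) • H l)) :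
    PowerSeries.mk P * C (coeff 0 S) = S * PowerSeries.mk P := by
  have hC : DrinfeldSerre.deriv' (C (coeff 0 S)) = 0 := by
    ext n; simp [coeff_deriv']
  refine eq_of_deriv'_eq (F := F)
    (H := PowerSeries.mk fun l => (((l + 1 : ℕ) : F) * η) • H l) ?_ ?_ ?_
  · rw [deriv'_mul, hC, mul_zero, add_zero, h.deriv', mul_assoc]
  · rw [deriv'_mul, hS, h.deriv', sub_mul, mul_assoc, mul_assoc]; abel
  · rw [coeff_mul_C, coeff_mk, h.1, one_mul, coeff_zero_mul, coeff_mk, h.1, mul_one]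
where
  coeff_zero_mul {U V : R⟦X⟧} : coeff 0 (U * V) = coeff 0 U * coeff 0 V := by simp

variable {b : F} {Y : ℕ → R}

theorem IsExpSeq.mul_current (hb : b ≠ 0) (h : IsExpSeq η H P)
    (hY : ∀ l r : ℕ, η • (H l * Y r - Y r * H l)
      = ((b ^ ((l : ℤ) + 1) - b ^ (-((l : ℤ) + 1))) / (l + 1)) • Y (r + l + 1)) (r : ℕ) :
    PowerSeries.mk P * C (Y r)
      = PowerSeries.mk (fun s => twistCoeff b s • Y (r + s)) * PowerSeries.mk P := by
  have := h.mul_C (S := PowerSeries.mk (fun s => twistCoeff b s • Y (r + s))) ?_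
  · simpa [twistCoeff] using this
  ext n
  rw [coeff_deriv', coeff_mk, map_sub, coeff_mul, coeff_mul, ← Finset.Nat.sum_antidiagonal_swap
    (f := fun p => coeff p.1 (PowerSeries.mk (fun s => twistCoeff b s • Y (r + s))) * _),
    ← Finset.sum_sub_distrib, ← Nat.cast_smul_eq_nsmul F, smul_smul, Nat.cast_succ,
    ← add_one_mul_twistCoeff hb, Finset.sum_smul]
  refine Finset.sum_congr rfl fun p hp => ?_
  have hp1 : ((p.1 : F) + 1) ≠ 0 := Nat.cast_add_one_ne_zero _
  have e1 : r + (n + 1) = r + p.2 + p.1 + 1 := by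
    rw [← Finset.HasAntidiagonal.mem_antidiagonal.mp hp]; ring
  simp only [coeff_mk, Prod.fst_swap, Prod.snd_swap, smul_mul_smul_comm]
  rw [mul_comm (twistCoeff b p.2) (_ * η), ← smul_sub, mul_right_comm,
    mul_smul _ η, hY, smul_smul, e1]
  congr 1
  push_cast
  field_simp

theorem IsExpSeq.exchange (hb : b ≠ 0) (h : IsExpSeq η H P)
    (hY : ∀ l r : ℕ, η • (H l * Y r - Y r * H l)
      = ((b ^ ((l : ℤ) + 1) - b ^ (-((l : ℤ) + 1))) / (l + 1)) • Y (r + l + 1)) (n r : ℕ) :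
    P (n + 1) * Y r - b • (P n * Y (r + 1)) = Y r * P (n + 1) - b⁻¹ • (Y (r + 1) * P n) := by
  have h1 := congrArg (coeff (n + 1)) (h.mul_current hb hY r)
  have h2 := congrArg (coeff n) (h.mul_current hb hY (r + 1))
  rw [coeff_mul_C, coeff_mk, coeff_mul] at h1 h2
  rw [h1, h2, Finset.Nat.sum_antidiagonal_succ, add_sub_assoc, Finset.smul_sum,
    ← Finset.sum_sub_distrib, sub_eq_add_neg]
  simp only [coeff_mk]
  congr 1
  · simp [twistCoeff]
  rw [Finset.sum_eq_single (0, n)]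
  · simp [sub_smul, twistCoeff, sub_mul]
  · rintro ⟨i, j⟩ hij hne
    have hi : i ≠ 0 := by
      rintro rfl
      exact hne (by simpa using hij)
    rw [twistCoeff_succ hb, if_neg hi, sub_zero, mul_smul, smul_mul_assoc, add_assoc,
      add_comm 1 i, sub_self]
  · simp

/-- Moving a current to the right of an exponential. -/
theorem IsExpSeq.current_mul (hb : b ≠ 0) (h : IsExpSeq η H P)
    (hY : ∀ l r : ℕ, η • (H l * Y r - Y r * H l)
      = ((b ^ ((l : ℤ) + 1) - b ^ (-((l : ℤ) + 1))) / (l + 1)) • Y (r + l + 1)) (n r : ℕ) :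
    Y r * P n = ∑ s ∈ Finset.range (n + 1), twistCoeff b⁻¹ s • (P (n - s) * Y (r + s)) := by
  induction n generalizing r with
  | zero => simp [h.1, twistCoeff]
  | succ n ih =>
    have h1 := h.exchange hb hY n r
    rw [eq_add_of_sub_eq h1.symm, ih, Finset.sum_range_succ' _ (n + 1), Finset.smul_sum,
      sub_add_comm]
    simp only [twistCoeff_succ (inv_ne_zero hb), sub_smul, Finset.sum_sub_distrib]
    congr 1
    · congr 1
      · refine Finset.sum_congr rfl fun s _ => ?_
        rw [mul_smul, Nat.add_sub_add_right, add_assoc, add_comm 1 s]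
      · simp [ite_smul]
    · simp [twistCoeff]

end ExpSeries

end DrinfeldSerre

namespace DrinfeldSerre

section Cartan

variable {S : Type*} [Ring S] [Algebra Fq S] (Φ : FA N →ₐ[Fq] S)

theorem map_gammaHalf {u : Sˣ} (h1 : Φ (e g2) = u) (h2 : Φ (e g2inv) = ↑u⁻¹) (m : ℤ) :
    Φ (gammaHalf m) = ↑(u ^ m) := by
  rw [gammaHalf]
  split_ifs with h
  · obtain ⟨n, rfl⟩ := Int.eq_ofNat_of_zero_le h
    simp [h1]
  · obtain ⟨n, rfl⟩ : ∃ n : ℕ, m = -n := ⟨(-m).toNat, by omega⟩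
    simp [h2]

theorem isExpSeq_Ppos (i : Fin N) : IsExpSeq (qi d i - (qi d i)⁻¹)
    (fun l : ℕ => Φ (e (h i ((l : ℤ) + 1)))) (fun n => Φ (Ppos d i n)) := by
  refine ⟨by simp [Ppos], fun k => ?_⟩
  beta_reduce
  rw [Ppos]
  simp only [map_smul, map_sum, map_mul]

theorem isExpSeq_Pneg (i : Fin N) : IsExpSeq (-(qi d i - (qi d i)⁻¹))
    (fun l : ℕ => Φ (e (h i (-((l : ℤ) + 1))))) (fun n => Φ (Pneg d i n)) := by
  refine ⟨by simp [Pneg], fun k => ?_⟩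
  beta_reduce
  rw [Pneg]
  simp only [map_smul, map_sum, map_mul]

theorem psiEl_natCast (i : Fin N) (n : ℕ) : psiEl d i n = e (K i) * Ppos d i n := by
  simp [psiEl]

theorem phiEl_neg_natCast (i : Fin N) (n : ℕ) : phiEl d i (-n) = e (Kinv i) * Pneg d i n := by
  simp [phiEl]

theorem psiEl_of_neg (i : Fin N) {m : ℤ} (hm : m < 0) : psiEl d i m = 0 := if_neg (by omega)

theorem phiEl_of_pos (i : Fin N) {m : ℤ} (hm : 0 < m) : phiEl d i m = 0 := if_neg (by omega)

/-- The relations between the Cartan currents of index `i` and a current `x` of weight `b`. -/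
structure CartanRel (w : Sˣ) (i : Fin N) (b : Fq) (x : ℤ → S) : Prop where
  central : ∀ s : S, Commute s w
  K_mul : ∀ r, Φ (e (K i)) * x r = b • (x r * Φ (e (K i)))
  Kinv_mul : ∀ r, Φ (e (Kinv i)) * x r = b⁻¹ • (x r * Φ (e (Kinv i)))
  h_mul : ∀ s ≠ 0, ∀ r, (qi d i - (qi d i)⁻¹) • (Φ (e (h i s)) * x r - x r * Φ (e (h i s)))
    = ((b ^ s - b ^ (-s)) / s) • (↑(w ^ |s|) * x (r + s))

namespace CartanRel

variable {d Φ} {w : Sˣ} {i : Fin N} {b : Fq} {x : ℤ → S}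

theorem comm (H : CartanRel d Φ w i b x) (n : ℤ) (s : S) : s * ↑(w ^ n) = ↑(w ^ n) * s :=
  (H.central s).units_zpow_right n

theorem h_mul_pos (H : CartanRel d Φ w i b x) (k : ℤ) (l r : ℕ) :
    (qi d i - (qi d i)⁻¹) • (Φ (e (h i ((l : ℤ) + 1))) * (↑(w ^ (r : ℤ)) * x (k + r))
        - ↑(w ^ (r : ℤ)) * x (k + r) * Φ (e (h i ((l : ℤ) + 1))))
      = ((b ^ ((l : ℤ) + 1) - b ^ (-((l : ℤ) + 1))) / (l + 1)) •
        (↑(w ^ ((r + l + 1 : ℕ) : ℤ)) * x (k + (r + l + 1 : ℕ))) := by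
  have h0 : (0 : ℤ) < (l : ℤ) + 1 := by positivity
  rw [← mul_assoc, H.comm, mul_assoc, mul_assoc, ← mul_sub, ← mul_smul_comm, H.h_mul _ h0.ne',
    mul_smul_comm, ← mul_assoc, ← Units.val_mul, ← zpow_add, abs_of_pos h0]
  push_cast
  simp only [add_assoc]

theorem h_mul_neg (H : CartanRel d Φ w i b x) (k : ℤ) (l r : ℕ) :
    (-(qi d i - (qi d i)⁻¹)) • (Φ (e (h i (-((l : ℤ) + 1)))) * (↑(w ^ (r : ℤ)) * x (k - r))
        - ↑(w ^ (r : ℤ)) * x (k - r) * Φ (e (h i (-((l : ℤ) + 1)))))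
      = ((b⁻¹ ^ ((l : ℤ) + 1) - b⁻¹ ^ (-((l : ℤ) + 1))) / (l + 1)) •
        (↑(w ^ ((r + l + 1 : ℕ) : ℤ)) * x (k - (r + l + 1 : ℕ))) := by
  have h0 : (0 : ℤ) < (l : ℤ) + 1 := by positivity
  rw [← mul_assoc, H.comm, mul_assoc, mul_assoc, ← mul_sub, neg_smul, ← mul_smul_comm,
    H.h_mul _ (neg_ne_zero.mpr h0.ne'), mul_smul_comm, ← mul_assoc, ← Units.val_mul, ← zpow_add,
    abs_neg, abs_of_pos h0, ← neg_smul, inv_zpow', inv_zpow', neg_neg]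
  have e1 : k - (r : ℤ) + -((l : ℤ) + 1) = k - (r + l + 1 : ℕ) := by push_cast; ring
  rw [e1]
  push_cast
  rw [add_assoc (r : ℤ), div_neg, neg_neg]

theorem exchange_of_exp {k p₀ p₁ y₀ y₁ : S} (hb : b ≠ 0) (hw : ∀ s : S, Commute s w)
    (h₀ : k * y₀ = b • (y₀ * k)) (h₁ : k * y₁ = b • (y₁ * k))
    (h : p₁ * y₀ - b • (p₀ * (w * y₁)) = y₀ * p₁ - b⁻¹ • (w * y₁ * p₀)) :
    k * p₁ * y₀ + w * (y₁ * (k * p₀)) = b • (y₀ * (k * p₁) + w * (k * p₀ * y₁)) := by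
  have e1 : k * (w * y₁ * p₀) = b • (w * (y₁ * (k * p₀))) := by
    rw [mul_assoc (w : S), ← mul_assoc k, (hw k).eq, mul_assoc (w : S), ← mul_assoc k, h₁,
      smul_mul_assoc, mul_smul_comm, mul_assoc y₁]
  have e2 : k * (p₀ * (w * y₁)) = w * (k * p₀ * y₁) := by
    rw [← mul_assoc, ← mul_assoc, (hw _).eq, mul_assoc]
  have := congrArg (k * ·) h
  simp only [mul_sub, mul_smul_comm, e1, e2, inv_smul_smul₀ hb] at this
  rw [← mul_assoc, ← mul_assoc k y₀, h₀, smul_mul_assoc, mul_assoc y₀,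
    sub_eq_sub_iff_add_eq_add] at this
  rw [this, smul_add]

theorem psi_exchange (hb : b ≠ 0) (H : CartanRel d Φ w i b x) (n l : ℤ) :
    Φ (psiEl d i (n + 1)) * x l + ↑w * (x (l + 1) * Φ (psiEl d i n))
      = b • (x l * Φ (psiEl d i (n + 1)) + ↑w * (Φ (psiEl d i n) * x (l + 1))) := by
  rcases lt_trichotomy (n + 1) 0 with hn | hn | hn
  · simp [psiEl_of_neg d i hn, psiEl_of_neg d i (by omega : n < 0)]
  · have := psiEl_natCast d i 0
    rw [Nat.cast_zero] at this
    simp [hn, psiEl_of_neg d i (by omega : n < 0), this, Ppos, H.K_mul]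
  · obtain ⟨m, rfl⟩ := Int.eq_ofNat_of_zero_le (by omega : 0 ≤ n)
    have h1 := (isExpSeq_Ppos d Φ i).exchange hb (Y := fun r : ℕ => ↑(w ^ (r : ℤ)) * x (l + r))
      (H.h_mul_pos l) m 0
    have e1 : ((m : ℕ) : ℤ) + 1 = (m + 1 : ℕ) := by push_cast; rfl
    simp only [e1, psiEl_natCast, map_mul]
    exact exchange_of_exp hb H.central (H.K_mul _) (H.K_mul _) (by simpa using h1)

theorem phi_exchange (hb : b ≠ 0) (H : CartanRel d Φ w i b x) (n l : ℤ) :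
    Φ (phiEl d i (n - 1)) * x l + ↑w * (x (l - 1) * Φ (phiEl d i n))
      = b⁻¹ • (x l * Φ (phiEl d i (n - 1)) + ↑w * (Φ (phiEl d i n) * x (l - 1))) := by
  rcases lt_trichotomy (n - 1) 0 with hn | hn | hn
  · obtain ⟨m, rfl⟩ : ∃ m : ℕ, n = -m := ⟨(-n).toNat, by omega⟩
    have h1 := (isExpSeq_Pneg d Φ i).exchange (inv_ne_zero hb)
      (Y := fun r : ℕ => ↑(w ^ (r : ℤ)) * x (l - r)) (H.h_mul_neg l) m 0
    have e1 : -((m : ℕ) : ℤ) - 1 = -(m + 1 : ℕ) := by push_cast; ring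
    simp only [e1, phiEl_neg_natCast, map_mul]
    exact exchange_of_exp (inv_ne_zero hb) H.central (H.Kinv_mul _) (H.Kinv_mul _)
      (by simpa using h1)
  · have := phiEl_neg_natCast d i 0
    rw [Nat.cast_zero, neg_zero] at this
    simp [hn, phiEl_of_pos d i (by omega : 0 < n), this, Pneg, H.Kinv_mul]
  · simp [phiEl_of_pos d i hn, phiEl_of_pos d i (by omega : 0 < n)]

theorem qc_psi (hb : b ≠ 0) (H : CartanRel d Φ w i b x) (c m : ℤ) :
    QC b x (fun r => ↑(w ^ (m - r)) * Φ (psiEl d i (c + r))) := fun k l => by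
  have h1 := congrArg (((w ^ (m - (l + 1)) : Sˣ) : S) * ·) (H.psi_exchange hb (c + l) k)
  have e1 : w ^ (m - l) = w ^ (m - (l + 1)) * w := by rw [← zpow_add_one]; congr 1; ring
  simp only [mul_add, mul_smul_comm] at h1
  simp only [e1, Units.val_mul, mul_assoc, ← add_assoc]
  rw [add_comm (x (k + 1) * _), ← mul_assoc (x (k + 1)), H.comm, mul_assoc, ← mul_assoc (x (k + 1)),
    (H.central _).eq, mul_assoc, h1, ← mul_assoc (x k), H.comm, mul_assoc, smul_add, smul_add,
    add_comm]

theorem qc_phi (hb : b ≠ 0) (H : CartanRel d Φ w i b x) (c m : ℤ) :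
    QC b x (fun r => ↑(w ^ (m + r)) * Φ (phiEl d i (c + r))) := fun k l => by
  have h1 := H.phi_exchange hb (c + l + 1) (k + 1)
  have e1 : w ^ (m + (l + 1)) = w ^ (m + l) * w := by rw [← zpow_add_one]; congr 1; ring
  simp only [add_sub_cancel_right] at h1
  rw [eq_inv_smul_iff₀ hb] at h1
  replace h1 := congrArg (((w ^ (m + l) : Sˣ) : S) * ·) h1
  simp only [mul_add, mul_smul_comm] at h1
  have e2 : ((w ^ (m + l) : Sˣ) : S) * w = ↑(w ^ (m + (l + 1))) := by rw [e1, Units.val_mul]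
  simp only [← mul_assoc, e2, add_assoc] at h1 ⊢
  rw [H.comm, H.comm, ← h1]

/-- Moving a current to the right of `φ`. -/
theorem current_mul_phi (hb : b ≠ 0) (H : CartanRel d Φ w i b x) (n : ℕ) (l : ℤ) :
    x l * Φ (phiEl d i (-n)) = ∑ s ∈ Finset.range (n + 1), (b * twistCoeff b s) •
      (Φ (phiEl d i (-(n - s : ℕ))) * (↑(w ^ (s : ℤ)) * x (l - s))) := by
  have h1 := (isExpSeq_Pneg d Φ i).current_mul (inv_ne_zero hb)
      (Y := fun r : ℕ => ↑(w ^ (r : ℤ)) * x (l - r)) (H.h_mul_neg l) n 0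
  simp only [inv_inv, Nat.cast_zero, zpow_zero, Units.val_one, one_mul, sub_zero, zero_add] at h1
  have h2 : x l * Φ (e (Kinv i)) = b • (Φ (e (Kinv i)) * x l) := by
    rw [H.Kinv_mul, smul_inv_smul₀ hb]
  simp only [phiEl_neg_natCast, map_mul]
  rw [← mul_assoc, h2, smul_mul_assoc, mul_assoc, h1, Finset.mul_sum, Finset.smul_sum]
  refine Finset.sum_congr rfl fun s _ => ?_
  rw [mul_smul_comm, mul_smul, mul_assoc]

end CartanRel

theorem gcoef_eq {a : Fq} (ha : a ≠ 0) (r : ℕ) : gcoef a r = a⁻¹ * twistCoeff a⁻¹ r := by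
  cases r with
  | zero => simp [gcoef, twistCoeff]
  | succ r =>
    rw [gcoef, twistCoeff, mul_sub, ← zpow_one_add₀ (inv_ne_zero ha),
      ← zpow_one_add₀ (inv_ne_zero ha), inv_zpow', inv_zpow']
    ring_nf

end Cartan

end DrinfeldSerre

namespace DrinfeldSerre

section Heisenberg

open PowerSeries in
theorem IsExpSeq.commutator {F : Type*} [Field F] {R : Type*} [Ring R] [Algebra F R] [CharZero F]
    {η : F} {H P : ℕ → R} (h : IsExpSeq η H P) {z c : R} {t : ℕ} (hc : ∀ s : R, Commute s c)
    (hz : ∀ l : ℕ, η • (z * H l - H l * z) = if l = t then c else 0) (n : ℕ) :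
    z * P n - P n * z = if t + 1 ≤ n then c * P (n - (t + 1)) else 0 := by
  have h1 := h.mul_C (S := C z - C c * X ^ (t + 1)) ?_
  · have h2 := congrArg (coeff n) h1
    rw [map_sub, coeff_zero_C, pow_succ', ← mul_assoc (C c), ← X_mul, mul_assoc, coeff_zero_X_mul,
      sub_zero, coeff_mul_C, coeff_mk, ← mul_assoc, X_mul, mul_assoc, ← pow_succ', sub_mul, map_sub,
      coeff_C_mul, coeff_mk, mul_assoc, coeff_C_mul, coeff_X_pow_mul'] at h2
    rw [h2, sub_sub_cancel]
    split_ifs <;> simp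
  have hS : ∀ U : PowerSeries R, U * (C c * X ^ (t + 1)) = C c * X ^ (t + 1) * U := by
    intro U
    rw [mul_assoc, X_pow_mul, ← mul_assoc, ← mul_assoc]
    congr 1
    ext n
    rw [coeff_mul_C, coeff_C_mul, (hc _).eq]
  rw [mul_sub, sub_mul, hS, sub_sub_sub_cancel_right]
  ext n
  have e1 : (((n + 1 : ℕ) : F) * η) • (H n * z) - (((n + 1 : ℕ) : F) * η) • (z * H n)
      = -((n + 1) • if n = t then c else 0) := by
    rw [← hz, ← smul_sub, mul_smul, Nat.cast_smul_eq_nsmul, ← smul_neg, ← smul_neg, neg_sub]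
  rw [coeff_deriv', map_sub, coeff_C_mul, map_sub, coeff_mul_C, coeff_C_mul, coeff_mk,
    smul_mul_assoc, mul_smul_comm, e1]
  simp [coeff_X_pow]

variable {S : Type*} [Ring S] [Algebra Fq S] (Φ : FA N →ₐ[Fq] S)

/-- The relations of the Cartan part of the quantum affine algebra. -/
structure HeisenbergRel (u : Sˣ) : Prop where
  central : ∀ s : S, Commute s u
  K_comm : ∀ i j s, Commute (Φ (e (h i s))) (Φ (e (K j)))
  Kinv_comm : ∀ i j s, Commute (Φ (e (h i s))) (Φ (e (Kinv j)))
  h_comm : ∀ i j, ∀ s ≠ 0, ∀ l ≠ 0, (qi d j - (qi d j)⁻¹) •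
    (Φ (e (h i s)) * Φ (e (h j l)) - Φ (e (h j l)) * Φ (e (h i s)))
      = if l = -s then ((s : Fq)⁻¹ * qint d i (s * A i j)) •
          (((u ^ (2 * s) : Sˣ) : S) - ↑(u ^ (-(2 * s))))
        else 0

namespace HeisenbergRel

variable {d A Φ} {u : Sˣ}

theorem comm (H : HeisenbergRel d A Φ u) (n : ℤ) (s : S) : Commute s ↑(u ^ n) :=
  (H.central s).units_zpow_right n

theorem h_psi (H : HeisenbergRel d A Φ u) (i j : Fin N) {s : ℤ} (hs : s ≠ 0) (m : ℤ) :
    Φ (e (h i s)) * Φ (psiEl d j m) - Φ (psiEl d j m) * Φ (e (h i s))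
      = ((s : Fq)⁻¹ * qint d i (s * A i j)) •
        ((((u ^ (s - |s|) : Sˣ) : S) - ↑(u ^ (|s| - s))) * Φ (psiEl d j (m + s))) := by
  rcases lt_or_ge m 0 with hm | hm
  · rw [psiEl_of_neg d j hm]
    rcases lt_or_gt_of_ne hs with h0 | h0
    · rw [psiEl_of_neg d j (by omega)]; simp
    · simp [abs_of_pos h0]
  obtain ⟨n, rfl⟩ := Int.eq_ofNat_of_zero_le hm
  have key : Φ (e (h i s)) * Φ (psiEl d j n) - Φ (psiEl d j n) * Φ (e (h i s))
      = Φ (e (K j)) * (Φ (e (h i s)) * Φ (Ppos d j n) - Φ (Ppos d j n) * Φ (e (h i s))) := by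
    rw [psiEl_natCast, map_mul, ← mul_assoc, (H.K_comm i j s).eq, mul_sub, mul_assoc, mul_assoc]
  rw [key]
  rcases lt_or_gt_of_ne hs with h0 | h0
  · obtain ⟨t, rfl⟩ : ∃ t : ℕ, s = -((t : ℤ) + 1) := ⟨(-s - 1).toNat, by omega⟩
    have e0 : |(-((t : ℤ) + 1))| = (t : ℤ) + 1 := by rw [abs_neg, abs_of_pos (by positivity)]
    rw [(isExpSeq_Ppos d Φ j).commutator (t := t) (z := Φ (e (h i (-((t : ℤ) + 1)))))
      (c := (((-((t : ℤ) + 1) : ℤ) : Fq)⁻¹ * qint d i (-((t : ℤ) + 1) * A i j)) •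
        (((u ^ (2 * (-((t : ℤ) + 1))) : Sˣ) : S) - ↑(u ^ (-(2 * (-((t : ℤ) + 1)))))))
      (fun s => (((H.comm _ s).sub_right (H.comm _ s)).smul_right _)) ?_, e0]
    · split_ifs with htn
      · obtain ⟨k, rfl⟩ := Nat.exists_eq_add_of_le' htn
        have e1 : ((k + (t + 1) : ℕ) : ℤ) + -((t : ℤ) + 1) = k := by push_cast; ring
        rw [e1, psiEl_natCast, Nat.add_sub_cancel, map_mul, smul_mul_assoc, mul_smul_comm,
          ← mul_assoc, ((H.comm _ _).sub_right (H.comm _ _)).eq, mul_assoc]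
        ring_nf
      · rw [psiEl_of_neg d j (by omega)]; simp
    · intro l
      rw [H.h_comm i j _ hs _ (by positivity)]
      refine if_congr ?_ rfl rfl
      omega
  · rw [(isExpSeq_Ppos d Φ j).commutator (t := 0) (c := 0) (fun s => Commute.zero_right s)]
    · simp [abs_of_pos h0]
    · intro l
      rw [H.h_comm i j _ hs _ (by positivity), if_neg (by omega), ite_self]

theorem h_phi (H : HeisenbergRel d A Φ u) (i j : Fin N) {s : ℤ} (hs : s ≠ 0) (m : ℤ) :
    Φ (e (h i s)) * Φ (phiEl d j m) - Φ (phiEl d j m) * Φ (e (h i s))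
      = ((s : Fq)⁻¹ * qint d i (s * A i j)) •
        ((((u ^ (-(s + |s|)) : Sˣ) : S) - ↑(u ^ (s + |s|))) * Φ (phiEl d j (m + s))) := by
  rcases lt_or_ge 0 m with hm | hm
  · rw [phiEl_of_pos d j hm]
    rcases lt_or_gt_of_ne hs with h0 | h0
    · simp [abs_of_neg h0]
    · rw [phiEl_of_pos d j (by omega)]; simp
  obtain ⟨n, rfl⟩ : ∃ n : ℕ, m = -n := ⟨(-m).toNat, by omega⟩
  have key : Φ (e (h i s)) * Φ (phiEl d j (-n)) - Φ (phiEl d j (-n)) * Φ (e (h i s))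
      = Φ (e (Kinv j)) * (Φ (e (h i s)) * Φ (Pneg d j n) - Φ (Pneg d j n) * Φ (e (h i s))) := by
    rw [phiEl_neg_natCast, map_mul, ← mul_assoc, (H.Kinv_comm i j s).eq, mul_sub, mul_assoc,
      mul_assoc]
  rw [key]
  rcases lt_or_gt_of_ne hs with h0 | h0
  · rw [(isExpSeq_Pneg d Φ j).commutator (t := 0) (c := 0) (fun s => Commute.zero_right s)]
    · simp [abs_of_neg h0]
    · intro l
      rw [neg_smul, H.h_comm i j _ hs _ (by omega), if_neg (by omega), ite_self, neg_zero]
  · obtain ⟨t, rfl⟩ : ∃ t : ℕ, s = (t : ℤ) + 1 := ⟨(s - 1).toNat, by omega⟩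
    have e0 : |((t : ℤ) + 1)| = (t : ℤ) + 1 := abs_of_pos (by positivity)
    rw [(isExpSeq_Pneg d Φ j).commutator (t := t) (z := Φ (e (h i ((t : ℤ) + 1))))
      (c := -((((((t : ℤ) + 1 : ℤ) : Fq)⁻¹ * qint d i (((t : ℤ) + 1) * A i j)) •
        (((u ^ (2 * ((t : ℤ) + 1)) : Sˣ) : S) - ↑(u ^ (-(2 * ((t : ℤ) + 1))))))))
      (fun s => (((H.comm _ s).sub_right (H.comm _ s)).smul_right _).neg_right) ?_, e0]
    · split_ifs with htn
      · obtain ⟨k, rfl⟩ := Nat.exists_eq_add_of_le' htn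
        have e1 : -((k + (t + 1) : ℕ) : ℤ) + ((t : ℤ) + 1) = -k := by push_cast; ring
        rw [e1, phiEl_neg_natCast, Nat.add_sub_cancel, map_mul, ← smul_neg, neg_sub, smul_mul_assoc,
          mul_smul_comm, ← mul_assoc, ((H.comm _ _).sub_right (H.comm _ _)).eq, mul_assoc]
        ring_nf
      · rw [phiEl_of_pos d j (by omega)]; simp
    · intro l
      rw [neg_smul, H.h_comm i j _ hs _ (by omega)]
      split_ifs with h1 h2 h2
      · rfl
      · omega
      · omega
      · simp

end HeisenbergRel

end Heisenberg

end DrinfeldSerre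

namespace DrinfeldSerre

/-- The defining relations in which no generator `x^+` occurs. -/
inductive MinusRel : FA N → FA N → Prop
  | K_Kinv (i : Fin N) : MinusRel (e (K i) * e (Kinv i)) 1
  | Kinv_K (i : Fin N) : MinusRel (e (Kinv i) * e (K i)) 1
  | D_Dinv : MinusRel (e D * e Dinv) 1
  | Dinv_D : MinusRel (e Dinv * e D) 1
  | g_ginv : MinusRel (e g2 * e g2inv) 1
  | ginv_g : MinusRel (e g2inv * e g2) 1
  | g2_comm (x : Gen N) : MinusRel (e g2 * e x) (e x * e g2)
  | g2inv_comm (x : Gen N) : MinusRel (e g2inv * e x) (e x * e g2inv)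
  | K_comm_K (i j : Fin N) : MinusRel (e (K i) * e (K j)) (e (K j) * e (K i))
  | K_comm_D (i : Fin N) : MinusRel (e (K i) * e D) (e D * e (K i))
  | K_comm_h (i j : Fin N) (s : ℤ) : MinusRel (e (K i) * e (h j s)) (e (h j s) * e (K i))
  | h_zero (i : Fin N) : MinusRel (e (h i 0)) 0
  | D_h (i : Fin N) (s : ℤ) : MinusRel (e D * e (h i s) * e Dinv) ((qq ^ s) • e (h i s))
  | D_xm (i : Fin N) (r : ℤ) : MinusRel (e D * e (xm i r) * e Dinv) ((qq ^ r) • e (xm i r))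
  | K_xm (i j : Fin N) (r : ℤ) :
      MinusRel (e (K i) * e (xm j r) * e (Kinv i)) ((qp d A i j)⁻¹ • e (xm j r))
  | h_h (i j : Fin N) (k l : ℤ) (hk : k ≠ 0) (hl : l ≠ 0) :
      MinusRel (e (h i k) * e (h j l) - e (h j l) * e (h i k))
        (if l = -k then
          ((k : Fq)⁻¹ * qint d i (k * A i j) * (qi d j - (qi d j)⁻¹)⁻¹) •
            (gammaPow k - gammaPow (-k))
         else 0)
  | h_xm (i j : Fin N) (k l : ℤ) (hk : k ≠ 0) :
      MinusRel (e (h i k) * e (xm j l) - e (xm j l) * e (h i k))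
        ((-((k : Fq)⁻¹ * qint d i (k * A i j))) • (gammaHalf |k| * e (xm j (k + l))))
  | serre_m (i j : Fin N) (k l : ℤ) :
      MinusRel
        (e (xm i (k+1)) * e (xm j l) - (qp d A i j)⁻¹ • (e (xm j l) * e (xm i (k+1))))
        ((qp d A i j)⁻¹ • (e (xm i k) * e (xm j (l+1))) - e (xm j (l+1)) * e (xm i k))
  | dserre (i j : Fin N) (hij : i ≠ j) (ks : Fin (1 - A i j).toNat → ℤ) (l : ℤ) :
      MinusRel
        (∑ σ : Equiv.Perm (Fin (1 - A i j).toNat),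
          ∑ r ∈ Finset.range ((1 - A i j).toNat + 1),
            ((-1 : Fq) ^ r * qbinom d i (1 - A i j).toNat r) •
              dsTerm false i j (1 - A i j).toNat ks l σ r)
        0

/-- The relations of the algebra obtained by dropping the relations among the `x^+`. -/
inductive TildeRel : FA N → FA N → Prop
  | minus {x y : FA N} (hxy : MinusRel d A x y) : TildeRel x y
  | D_xp (i : Fin N) (r : ℤ) : TildeRel (e D * e (xp i r) * e Dinv) ((qq ^ r) • e (xp i r))
  | K_xp (i j : Fin N) (r : ℤ) :
      TildeRel (e (K i) * e (xp j r) * e (Kinv i)) (qp d A i j • e (xp j r))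
  | h_xp (i j : Fin N) (k l : ℤ) (hk : k ≠ 0) :
      TildeRel (e (h i k) * e (xp j l) - e (xp j l) * e (h i k))
        (((k : Fq)⁻¹ * qint d i (k * A i j)) • (gammaHalf (-|k|) * e (xp j (k + l))))
  | xp_xm (i j : Fin N) (k l : ℤ) :
      TildeRel (e (xp i k) * e (xm j l) - e (xm j l) * e (xp i k))
        (if i = j then
          ((qi d i - (qi d i)⁻¹)⁻¹) •
            (gammaHalf (k - l) * psiEl d i (k + l) - gammaHalf (l - k) * phiEl d i (k + l))
         else 0)

/-- The relations of the subalgebra generated by all generators except the `x^+`. -/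
inductive BorelRel : FA N → FA N → Prop
  | minus {x y : FA N} (hxy : MinusRel d A x y) : BorelRel x y
  | xp (i : Fin N) (r : ℤ) : BorelRel (e (xp i r)) 0

variable {d A}

theorem MinusRel.qRel {x y : FA N} (hxy : MinusRel d A x y) : QRel N d A x y := by
  cases hxy with
  | dserre i j hij ks l => exact .dserre false i j hij ks l
  | _ => constructor <;> assumption

theorem commute_of_gen {S : Type*} [Ring S] [Algebra Fq S] {Φ : FA N →ₐ[Fq] S}
    (hΦ : Function.Surjective Φ) {c : S} (hc : ∀ x, Commute (Φ (e x)) c) (s : S) :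
    Commute s c := by
  obtain ⟨a, rfl⟩ := hΦ s
  induction a using FreeAlgebra.induction with
  | grade0 r => rw [AlgHom.commutes]; exact Algebra.commutes r c
  | grade1 x => exact hc x
  | mul a b ha hb => rw [map_mul]; exact ha.mul_left hb
  | add a b ha hb => rw [map_add]; exact ha.add_left hb

variable (d A) in
/-- A surjection from the free algebra respecting the relations without `x^+`. -/
structure IsMinusQuot {S : Type*} [Ring S] [Algebra Fq S] (Φ : FA N →ₐ[Fq] S) : Prop where
  surjective : Function.Surjective Φ
  rel : ∀ ⦃x y⦄, MinusRel d A x y → Φ x = Φ y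

theorem mul_eq_smul_of_conj {S : Type*} [Ring S] [Algebra Fq S] {a b x : S} {c : Fq}
    (hba : b * a = 1) (h : a * x * b = c • x) : a * x = c • (x * a) := by
  rw [← smul_mul_assoc, ← h, mul_assoc, hba, mul_one]

theorem mul_eq_inv_smul_of_conj {S : Type*} [Ring S] [Algebra Fq S] {a b x : S} {c : Fq}
    (hc : c ≠ 0) (hba : b * a = 1) (h : a * x * b = c • x) : b * x = c⁻¹ • (x * b) := by
  rw [eq_inv_smul_iff₀ hc, ← mul_smul_comm, ← h, ← mul_assoc, ← mul_assoc, hba, one_mul]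

theorem sub_inv_mul_qint {i : Fin N} (hd : 0 < d i) (j : Fin N) (s : ℤ) :
    (qi d i - (qi d i)⁻¹) * ((s : Fq)⁻¹ * qint d i (s * A i j))
      = (qp d A i j ^ s - qp d A i j ^ (-s)) / s := by
  have h1 := qi_sub_inv_ne_zero hd
  rw [qint, qp_eq, ← zpow_mul, ← zpow_mul, mul_neg, mul_comm (A i j), mul_left_comm,
    mul_div_cancel₀ _ h1, div_eq_inv_mul]

namespace IsMinusQuot

variable {S : Type*} [Ring S] [Algebra Fq S] {Φ : FA N →ₐ[Fq] S}

/-- The image of `γ^{1/2}`. -/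
def gamma (H : IsMinusQuot d A Φ) : Sˣ where
  val := Φ (e g2)
  inv := Φ (e g2inv)
  val_inv := by rw [← map_mul, H.rel .g_ginv, map_one]
  inv_val := by rw [← map_mul, H.rel .ginv_g, map_one]

variable (H : IsMinusQuot d A Φ)

theorem map_gammaHalf (m : ℤ) : Φ (gammaHalf m) = ↑(H.gamma ^ m) :=
  DrinfeldSerre.map_gammaHalf Φ rfl rfl m

theorem central (s : S) : Commute s H.gamma :=
  commute_of_gen H.surjective (fun x => by
    have h1 := H.rel (.g2_comm x)
    rw [map_mul, map_mul] at h1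
    exact h1.symm) s

theorem central_zpow (n : ℤ) (s : S) : Commute s ↑(H.gamma ^ n) :=
  (H.central s).units_zpow_right n

include H

theorem Kinv_mul_K (i : Fin N) : Φ (e (Kinv i)) * Φ (e (K i)) = 1 := by
  rw [← map_mul, H.rel (.Kinv_K i), map_one]

theorem K_mul_Kinv (i : Fin N) : Φ (e (K i)) * Φ (e (Kinv i)) = 1 := by
  rw [← map_mul, H.rel (.K_Kinv i), map_one]

theorem Dinv_mul_D : Φ (e Dinv) * Φ (e D) = 1 := by
  rw [← map_mul, H.rel .Dinv_D, map_one]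

theorem D_mul_Dinv : Φ (e D) * Φ (e Dinv) = 1 := by
  rw [← map_mul, H.rel .D_Dinv, map_one]

theorem K_mul_xm (i j : Fin N) (r : ℤ) :
    Φ (e (K i)) * Φ (e (xm j r)) = (qp d A i j)⁻¹ • (Φ (e (xm j r)) * Φ (e (K i))) := by
  refine mul_eq_smul_of_conj (H.Kinv_mul_K i) ?_
  rw [← map_mul, ← map_mul, H.rel (.K_xm i j r), map_smul]

theorem Kinv_mul_xm (i j : Fin N) (r : ℤ) :
    Φ (e (Kinv i)) * Φ (e (xm j r)) = qp d A i j • (Φ (e (xm j r)) * Φ (e (Kinv i))) := by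
  have h1 : Φ (e (K i)) * Φ (e (xm j r)) * Φ (e (Kinv i)) = (qp d A i j)⁻¹ • Φ (e (xm j r)) := by
    rw [← map_mul, ← map_mul, H.rel (.K_xm i j r), map_smul]
  rw [mul_eq_inv_smul_of_conj (inv_ne_zero (qp_ne_zero d A i j)) (H.Kinv_mul_K i) h1, inv_inv]

theorem D_mul_xm (i : Fin N) (r : ℤ) :
    Φ (e D) * Φ (e (xm i r)) = qq ^ r • (Φ (e (xm i r)) * Φ (e D)) := by
  refine mul_eq_smul_of_conj H.Dinv_mul_D ?_
  rw [← map_mul, ← map_mul, H.rel (.D_xm i r), map_smul]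

theorem Dinv_mul_xm (i : Fin N) (r : ℤ) :
    Φ (e Dinv) * Φ (e (xm i r)) = (qq ^ r)⁻¹ • (Φ (e (xm i r)) * Φ (e Dinv)) := by
  refine mul_eq_inv_smul_of_conj (zpow_ne_zero _ qq_ne_zero) H.Dinv_mul_D ?_
  rw [← map_mul, ← map_mul, H.rel (.D_xm i r), map_smul]

theorem D_mul_h (i : Fin N) (s : ℤ) :
    Φ (e D) * Φ (e (h i s)) = qq ^ s • (Φ (e (h i s)) * Φ (e D)) := by
  refine mul_eq_smul_of_conj H.Dinv_mul_D ?_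
  rw [← map_mul, ← map_mul, H.rel (.D_h i s), map_smul]

theorem h_xm (i j : Fin N) {s : ℤ} (hs : s ≠ 0) (r : ℤ) :
    Φ (e (h i s)) * Φ (e (xm j r)) - Φ (e (xm j r)) * Φ (e (h i s))
      = (-((s : Fq)⁻¹ * qint d i (s * A i j))) • (↑(H.gamma ^ |s|) * Φ (e (xm j (s + r)))) := by
  rw [← map_mul, ← map_mul, ← map_sub, H.rel (.h_xm i j s r hs), map_smul, map_mul,
    H.map_gammaHalf]

theorem cartanRel_xm (hd : ∀ i, 0 < d i) (i j : Fin N) :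
    CartanRel d Φ H.gamma i (qp d A i j)⁻¹ (fun r => Φ (e (xm j r))) where
  central := H.central
  K_mul r := H.K_mul_xm i j r
  Kinv_mul r := by rw [H.Kinv_mul_xm, inv_inv]
  h_mul s hs r := by
    rw [H.h_xm i j hs, smul_smul, mul_neg, sub_inv_mul_qint (hd i), add_comm r, inv_zpow',
      inv_zpow',
      neg_neg, ← neg_div, neg_sub]

theorem cartanRel_xp (hd : ∀ i, 0 < d i) (i j : Fin N)
    (hK : ∀ r, Φ (e (K i) * e (xp j r) * e (Kinv i)) = Φ (qp d A i j • e (xp j r)))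
    (hh : ∀ s ≠ 0, ∀ r, Φ (e (h i s) * e (xp j r) - e (xp j r) * e (h i s)) =
      Φ (((s : Fq)⁻¹ * qint d i (s * A i j)) • (gammaHalf (-|s|) * e (xp j (s + r))))) :
    CartanRel d Φ H.gamma⁻¹ i (qp d A i j) (fun r => Φ (e (xp j r))) where
  central s := (H.central s).units_inv_right
  K_mul r := mul_eq_smul_of_conj (H.Kinv_mul_K i) (by rw [← map_mul, ← map_mul, hK, map_smul])
  Kinv_mul r := mul_eq_inv_smul_of_conj (qp_ne_zero d A i j) (H.Kinv_mul_K i)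
    (by rw [← map_mul, ← map_mul, hK, map_smul])
  h_mul s hs r := by
    rw [← map_mul, ← map_mul, ← map_sub, hh s hs, map_smul, smul_smul, sub_inv_mul_qint (hd i),
      map_mul, H.map_gammaHalf, add_comm r, inv_zpow']

theorem heisenbergRel (hd : ∀ i, 0 < d i) : HeisenbergRel d A Φ H.gamma where
  central := H.central
  K_comm i j s := by
    have h1 := H.rel (.K_comm_h j i s)
    rw [map_mul, map_mul] at h1
    exact h1.symm
  Kinv_comm i j s := by
    have h1 := H.rel (.K_comm_h j i s)
    rw [map_mul, map_mul] at h1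
    exact Commute.units_inv_right
      (u := ⟨Φ (e (K j)), Φ (e (Kinv j)), H.K_mul_Kinv j, H.Kinv_mul_K j⟩) h1.symm
  h_comm i j s hs l hl := by
    rw [← map_mul, ← map_mul, ← map_sub, H.rel (.h_h i j s l hs hl)]
    split_ifs
    · rw [map_smul, smul_smul, mul_left_comm, mul_inv_cancel₀ (qi_sub_inv_ne_zero (hd j)), mul_one,
        map_sub, gammaPow, gammaPow, H.map_gammaHalf, H.map_gammaHalf, mul_neg]
    · rw [map_zero, smul_zero]

theorem qc_xm (i j : Fin N) :
    QC (qp d A i j)⁻¹ (fun r => Φ (e (xm i r))) (fun r => Φ (e (xm j r))) := fun k l => by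
  have h1 := H.rel (.serre_m i j k l)
  simp only [map_sub, map_mul, map_smul] at h1
  rw [sub_eq_sub_iff_add_eq_add, add_comm (_ • _) (_ • _), ← smul_add] at h1
  exact h1

end IsMinusQuot

end DrinfeldSerre

namespace DrinfeldSerre

section Bracket

variable {S : Type*} [Ring S] [Algebra Fq S]

/-- The part of `[x^+_i, x^-_j]` involving `ψ_i`, as a current in one of the two indices. -/
def psiPart (Φ : FA N →ₐ[Fq] S) (w : Sˣ) (i : Fin N) (c : ℤ) (j : Fin N) (r : ℤ) : S :=
  if j = i then (qi d i - (qi d i)⁻¹)⁻¹ • (↑(w ^ (c - r)) * Φ (psiEl d i (c + r))) else 0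

/-- The part of `[x^+_i, x^-_j]` involving `φ_i`, as a current in one of the two indices. -/
def phiPart (Φ : FA N →ₐ[Fq] S) (w : Sˣ) (i : Fin N) (c : ℤ) (j : Fin N) (r : ℤ) : S :=
  if j = i then (-(qi d i - (qi d i)⁻¹)⁻¹) • (↑(w ^ (-c + r)) * Φ (phiEl d i (c + r))) else 0

variable {d A} {Φ : FA N →ₐ[Fq] S} {w : Sˣ} {b : Fin N → Fin N → Fq} {x : Fin N → ℤ → S}
  (hb : ∀ i j, b i j ≠ 0) (hsymm : ∀ i j, b i j = b j i)
  (hC : ∀ i j, CartanRel d Φ w i (b i j) (x j))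

include hb hsymm hC in
theorem qc_psiPart (i : Fin N) (c : ℤ) (a j : Fin N) : QC (b a j) (x a) (psiPart d Φ w i c j) := by
  by_cases hj : j = i
  · subst hj
    rw [hsymm]
    unfold psiPart
    simpa only [if_true] using ((hC j a).qc_psi (hb _ _) c c).smul _
  · intro k l; simp [psiPart, hj]

include hb hsymm hC in
theorem qc_phiPart (i : Fin N) (c : ℤ) (a j : Fin N) : QC (b a j) (x a) (phiPart d Φ w i c j) := by
  by_cases hj : j = i
  · subst hj
    rw [hsymm]
    unfold phiPart
    simpa only [if_true] using ((hC j a).qc_phi (hb _ _) c (-c)).smul _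
  · intro k l; simp [phiPart, hj]

theorem psiPart_bounded (i : Fin N) (c : ℤ) (j : Fin N) :
    ∃ m, ∀ l < m, psiPart d Φ w i c j l = 0 :=
  ⟨-c, fun l hl => by simp [psiPart, psiEl_of_neg d i (by omega : c + l < 0)]⟩

theorem phiPart_bounded (i : Fin N) (c : ℤ) (j : Fin N) :
    ∃ m, ∀ l > m, phiPart d Φ w i c j l = 0 :=
  ⟨-c, fun l hl => by simp [phiPart, phiEl_of_pos d i (by omega : 0 < c + l)]⟩

/-- The Drinfeld-Serre combination is annihilated by every derivation sending the currents to
the brackets with a current of opposite sign. -/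
theorem snd_permSum_bracket_eq_zero (hA : ∀ i, A i i = 2) (hoff : ∀ i j, i ≠ j → A i j ≤ 0)
    (hb : ∀ i j, b i j ≠ 0) (hsymm : ∀ i j, b i j = b j i)
    (hC : ∀ i j, CartanRel d Φ w i (b i j) (x j))
    (hQ : ∀ i j, QC (b i j) (x i) (x j)) {q : Fq} {i : Fin N} (hq : q ≠ 0) (hq2 : q ^ 2 ≠ 1)
    (hbq : ∀ j, b i j = q ^ (-A i j)) (i₀ : Fin N) (c : ℤ) {j : Fin N} (hij : i ≠ j)
    (ks : Fin (1 - A i j).toNat → ℤ) (l : ℤ) :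
    (permSum q (1 - A i j).toNat
      (fun s => dual (x i (ks s)) (psiPart d Φ w i₀ c i (ks s) + phiPart d Φ w i₀ c i (ks s)))
      (dual (x j l) (psiPart d Φ w i₀ c j l + phiPart d Φ w i₀ c j l))).snd = 0 := by
  obtain ⟨m, hm⟩ : ∃ m : ℕ, -A i j = m := Int.eq_ofNat_of_zero_le (by have := hoff i j hij; omega)
  have hn : (1 - A i j).toNat = m + 1 := by omega
  have hbm : b i j = q ^ m := by rw [hbq, hm, zpow_natCast]
  have hbi : b i i = q⁻¹ ^ 2 := by
    rw [hbq, hA, ← inv_zpow']; rfl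
  generalize (1 - A i j).toNat = n at ks hn
  subst hn
  by_cases hi : i = i₀
  · subst hi
    have h0 : psiPart d Φ w i c j l + phiPart d Φ w i c j l = 0 := by
      simp [psiPart, phiPart, hij.symm]
    rw [h0]
    refine snd_permSum_left_eq_zero hq hq2 ?_ ?_ ?_ ?_ (psiPart_bounded i c i) ?_ ?_
      (phiPart_bounded i c i) ks l
    · rw [← hbi]; exact hQ i i
    · rw [← hbm]; exact hQ i j
    · rw [← hbi]; exact qc_psiPart hb hsymm hC i c i i
    · rw [← hbm, hsymm]; exact qc_psiPart hb hsymm hC i c j i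
    · rw [← hbi]; exact qc_phiPart hb hsymm hC i c i i
    · rw [← hbm, hsymm]; exact qc_phiPart hb hsymm hC i c j i
  · have h0 : ∀ k, psiPart d Φ w i₀ c i k + phiPart d Φ w i₀ c i k = 0 := by
      simp [psiPart, phiPart, hi]
    simp only [h0]
    refine snd_permSum_right_eq_zero hq ?_ ?_ (psiPart_bounded i₀ c j) ?_
      (phiPart_bounded i₀ c j) ks l _
    · rw [← hbi]; exact hQ i i
    · rw [← hbm]; exact qc_psiPart hb hsymm hC i₀ c i j
    · rw [← hbm]; exact qc_phiPart hb hsymm hC i₀ c i j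

theorem QC.snd_dual {F R : Type*} [Field F] [Ring R] [Algebra F R] {b : F} {x y x' y' : ℤ → R}
    (h : QC b x y') (h' : QC b y x') :
    ∀ k l, (dual (x (k + 1)) (x' (k + 1)) * dual (y l) (y' l)
        + dual (y (l + 1)) (y' (l + 1)) * dual (x k) (x' k)).snd
      = (b • (dual (y l) (y' l) * dual (x (k + 1)) (x' (k + 1))
        + dual (x k) (x' k) * dual (y (l + 1)) (y' (l + 1)))).snd := fun k l => by
  simp only [TrivSqZeroExt.snd_add, TrivSqZeroExt.snd_smul, DualNumber.snd_mul, fst_dual,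
    DrinfeldSerre.snd_dual, smul_add]
  have h1 := h k l
  have h2 := h' l k
  simp only [smul_add] at h1 h2
  have h3 := congrArg₂ (· + ·) h1 h2
  beta_reduce at h3
  convert h3 using 1 <;> abel

end Bracket

end DrinfeldSerre

namespace DrinfeldSerre

section Theta

variable {S : Type*} [Ring S] [Algebra Fq S] {d A} {Φ : FA N →ₐ[Fq] S}

/-- A generator acts on a pair `(b, y)`, where `y k` plays the role of the value on `b` of the
operator attached to `x^+_{i,k}`; this is the second component of the action. -/
def thetaSnd (H : IsMinusQuot d A Φ) (i : Fin N) : Gen N → ℤ → (S × (ℤ → S)) →ₗ[Fq] S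
  | xp _ _, _ => 0
  | xm j l, k =>
    LinearMap.mulLeft Fq (Φ (e (xm j l))) ∘ₗ LinearMap.proj k ∘ₗ LinearMap.snd Fq S (ℤ → S) +
      LinearMap.mulLeft Fq (psiPart d Φ H.gamma i k j l + phiPart d Φ H.gamma i k j l) ∘ₗ
        LinearMap.fst Fq S (ℤ → S)
  | h j s, k =>
    LinearMap.mulLeft Fq (Φ (e (h j s))) ∘ₗ LinearMap.proj k ∘ₗ LinearMap.snd Fq S (ℤ → S) -
      LinearMap.mulLeft Fq (((s : Fq)⁻¹ * qint d j (s * A j i)) • ↑(H.gamma ^ (-|s|))) ∘ₗ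
        LinearMap.proj (k + s) ∘ₗ LinearMap.snd Fq S (ℤ → S)
  | K j, k => LinearMap.mulLeft Fq ((qp d A j i)⁻¹ • Φ (e (K j))) ∘ₗ
      LinearMap.proj k ∘ₗ LinearMap.snd Fq S (ℤ → S)
  | Kinv j, k => LinearMap.mulLeft Fq (qp d A j i • Φ (e (Kinv j))) ∘ₗ
      LinearMap.proj k ∘ₗ LinearMap.snd Fq S (ℤ → S)
  | g2, k => LinearMap.mulLeft Fq (Φ (e g2)) ∘ₗ
      LinearMap.proj k ∘ₗ LinearMap.snd Fq S (ℤ → S)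
  | g2inv, k => LinearMap.mulLeft Fq (Φ (e g2inv)) ∘ₗ
      LinearMap.proj k ∘ₗ LinearMap.snd Fq S (ℤ → S)
  | D, k => LinearMap.mulLeft Fq ((qq ^ k)⁻¹ • Φ (e D)) ∘ₗ
      LinearMap.proj k ∘ₗ LinearMap.snd Fq S (ℤ → S)
  | Dinv, k => LinearMap.mulLeft Fq (qq ^ k • Φ (e Dinv)) ∘ₗ
      LinearMap.proj k ∘ₗ LinearMap.snd Fq S (ℤ → S)

/-- The action of the free algebra on pairs. -/
def theta (H : IsMinusQuot d A Φ) (i : Fin N) : FA N →ₐ[Fq] Module.End Fq (S × (ℤ → S)) :=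
  FreeAlgebra.lift Fq fun x =>
    (LinearMap.mulLeft Fq (Φ (e x)) ∘ₗ LinearMap.fst Fq S (ℤ → S)).prod
      (LinearMap.pi (thetaSnd H i x))

variable (H : IsMinusQuot d A Φ) (i : Fin N)

theorem theta_fst (a : FA N) (w : S × (ℤ → S)) : (theta H i a w).1 = Φ a * w.1 := by
  induction a using FreeAlgebra.induction generalizing w with
  | grade0 r => simp [Module.algebraMap_end_apply, Algebra.smul_def]
  | grade1 x => simp [theta, e]
  | mul a b ha hb => rw [map_mul, Module.End.mul_apply, ha, hb, map_mul, mul_assoc]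
  | add a b ha hb => rw [map_add, LinearMap.add_apply, Prod.fst_add, ha, hb, map_add, add_mul]

theorem theta_e_snd (x : Gen N) (w : S × (ℤ → S)) (k : ℤ) :
    (theta H i (e x) w).2 k = thetaSnd H i x k w := by
  simp [theta, e]

theorem theta_xp (j : Fin N) (r : ℤ) (w : S × (ℤ → S)) (k : ℤ) :
    (theta H i (e (xp j r)) w).2 k = 0 := by rw [theta_e_snd]; rfl

theorem theta_xm (j : Fin N) (l : ℤ) (w : S × (ℤ → S)) (k : ℤ) :
    (theta H i (e (xm j l)) w).2 k = Φ (e (xm j l)) * w.2 k +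
      (psiPart d Φ H.gamma i k j l + phiPart d Φ H.gamma i k j l) * w.1 := by
  rw [theta_e_snd]; rfl

theorem theta_h (j : Fin N) (s : ℤ) (w : S × (ℤ → S)) (k : ℤ) :
    (theta H i (e (h j s)) w).2 k = Φ (e (h j s)) * w.2 k -
      ((s : Fq)⁻¹ * qint d j (s * A j i)) • (↑(H.gamma ^ (-|s|)) * w.2 (k + s)) := by
  rw [theta_e_snd, ← smul_mul_assoc]; rfl

theorem theta_K (j : Fin N) (w : S × (ℤ → S)) (k : ℤ) :
    (theta H i (e (K j)) w).2 k = (qp d A j i)⁻¹ • (Φ (e (K j)) * w.2 k) := by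
  rw [theta_e_snd, ← smul_mul_assoc]; rfl

theorem theta_Kinv (j : Fin N) (w : S × (ℤ → S)) (k : ℤ) :
    (theta H i (e (Kinv j)) w).2 k = qp d A j i • (Φ (e (Kinv j)) * w.2 k) := by
  rw [theta_e_snd, ← smul_mul_assoc]; rfl

theorem theta_g2 (w : S × (ℤ → S)) (k : ℤ) :
    (theta H i (e g2) w).2 k = Φ (e g2) * w.2 k := by rw [theta_e_snd]; rfl

theorem theta_g2inv (w : S × (ℤ → S)) (k : ℤ) :
    (theta H i (e g2inv) w).2 k = Φ (e g2inv) * w.2 k := by rw [theta_e_snd]; rfl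

theorem theta_D (w : S × (ℤ → S)) (k : ℤ) :
    (theta H i (e D) w).2 k = (qq ^ k)⁻¹ • (Φ (e D) * w.2 k) := by
  rw [theta_e_snd, ← smul_mul_assoc]; rfl

theorem theta_Dinv (w : S × (ℤ → S)) (k : ℤ) :
    (theta H i (e Dinv) w).2 k = qq ^ k • (Φ (e Dinv) * w.2 k) := by
  rw [theta_e_snd, ← smul_mul_assoc]; rfl

theorem theta_gammaHalf (m : ℤ) (w : S × (ℤ → S)) (k : ℤ) :
    (theta H i (gammaHalf m) w).2 k = ↑(H.gamma ^ m) * w.2 k := by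
  rw [← H.map_gammaHalf]
  have hp : ∀ (x : FA N), (∀ w k, (theta H i x w).2 k = Φ x * w.2 k) → ∀ (n : ℕ) w k,
      (theta H i (x ^ n) w).2 k = Φ (x ^ n) * w.2 k := fun x hx n => by
    induction n with
    | zero => simp
    | succ n ih =>
      intro w k
      rw [pow_succ, map_mul, Module.End.mul_apply, ih, hx, map_mul, mul_assoc]
  rw [gammaHalf]
  split_ifs
  · exact hp _ (theta_g2 H i) _ w k
  · exact hp _ (theta_g2inv H i) _ w k

theorem IsExpSeq.conj {F R : Type*} [Field F] [Ring R] [Algebra F R] {η t : F} {E P : ℕ → R}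
    (h : IsExpSeq η E P) {z : R} (hz : ∀ l, z * E l = t ^ (l + 1) • (E l * z)) (n : ℕ) :
    z * P n = t ^ n • (P n * z) := by
  induction n using Nat.strong_induction_on with
  | _ n ih =>
    cases n with
    | zero => simp [h.1]
    | succ n =>
      rw [h.2, mul_smul_comm, smul_mul_assoc, smul_comm (t ^ (n + 1)), Finset.mul_sum,
        Finset.sum_mul]
      congr 1
      rw [Finset.smul_sum]
      refine Finset.sum_congr rfl fun l hl => ?_
      have hl' := Finset.mem_range.mp hl
      rw [mul_smul_comm, smul_mul_assoc, smul_comm (t ^ (n + 1)), ← mul_assoc, hz, smul_mul_assoc,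
        mul_assoc, ih (n - l) (by omega), mul_smul_comm, smul_smul (t ^ (l + 1)),
        ← pow_add, mul_assoc, show l + 1 + (n - l) = n + 1 by omega]

namespace IsMinusQuot

include H

theorem K_comm_K (i j : Fin N) : Commute (Φ (e (K i))) (Φ (e (K j))) := by
  have h1 := H.rel (.K_comm_K i j)
  rwa [map_mul, map_mul] at h1

theorem K_comm_h (i j : Fin N) (s : ℤ) : Commute (Φ (e (K i))) (Φ (e (h j s))) := by
  have h1 := H.rel (.K_comm_h i j s)
  rwa [map_mul, map_mul] at h1

theorem K_comm_D (i : Fin N) : Commute (Φ (e (K i))) (Φ (e D)) := by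
  have h1 := H.rel (.K_comm_D i)
  rwa [map_mul, map_mul] at h1

omit H in
theorem commute_of_mul_eq_one {S : Type*} [Ring S] {a b c : S} (hab : a * b = 1) (hba : b * a = 1)
    (hc : Commute c a) :
    Commute c b :=
  Commute.units_inv_right (u := ⟨a, b, hab, hba⟩) hc

theorem K_comm_Kinv (i j : Fin N) : Commute (Φ (e (K i))) (Φ (e (Kinv j))) :=
  commute_of_mul_eq_one (H.K_mul_Kinv j) (H.Kinv_mul_K j) (H.K_comm_K i j)

theorem D_comm_Kinv (i : Fin N) : Commute (Φ (e D)) (Φ (e (Kinv i))) :=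
  commute_of_mul_eq_one (H.K_mul_Kinv i) (H.Kinv_mul_K i) (H.K_comm_D i).symm

theorem K_comm_psi (i j : Fin N) (m : ℤ) : Commute (Φ (e (K i))) (Φ (psiEl d j m)) := by
  rw [psiEl]
  split_ifs
  · rw [map_mul]
    refine (H.K_comm_K i j).mul_right ?_
    have := (isExpSeq_Ppos d Φ j).conj (z := Φ (e (K i))) (t := 1) (fun l => by
      rw [one_pow, one_smul, (H.K_comm_h i j _).eq]) m.toNat
    rwa [one_pow, one_smul] at this
  · rw [map_zero]; exact Commute.zero_right _

theorem K_comm_phi (i j : Fin N) (m : ℤ) : Commute (Φ (e (K i))) (Φ (phiEl d j m)) := by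
  rw [phiEl]
  split_ifs
  · rw [map_mul]
    refine (H.K_comm_Kinv i j).mul_right ?_
    have := (isExpSeq_Pneg d Φ j).conj (z := Φ (e (K i))) (t := 1) (fun l => by
      rw [one_pow, one_smul, (H.K_comm_h i j _).eq]) (-m).toNat
    rwa [one_pow, one_smul] at this
  · rw [map_zero]; exact Commute.zero_right _

theorem D_mul_psi (j : Fin N) (m : ℤ) :
    Φ (e D) * Φ (psiEl d j m) = qq ^ m • (Φ (psiEl d j m) * Φ (e D)) := by
  rcases lt_or_ge m 0 with hm | hm
  · simp [psiEl_of_neg d j hm]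
  obtain ⟨n, rfl⟩ := Int.eq_ofNat_of_zero_le hm
  rw [psiEl_natCast, map_mul, ← mul_assoc, ← (H.K_comm_D j).eq, mul_assoc,
    (isExpSeq_Ppos d Φ j).conj (z := Φ (e D)) (t := qq) (fun l => by
      rw [H.D_mul_h]; norm_cast) n, mul_smul_comm, mul_assoc, zpow_natCast]

theorem D_mul_phi (j : Fin N) (m : ℤ) :
    Φ (e D) * Φ (phiEl d j m) = qq ^ m • (Φ (phiEl d j m) * Φ (e D)) := by
  rcases lt_or_ge 0 m with hm | hm
  · simp [phiEl_of_pos d j hm]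
  obtain ⟨n, rfl⟩ : ∃ n : ℕ, m = -n := ⟨(-m).toNat, by omega⟩
  rw [phiEl_neg_natCast, map_mul, ← mul_assoc, (H.D_comm_Kinv j).eq, mul_assoc,
    (isExpSeq_Pneg d Φ j).conj (z := Φ (e D)) (t := qq⁻¹) (fun l => by
      rw [H.D_mul_h, zpow_neg, inv_pow]; norm_cast) n, mul_smul_comm, mul_assoc, zpow_neg,
    zpow_natCast, inv_pow]

theorem K_comm_bracket (i j a : Fin N) (k l : ℤ) : Commute (Φ (e (K a)))
    (psiPart d Φ H.gamma i k j l + phiPart d Φ H.gamma i k j l) := by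
  rw [psiPart, phiPart]
  split_ifs
  · exact (((H.central_zpow _ _).mul_right (H.K_comm_psi a i _)).smul_right _).add_right
      (((H.central_zpow _ _).mul_right (H.K_comm_phi a i _)).smul_right _)
  · rw [add_zero]; exact Commute.zero_right _

theorem D_mul_bracket (i j : Fin N) (k l : ℤ) :
    Φ (e D) * (psiPart d Φ H.gamma i k j l + phiPart d Φ H.gamma i k j l)
      = qq ^ (k + l) •
        ((psiPart d Φ H.gamma i k j l + phiPart d Φ H.gamma i k j l) * Φ (e D)) := by
  rw [psiPart, phiPart]
  split_ifs
  · rw [mul_add, add_mul, smul_add, mul_smul_comm, mul_smul_comm, ← mul_assoc, ← mul_assoc,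
      (H.central_zpow _ _).eq, (H.central_zpow _ _).eq, mul_assoc, mul_assoc, H.D_mul_psi,
      H.D_mul_phi, smul_mul_assoc, smul_mul_assoc, mul_smul_comm, mul_smul_comm, mul_assoc,
      mul_assoc, smul_comm, smul_comm (qq ^ _)]
    rw [smul_comm (qq ^ _) (-(qi d i - (qi d i)⁻¹)⁻¹)]
  · simp

/-- The Jacobi identity for `h`, `x^+` and `x^-`. -/
theorem h_bracket (hd : ∀ i, 0 < d i) (i a : Fin N) {s : ℤ} (hs : s ≠ 0) (k l : ℤ) :
    Φ (e (h a s)) * (psiPart d Φ H.gamma i k i l + phiPart d Φ H.gamma i k i l)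
        - (psiPart d Φ H.gamma i k i l + phiPart d Φ H.gamma i k i l) * Φ (e (h a s))
      = ((s : Fq)⁻¹ * qint d a (s * A a i)) •
        (↑(H.gamma ^ (-|s|)) *
            (psiPart d Φ H.gamma i (k + s) i l + phiPart d Φ H.gamma i (k + s) i l)
          - ↑(H.gamma ^ |s|) *
            (psiPart d Φ H.gamma i k i (s + l) + phiPart d Φ H.gamma i k i (s + l))) := by
  have h1 := (H.heisenbergRel hd).h_psi a i hs (k + l)
  have h2 := (H.heisenbergRel hd).h_phi a i hs (k + l)
  simp only [psiPart, phiPart, if_true]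
  rw [mul_add, add_mul, mul_smul_comm, mul_smul_comm, ← mul_assoc, ← mul_assoc,
    (H.central_zpow _ (Φ (e (h a s)))).eq, (H.central_zpow _ (Φ (e (h a s)))).eq, mul_assoc,
    mul_assoc, smul_mul_assoc, smul_mul_assoc, mul_assoc, mul_assoc, add_sub_add_comm, ← smul_sub,
    ← smul_sub, ← mul_sub, ← mul_sub, h1, h2]
  have e1 : k + s + l = k + l + s := by ring
  have e2 : k + (s + l) = k + l + s := by ring
  rw [e1, e2]
  simp only [mul_smul_comm, mul_add, sub_mul, mul_sub, ← mul_assoc, ← Units.val_mul, ← zpow_add]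
  have e3 : k - l + (s - |s|) = -|s| + (k + s - l) := by ring
  have e4 : k - l + (|s| - s) = |s| + (k - (s + l)) := by ring
  have e5 : -k + l + -(s + |s|) = -|s| + (-(k + s) + l) := by ring
  have e6 : -k + l + (s + |s|) = |s| + (-k + (s + l)) := by ring
  rw [e3, e4, e5, e6]
  simp only [smul_sub, smul_add, neg_smul, smul_neg,
    smul_comm ((s : Fq)⁻¹ * qint d a (s * A a i)) (qi d i - (qi d i)⁻¹)⁻¹]
  abel

end IsMinusQuot

end Theta

end DrinfeldSerre

namespace DrinfeldSerre

section ThetaRel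

variable {S : Type*} [Ring S] [Algebra Fq S] {d A} {Φ : FA N →ₐ[Fq] S}

/-- The deformation of `Φ` by the brackets with `x^+_{i,k}`. -/
def deform (H : IsMinusQuot d A Φ) (i : Fin N) (k : ℤ) : FA N →ₐ[Fq] DualNumber S :=
  FreeAlgebra.lift Fq fun
    | xm j l => dual (Φ (e (xm j l))) (psiPart d Φ H.gamma i k j l + phiPart d Φ H.gamma i k j l)
    | x => dual (Φ (e x)) 0

variable (H : IsMinusQuot d A Φ) (i : Fin N) (k : ℤ)

theorem deform_xm (j : Fin N) (l : ℤ) : deform H i k (e (xm j l)) =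
    dual (Φ (e (xm j l))) (psiPart d Φ H.gamma i k j l + phiPart d Φ H.gamma i k j l) := by
  simp [deform, e]

theorem fst_deform (a : FA N) : (deform H i k a).fst = Φ a := by
  induction a using FreeAlgebra.induction with
  | grade0 r => rw [AlgHom.commutes, AlgHom.commutes, TrivSqZeroExt.algebraMap_eq_inl',
      TrivSqZeroExt.fst_inl]
  | grade1 x => cases x <;> simp [deform, e]
  | mul a b ha hb => rw [map_mul, TrivSqZeroExt.fst_mul, ha, hb, map_mul]
  | add a b ha hb => rw [map_add, TrivSqZeroExt.fst_add, ha, hb, map_add]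

/-- The elements on which the action is given by the deformation. -/
def deformSubalgebra : Subalgebra Fq (FA N) where
  carrier := {a | ∀ w, (theta H i a w).2 k = Φ a * w.2 k + (deform H i k a).snd * w.1}
  mul_mem' {a b} ha hb w := by
    rw [map_mul, Module.End.mul_apply, ha, hb, theta_fst, map_mul, map_mul, DualNumber.snd_mul,
      fst_deform, fst_deform]
    simp only [mul_add, add_mul, mul_assoc, add_assoc]
  add_mem' {a b} ha hb w := by
    rw [map_add, LinearMap.add_apply, Prod.snd_add, Pi.add_apply, ha, hb, map_add, map_add,
      TrivSqZeroExt.snd_add, add_mul, add_mul]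
    abel
  algebraMap_mem' r w := by
    rw [AlgHom.commutes, AlgHom.commutes, AlgHom.commutes, TrivSqZeroExt.algebraMap_eq_inl',
      TrivSqZeroExt.snd_inl, zero_mul, add_zero, Module.algebraMap_end_apply, Prod.smul_snd,
      Pi.smul_apply, Algebra.smul_def]

theorem xm_mem_deformSubalgebra (j : Fin N) (l : ℤ) : e (xm j l) ∈ deformSubalgebra H i k :=
  fun w => by rw [theta_xm, deform_xm, snd_dual]

theorem permSum_mem {F T : Type*} [Field F] [Ring T] [Algebra F T] (U : Subalgebra F T) (q : F)
    {n : ℕ} {x : Fin n → T} {v : T} (hx : ∀ s, x s ∈ U) (hv : v ∈ U) : permSum q n x v ∈ U := by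
  have := map_permSum q U.val n (fun s => ⟨x s, hx s⟩) ⟨v, hv⟩
  exact this ▸ Subtype.property _

variable (hd : ∀ i, 0 < d i) (hA : ∀ i, A i i = 2) (hoff : ∀ i j, i ≠ j → A i j ≤ 0)
  (hsym : ∀ i j, d i * A i j = d j * A j i)

include hsym in
theorem qp_symm (i j : Fin N) : qp d A i j = qp d A j i := by rw [qp, qp, hsym]

include hd hsym in
theorem qc_bracket (a j : Fin N) : QC (qp d A a j)⁻¹ (fun r => Φ (e (xm a r)))
    (fun l => psiPart d Φ H.gamma i k j l + phiPart d Φ H.gamma i k j l) := fun l m => by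
  have hb : ∀ i j, (qp d A i j)⁻¹ ≠ 0 := fun i j => inv_ne_zero (qp_ne_zero d A i j)
  have hs : ∀ i j, (qp d A i j)⁻¹ = (qp d A j i)⁻¹ := fun i j => by rw [qp_symm hsym]
  have h1 := qc_psiPart (x := fun j r => Φ (e (xm j r))) hb hs (H.cartanRel_xm hd) i k a j l m
  have h2 := qc_phiPart (x := fun j r => Φ (e (xm j r))) hb hs (H.cartanRel_xm hd) i k a j l m
  have h3 := congrArg₂ (· + ·) h1 h2
  beta_reduce at h3
  rw [← smul_add] at h3
  beta_reduce
  convert h3 using 1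
  · noncomm_ring
  · congr 1; noncomm_ring

include hd hA hoff hsym in
theorem snd_deform_dserre {a b : Fin N} (hab : a ≠ b) (ks : Fin (1 - A a b).toNat → ℤ) (l : ℤ) :
    (deform H i k (permSum (qi d a) (1 - A a b).toNat (fun s => e (xm a (ks s)))
      (e (xm b l)))).snd = 0 := by
  rw [map_permSum]
  simp only [deform_xm]
  refine snd_permSum_bracket_eq_zero (x := fun j r => Φ (e (xm j r))) hA hoff
    (fun i j => inv_ne_zero (qp_ne_zero d A i j)) (fun i j => by rw [qp_symm hsym])
    (H.cartanRel_xm hd) H.qc_xm (qi_ne_zero d a) (qi_zpow_ne_one (hd a) two_ne_zero) (fun j => ?_)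
    i k hab ks l
  rw [qp_eq, zpow_neg]

include hd hA hoff hsym in
theorem theta_rel {x y : FA N} (hxy : MinusRel d A x y) : theta H i x = theta H i y := by
  refine LinearMap.ext fun w => Prod.ext ?_ (funext fun k => ?_)
  · rw [theta_fst, theta_fst, H.rel hxy]
  have hrel := H.rel hxy
  cases hxy with
  | K_Kinv j =>
    rw [map_mul, Module.End.mul_apply, theta_K, theta_Kinv, mul_smul_comm, ← mul_assoc,
      inv_smul_smul₀ (qp_ne_zero d A j i), H.K_mul_Kinv, one_mul, map_one, Module.End.one_apply]
  | Kinv_K j =>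
    rw [map_mul, Module.End.mul_apply, theta_Kinv, theta_K, mul_smul_comm, ← mul_assoc,
      smul_inv_smul₀ (qp_ne_zero d A j i), H.Kinv_mul_K, one_mul, map_one, Module.End.one_apply]
  | D_Dinv =>
    rw [map_mul, Module.End.mul_apply, theta_D, theta_Dinv, mul_smul_comm, ← mul_assoc,
      inv_smul_smul₀ (zpow_ne_zero _ qq_ne_zero), H.D_mul_Dinv, one_mul, map_one,
      Module.End.one_apply]
  | Dinv_D =>
    rw [map_mul, Module.End.mul_apply, theta_Dinv, theta_D, mul_smul_comm, ← mul_assoc,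
      smul_inv_smul₀ (zpow_ne_zero _ qq_ne_zero), H.Dinv_mul_D, one_mul, map_one,
      Module.End.one_apply]
  | g_ginv =>
    rw [map_mul, Module.End.mul_apply, theta_g2, theta_g2inv, ← mul_assoc, ← map_mul, hrel,
      map_one, one_mul, map_one, Module.End.one_apply]
  | ginv_g =>
    rw [map_mul, Module.End.mul_apply, theta_g2inv, theta_g2, ← mul_assoc, ← map_mul, hrel,
      map_one, one_mul, map_one, Module.End.one_apply]
  | g2_comm x =>
    have hc : ∀ s t, s * (Φ (e g2) * t) = Φ (e g2) * (s * t) := fun s t => by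
      rw [← mul_assoc, show s * Φ (e g2) = Φ (e g2) * s from (H.central s).eq, mul_assoc]
    rw [map_mul, map_mul, Module.End.mul_apply, Module.End.mul_apply]
    cases x <;> simp only [theta_xp, theta_xm, theta_h, theta_K, theta_Kinv, theta_g2, theta_g2inv,
      theta_D, theta_Dinv, theta_fst, mul_add, mul_sub, mul_smul_comm, mul_zero, hc]
  | g2inv_comm x =>
    have hc : ∀ s t, s * (Φ (e g2inv) * t) = Φ (e g2inv) * (s * t) := fun s t => by
      rw [← mul_assoc, show s * Φ (e g2inv) = Φ (e g2inv) * s from (H.central s).units_inv_right.eq,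
        mul_assoc]
    rw [map_mul, map_mul, Module.End.mul_apply, Module.End.mul_apply]
    cases x <;> simp only [theta_xp, theta_xm, theta_h, theta_K, theta_Kinv, theta_g2, theta_g2inv,
      theta_D, theta_Dinv, theta_fst, mul_add, mul_sub, mul_smul_comm, mul_zero, hc]
  | K_comm_K a b =>
    rw [map_mul, map_mul, Module.End.mul_apply, Module.End.mul_apply, theta_K, theta_K, theta_K,
      theta_K, mul_smul_comm, mul_smul_comm, smul_comm, ← mul_assoc, ← mul_assoc,
      (H.K_comm_K a b).eq]
  | K_comm_D a =>
    rw [map_mul, map_mul, Module.End.mul_apply, Module.End.mul_apply, theta_K, theta_D, theta_D,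
      theta_K, mul_smul_comm, mul_smul_comm, smul_comm, ← mul_assoc, ← mul_assoc,
      (H.K_comm_D a).eq]
  | K_comm_h a b s =>
    rw [map_mul, map_mul, Module.End.mul_apply, Module.End.mul_apply, theta_K, theta_h, theta_h,
      theta_K, theta_K, mul_sub, smul_sub, mul_smul_comm, mul_smul_comm, mul_smul_comm, ← mul_assoc,
      ← mul_assoc, ← mul_assoc, ← mul_assoc, (H.K_comm_h a b s).eq, (H.central_zpow _ _).eq,
      smul_comm (qp d A a i)⁻¹ ((s : Fq)⁻¹ * _)]
  | h_zero a =>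
    rw [theta_h, hrel, map_zero]
    simp
  | D_h a s =>
    have h1 : Φ (e D) * Φ (e (h a s)) * Φ (e Dinv) = qq ^ s • Φ (e (h a s)) := by
      rw [← map_mul, ← map_mul, hrel, map_smul]
    have h2 : ∀ y, Φ (e D) * (Φ (e (h a s)) * (Φ (e Dinv) * y)) = qq ^ s • (Φ (e (h a s)) * y) :=
      fun y => by rw [← mul_assoc, ← mul_assoc, h1, smul_mul_assoc]
    have h3 : ∀ y, Φ (e D) * (↑(H.gamma ^ (-|s|)) * (Φ (e Dinv) * y))
        = ↑(H.gamma ^ (-|s|)) * y := fun y => by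
      rw [← mul_assoc, (H.central_zpow _ _).eq, mul_assoc, ← mul_assoc (Φ (e D)), H.D_mul_Dinv,
        one_mul]
    rw [map_mul, map_mul, Module.End.mul_apply, Module.End.mul_apply, theta_D, theta_h, theta_Dinv,
      theta_Dinv, map_smul, LinearMap.smul_apply, Prod.smul_snd, Pi.smul_apply, theta_h]
    simp only [mul_sub, mul_smul_comm, h2, h3, smul_sub, smul_smul]
    have h4 : (qq ^ k : Fq) ≠ 0 := zpow_ne_zero _ qq_ne_zero
    congr 2
    · field_simp
    · rw [zpow_add₀ qq_ne_zero]; field_simp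
  | D_xm a r =>
    have h1 : Φ (e D) * Φ (e (xm a r)) * Φ (e Dinv) = qq ^ r • Φ (e (xm a r)) := by
      rw [← map_mul, ← map_mul, hrel, map_smul]
    have h2 : ∀ y, Φ (e D) * (Φ (e (xm a r)) * (Φ (e Dinv) * y)) = qq ^ r • (Φ (e (xm a r)) * y) :=
      fun y => by rw [← mul_assoc, ← mul_assoc, h1, smul_mul_assoc]
    have h4 : (qq ^ k : Fq) ≠ 0 := zpow_ne_zero _ qq_ne_zero
    rw [map_mul, map_mul, Module.End.mul_apply, Module.End.mul_apply, theta_D, theta_xm, theta_Dinv,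
      theta_fst, map_smul, LinearMap.smul_apply, Prod.smul_snd, Pi.smul_apply, theta_xm, mul_add,
      ← mul_assoc (Φ (e D)) (_ + _), H.D_mul_bracket, smul_mul_assoc, mul_assoc _ (Φ (e D)),
      ← mul_assoc (Φ (e D)) (Φ (e Dinv)), H.D_mul_Dinv, one_mul, mul_smul_comm, mul_smul_comm, h2,
      smul_add, smul_add, inv_smul_smul₀ h4, zpow_add₀ qq_ne_zero, smul_smul, inv_mul_cancel_left₀ h4]
  | K_xm a b r =>
    have h1 : Φ (e (K a)) * Φ (e (xm b r)) * Φ (e (Kinv a)) = (qp d A a b)⁻¹ • Φ (e (xm b r)) := by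
      rw [← map_mul, ← map_mul, hrel, map_smul]
    have h2 : ∀ y, Φ (e (K a)) * (Φ (e (xm b r)) * (Φ (e (Kinv a)) * y))
        = (qp d A a b)⁻¹ • (Φ (e (xm b r)) * y) :=
      fun y => by rw [← mul_assoc, ← mul_assoc, h1, smul_mul_assoc]
    have h3 : ∀ t : S, (qp d A a i)⁻¹ •
          ((psiPart d Φ H.gamma i k b r + phiPart d Φ H.gamma i k b r) * t)
        = (qp d A a b)⁻¹ • ((psiPart d Φ H.gamma i k b r + phiPart d Φ H.gamma i k b r) * t) :=
      fun t => by
        by_cases hb : b = i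
        · rw [hb]
        · simp [psiPart, phiPart, hb]
    rw [map_mul, map_mul, Module.End.mul_apply, Module.End.mul_apply, theta_K, theta_xm, theta_Kinv,
      theta_fst, map_smul, LinearMap.smul_apply, Prod.smul_snd, Pi.smul_apply, theta_xm, mul_add,
      ← mul_assoc (Φ (e (K a))) (_ + _), (H.K_comm_bracket i b a k r).eq, mul_assoc _ (Φ (e (K a))),
      ← mul_assoc (Φ (e (K a))) (Φ (e (Kinv a))), H.K_mul_Kinv, one_mul, mul_smul_comm,
      mul_smul_comm, h2, smul_add, smul_add, inv_smul_smul₀ (qp_ne_zero d A a i), h3]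
  | h_h a b s l hs hl =>
    have h1 : ∀ x y : FA N, (∀ w k, (theta H i x w).2 k = Φ x * w.2 k) → Φ y = Φ x →
      (theta H i y w).2 k = Φ y * w.2 k → (theta H i y w).2 k = (theta H i x w).2 k :=
        fun x y hx hy h1 => by rw [h1, hy, hx]
    refine h1 _ _ (fun w k => ?_) hrel ?_
    · split_ifs
      · rw [map_smul, map_smul, map_sub, map_sub, LinearMap.smul_apply, LinearMap.sub_apply,
          Prod.smul_snd, Pi.smul_apply, Prod.snd_sub, Pi.sub_apply, gammaPow, gammaPow,
          theta_gammaHalf, theta_gammaHalf, H.map_gammaHalf, H.map_gammaHalf, smul_mul_assoc,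
          sub_mul]
      · simp
    · have h2 : ∀ (m : ℤ) (s t : S), s * (↑(H.gamma ^ m) * t) = ↑(H.gamma ^ m) * (s * t) :=
        fun m s t => by rw [← mul_assoc, (H.central_zpow _ _).eq, mul_assoc]
      rw [map_sub, map_mul, map_mul, LinearMap.sub_apply, Module.End.mul_apply,
        Module.End.mul_apply, Prod.snd_sub, Pi.sub_apply]
      simp only [theta_h, map_sub, map_mul, mul_sub, sub_mul, mul_smul_comm, smul_sub,
        h2 _ (Φ (e (h a s))), h2 _ (Φ (e (h b l))), mul_assoc]
      rw [add_right_comm k l s, smul_comm ((s : Fq)⁻¹ * qint d a (s * A a i)),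
        h2 (-|s|) ↑(H.gamma ^ (-|l|))]
      abel
  | h_xm a b s l hs =>
    have h1 := H.h_xm a b hs l
    have h2 : ∀ (m : ℤ) (s t : S), s * (↑(H.gamma ^ m) * t) = ↑(H.gamma ^ m) * (s * t) :=
      fun m s t => by rw [← mul_assoc, (H.central_zpow _ _).eq, mul_assoc]
    rw [map_sub, map_mul, map_mul, LinearMap.sub_apply, Module.End.mul_apply,
      Module.End.mul_apply, Prod.snd_sub, Pi.sub_apply, theta_h, theta_xm, theta_xm, theta_xm,
      theta_h, theta_fst, map_smul, LinearMap.smul_apply, Prod.smul_snd, Pi.smul_apply,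
      map_mul, Module.End.mul_apply, theta_gammaHalf, theta_xm]
    have h3 : Φ (e (h a s)) * (psiPart d Φ H.gamma i k b l + phiPart d Φ H.gamma i k b l)
        - (psiPart d Φ H.gamma i k b l + phiPart d Φ H.gamma i k b l) * Φ (e (h a s))
      = ((s : Fq)⁻¹ * qint d a (s * A a i)) • (↑(H.gamma ^ (-|s|)) *
            (psiPart d Φ H.gamma i (k + s) b l + phiPart d Φ H.gamma i (k + s) b l))
          - ((s : Fq)⁻¹ * qint d a (s * A a b)) • (↑(H.gamma ^ |s|) *
            (psiPart d Φ H.gamma i k b (s + l) + phiPart d Φ H.gamma i k b (s + l))) := by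
      by_cases hb : b = i
      · rw [hb, H.h_bracket hd i a hs, smul_sub]
      · simp [psiPart, phiPart, hb]
    rw [sub_eq_iff_eq_add] at h1 h3
    rw [mul_add, ← mul_assoc (Φ (e (h a s))), h1, ← mul_assoc (Φ (e (h a s))), h3]
    simp only [mul_add, add_mul, mul_sub, sub_mul, smul_add, mul_smul_comm, smul_mul_assoc, h2,
      mul_assoc, neg_smul, neg_mul]
    abel
  | serre_m a b s l =>
    have hm := fun c m => xm_mem_deformSubalgebra H i k c m
    have h1 := Subalgebra.sub_mem _ (mul_mem (hm a (s + 1)) (hm b l))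
      (Subalgebra.smul_mem _ (mul_mem (hm b l) (hm a (s + 1))) (qp d A a b)⁻¹)
    have h2 := Subalgebra.sub_mem _ (Subalgebra.smul_mem _ (mul_mem (hm a s) (hm b (l + 1)))
      (qp d A a b)⁻¹) (mul_mem (hm b (l + 1)) (hm a s))
    rw [h1 w, h2 w, hrel]
    congr 2
    have h3 := QC.snd_dual (qc_bracket H i k hd hsym a b)
      (by rw [qp_symm hsym]; exact qc_bracket H i k hd hsym b a) s l
    simp only [← deform_xm, smul_add, TrivSqZeroExt.snd_add] at h3
    simp only [map_sub, map_mul, map_smul, TrivSqZeroExt.snd_sub]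
    rw [sub_eq_sub_iff_add_eq_add, h3, add_comm]
  | dserre a b hab ks l =>
    rw [sum_dsTerm_eq (hd a)] at hrel ⊢
    simp only [Bool.false_eq_true, if_false] at hrel ⊢
    have hmem := permSum_mem (deformSubalgebra H i k) (qi d a)
      (fun s => xm_mem_deformSubalgebra H i k a (ks s)) (xm_mem_deformSubalgebra H i k b l)
    rw [hmem w, hrel, snd_deform_dserre H i k hd hA hoff hsym hab]
    simp

end ThetaRel

end DrinfeldSerre

namespace DrinfeldSerre

section SerrePlus

variable {S : Type*} [Ring S] [Algebra Fq S] {d A} {Φ : FA N →ₐ[Fq] S}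

/-- The algebra homomorphism `a ↦ a + ε [a, c]`. -/
def bracketHom {F R : Type*} [Field F] [Ring R] [Algebra F R] (c : R) : R →ₐ[F] DualNumber R where
  toFun a := dual a (a * c - c * a)
  map_one' := by ext <;> simp
  map_mul' a b := by
    ext
    · simp
    · rw [DualNumber.snd_mul]; simp only [fst_dual, snd_dual]; noncomm_ring
  map_zero' := by ext <;> simp
  map_add' a b := by
    ext
    · simp
    · rw [TrivSqZeroExt.snd_add]; simp only [snd_dual]; noncomm_ring
  commutes' r := by
    ext
    · simp [TrivSqZeroExt.algebraMap_eq_inl']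
    · simp [TrivSqZeroExt.algebraMap_eq_inl', Algebra.commutes r c]

theorem bracketHom_apply {F R : Type*} [Field F] [Ring R] [Algebra F R] (c a : R) :
    bracketHom (F := F) c a = dual a (a * c - c * a) := rfl

theorem commute_of_snd_bracketHom {F R : Type*} [Field F] [Ring R] [Algebra F R] {c a : R}
    (h : (bracketHom (F := F) c a).snd = 0) : Commute a c := by
  rw [bracketHom_apply, snd_dual, sub_eq_zero] at h
  exact h

variable (H : IsMinusQuot d A Φ) (hT : ∀ ⦃x y⦄, TildeRel d A x y → Φ x = Φ y)

include hT in
theorem bracketHom_xp (i j : Fin N) (k l : ℤ) :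
    bracketHom (F := Fq) (Φ (e (xm j l))) (Φ (e (xp i k))) = dual (Φ (e (xp i k)))
      (psiPart d Φ H.gamma⁻¹ j l i k + phiPart d Φ H.gamma⁻¹ j l i k) := by
  rw [bracketHom_apply, ← map_mul, ← map_mul, ← map_sub, hT (.xp_xm i j k l), psiPart, phiPart]
  split_ifs with hij
  · subst hij
    rw [map_smul, map_sub, map_mul, map_mul, H.map_gammaHalf, H.map_gammaHalf, inv_zpow', inv_zpow',
      neg_smul, ← sub_eq_add_neg, ← smul_sub, neg_sub, add_comm l k, neg_add_rev, neg_neg,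
      ← sub_eq_neg_add]
  · simp

variable (hd : ∀ i, 0 < d i) (hA : ∀ i, A i i = 2) (hoff : ∀ i j, i ≠ j → A i j ≤ 0)
  (hsym : ∀ i j, d i * A i j = d j * A j i)

include H hT hd in
theorem cartanRel_xp_of_tildeRel (i j : Fin N) :
    CartanRel d Φ H.gamma⁻¹ i (qp d A i j) (fun r => Φ (e (xp j r))) :=
  H.cartanRel_xp hd i j (fun r => hT (.K_xp i j r)) (fun s hs r => hT (.h_xp i j s r hs))

include H hT hd hsym in
theorem serre_p_commute (i j : Fin N) (k l : ℤ) (j' : Fin N) (l' : ℤ) :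
    Commute (Φ ((e (xp i (k+1)) * e (xp j l) - qp d A i j • (e (xp j l) * e (xp i (k+1)))) -
        (qp d A i j • (e (xp i k) * e (xp j (l+1))) - e (xp j (l+1)) * e (xp i k))))
      (Φ (e (xm j' l'))) := by
  have hC := cartanRel_xp_of_tildeRel H hT hd
  have hb := qp_ne_zero d A
  have hs := qp_symm hsym
  have h0 : ∀ a c, QC (qp d A a c) (fun r => Φ (e (xp a r))) (fun r =>
      psiPart d Φ H.gamma⁻¹ j' l' c r + phiPart d Φ H.gamma⁻¹ j' l' c r) := fun a c l m => by
    have h1 := qc_psiPart (x := fun j r => Φ (e (xp j r))) hb hs hC j' l' a c l m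
    have h2 := qc_phiPart (x := fun j r => Φ (e (xp j r))) hb hs hC j' l' a c l m
    have h3 := congrArg₂ (· + ·) h1 h2
    beta_reduce at h3
    rw [← smul_add] at h3
    beta_reduce
    convert h3 using 1
    · noncomm_ring
    · congr 1; noncomm_ring
  apply commute_of_snd_bracketHom (F := Fq)
  have h3 := QC.snd_dual (h0 i j) (by rw [hs]; exact h0 j i) k l
  simp only [← bracketHom_xp H hT, smul_add, TrivSqZeroExt.snd_add] at h3
  simp only [map_sub, map_mul, map_smul, TrivSqZeroExt.snd_sub]
  rw [sub_eq_zero, sub_eq_sub_iff_add_eq_add, h3, add_comm]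

include H hT hd hA hoff hsym in
theorem dserre_p_commute
    (hQ : ∀ i j, QC (qp d A i j) (fun r => Φ (e (xp i r))) (fun r => Φ (e (xp j r))))
    {i j : Fin N} (hij : i ≠ j) (ks : Fin (1 - A i j).toNat → ℤ) (l : ℤ) (j' : Fin N) (l' : ℤ) :
    Commute (Φ (permSum (qi d i) (1 - A i j).toNat (fun s => e (xp i (ks s))) (e (xp j l))))
      (Φ (e (xm j' l'))) := by
  apply commute_of_snd_bracketHom (F := Fq)
  rw [map_permSum, map_permSum]
  simp only [bracketHom_xp H hT]
  rw [← permSum_inv (qi_ne_zero d i)]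
  refine snd_permSum_bracket_eq_zero (x := fun j r => Φ (e (xp j r))) hA hoff (qp_ne_zero d A)
    (qp_symm hsym) (cartanRel_xp_of_tildeRel H hT hd) hQ (inv_ne_zero (qi_ne_zero d i)) ?_
    (fun j => ?_) j' l' hij ks l
  · rw [inv_pow, Ne, inv_eq_one]
    exact qi_zpow_ne_one (hd i) two_ne_zero
  · rw [qp_eq, inv_zpow', neg_neg]

end SerrePlus

end DrinfeldSerre

namespace DrinfeldSerre

/-- A symmetrizable generalized Cartan matrix. -/
structure CartanDatum : Prop where
  pos : ∀ i, 0 < d i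
  diag : ∀ i, A i i = 2
  off : ∀ i j, i ≠ j → A i j ≤ 0
  symm : ∀ i j, d i * A i j = d j * A j i

theorem bracket_self {S : Type*} [Ring S] [Algebra Fq S] (Φ : FA N →ₐ[Fq] S) (w : Sˣ) (i : Fin N)
    (k l : ℤ) : psiPart d Φ w i k i l + phiPart d Φ w i k i l = (qi d i - (qi d i)⁻¹)⁻¹ •
      (↑(w ^ (k - l)) * Φ (psiEl d i (k + l)) - ↑(w ^ (l - k)) * Φ (phiEl d i (k + l))) := by
  rw [psiPart, phiPart, if_pos rfl, if_pos rfl, neg_smul, ← sub_eq_add_neg, ← smul_sub,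
    ← sub_eq_neg_add]

/-- The algebra generated by all generators except the `x^+`. -/
def Borel : Type := RingQuot (BorelRel d A)

instance : Ring (Borel d A) := inferInstanceAs (Ring (RingQuot (BorelRel d A)))

instance : Algebra Fq (Borel d A) := inferInstanceAs (Algebra Fq (RingQuot (BorelRel d A)))

/-- The projection onto the algebra without `x^+`. -/
def borelMap : FA N →ₐ[Fq] Borel d A := RingQuot.mkAlgHom Fq (BorelRel d A)

theorem borelMap_xp (i : Fin N) (r : ℤ) : borelMap d A (e (xp i r)) = 0 :=
  (RingQuot.mkAlgHom_rel Fq (BorelRel.xp i r)).trans (map_zero (borelMap d A))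

theorem borelQuot : IsMinusQuot d A (borelMap d A) where
  surjective := RingQuot.mkAlgHom_surjective Fq (BorelRel d A)
  rel _ _ hxy := RingQuot.mkAlgHom_rel Fq (BorelRel.minus hxy)

variable {d A}
variable (hc : CartanDatum d A)

include hc in
theorem theta_borelRel (i : Fin N) {x y : FA N} (hxy : BorelRel d A x y) :
    theta (borelQuot d A) i x = theta (borelQuot d A) i y := by
  cases hxy with
  | minus hxy => exact theta_rel _ i hc.pos hc.diag hc.off hc.symm hxy
  | xp j r =>
    refine LinearMap.ext fun w => Prod.ext ?_ (funext fun k => ?_)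
    · rw [theta_fst, theta_fst, borelMap_xp, map_zero]
    · rw [theta_xp, map_zero]; rfl

/-- The action of the algebra without `x^+` on pairs. -/
def borelTheta (i : Fin N) :
    Borel d A →ₐ[Fq] Module.End Fq (Borel d A × (ℤ → Borel d A)) :=
  RingQuot.liftAlgHom Fq ⟨theta (borelQuot d A) i, fun _ _ hxy => theta_borelRel hc i hxy⟩

theorem borelTheta_borelMap (i : Fin N) (a : FA N) :
    borelTheta hc i (borelMap d A a) = theta (borelQuot d A) i a :=
  RingQuot.liftAlgHom_mkAlgHom_apply _ _ _ _

/-- The operator by which `x^+_{i,k}` acts. -/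
def raise (i : Fin N) (k : ℤ) : Module.End Fq (Borel d A) :=
  LinearMap.proj k ∘ₗ LinearMap.snd Fq _ (ℤ → Borel d A) ∘ₗ
    LinearMap.applyₗ (1, 0) ∘ₗ (borelTheta hc i).toLinearMap

theorem raise_apply (i : Fin N) (k : ℤ) (b : Borel d A) :
    raise hc i k b = (borelTheta hc i b (1, 0)).2 k := rfl

theorem borelTheta_fst (i : Fin N) (b : Borel d A) : (borelTheta hc i b (1, 0)).1 = b := by
  obtain ⟨a, rfl⟩ := (borelQuot d A).surjective b
  rw [borelTheta_borelMap, theta_fst, mul_one]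

theorem raise_one (i : Fin N) (k : ℤ) : raise hc i k 1 = 0 := by
  rw [raise_apply, map_one]; rfl

theorem raise_mul (i : Fin N) (k : ℤ) (a : FA N) (b : Borel d A) :
    raise hc i k (borelMap d A a * b)
      = (theta (borelQuot d A) i a (borelTheta hc i b (1, 0))).2 k := by
  rw [raise_apply, map_mul, Module.End.mul_apply, borelTheta_borelMap]

theorem raise_xm_mul (i : Fin N) (k : ℤ) (j : Fin N) (l : ℤ) (b : Borel d A) :
    raise hc i k (borelMap d A (e (xm j l)) * b) = borelMap d A (e (xm j l)) * raise hc i k b +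
      (psiPart d (borelMap d A) (borelQuot d A).gamma i k j l
        + phiPart d (borelMap d A) (borelQuot d A).gamma i k j l) * b := by
  rw [raise_mul, theta_xm, borelTheta_fst]; rfl

theorem raise_h_mul (i : Fin N) (k : ℤ) (j : Fin N) (s : ℤ) (b : Borel d A) :
    raise hc i k (borelMap d A (e (h j s)) * b) = borelMap d A (e (h j s)) * raise hc i k b -
      ((s : Fq)⁻¹ * qint d j (s * A j i)) •
        (↑((borelQuot d A).gamma ^ (-|s|)) * raise hc i (k + s) b) := by
  rw [raise_mul, theta_h]; rfl

theorem raise_K_mul (i : Fin N) (k : ℤ) (j : Fin N) (b : Borel d A) :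
    raise hc i k (borelMap d A (e (K j)) * b)
      = (qp d A j i)⁻¹ • (borelMap d A (e (K j)) * raise hc i k b) := by
  rw [raise_mul, theta_K]; rfl

theorem raise_Kinv_mul (i : Fin N) (k : ℤ) (j : Fin N) (b : Borel d A) :
    raise hc i k (borelMap d A (e (Kinv j)) * b)
      = qp d A j i • (borelMap d A (e (Kinv j)) * raise hc i k b) := by
  rw [raise_mul, theta_Kinv]; rfl

theorem raise_g2_mul (i : Fin N) (k : ℤ) (b : Borel d A) :
    raise hc i k (borelMap d A (e g2) * b) = borelMap d A (e g2) * raise hc i k b := by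
  rw [raise_mul, theta_g2]; rfl

theorem raise_g2inv_mul (i : Fin N) (k : ℤ) (b : Borel d A) :
    raise hc i k (borelMap d A (e g2inv) * b) = borelMap d A (e g2inv) * raise hc i k b := by
  rw [raise_mul, theta_g2inv]; rfl

theorem raise_D_mul (i : Fin N) (k : ℤ) (b : Borel d A) :
    raise hc i k (borelMap d A (e D) * b)
      = (qq ^ k)⁻¹ • (borelMap d A (e D) * raise hc i k b) := by
  rw [raise_mul, theta_D]; rfl

theorem raise_Dinv_mul (i : Fin N) (k : ℤ) (b : Borel d A) :
    raise hc i k (borelMap d A (e Dinv) * b)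
      = qq ^ k • (borelMap d A (e Dinv) * raise hc i k b) := by
  rw [raise_mul, theta_Dinv]; rfl

/-- The action of the free algebra on the algebra without `x^+`. -/
def rhoFree : FA N →ₐ[Fq] Module.End Fq (Borel d A) :=
  FreeAlgebra.lift Fq fun
    | xp i k => raise hc i k
    | x => LinearMap.mulLeft Fq (borelMap d A (e x))

theorem rhoFree_xp (i : Fin N) (k : ℤ) : rhoFree hc (e (xp i k)) = raise hc i k := by
  simp [rhoFree, e]

/-- The elements acting by left multiplication. -/
def leftSubalgebra : Subalgebra Fq (FA N) :=
  AlgHom.equalizer (rhoFree hc) ((Algebra.lmul Fq (Borel d A)).comp (borelMap d A))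

theorem rhoFree_apply {a : FA N} (ha : a ∈ leftSubalgebra hc) (b : Borel d A) :
    rhoFree hc a b = borelMap d A a * b := by
  have h1 : rhoFree hc a = (Algebra.lmul Fq (Borel d A)).comp (borelMap d A) a := ha
  rw [h1]; rfl

theorem xm_mem (j : Fin N) (l : ℤ) : e (xm j l) ∈ leftSubalgebra hc := by
  rw [leftSubalgebra, AlgHom.mem_equalizer]; simp [rhoFree, e]; rfl

theorem h_mem (j : Fin N) (s : ℤ) : e (h j s) ∈ leftSubalgebra hc := by
  rw [leftSubalgebra, AlgHom.mem_equalizer]; simp [rhoFree, e]; rfl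

theorem K_mem (j : Fin N) : e (K j) ∈ leftSubalgebra hc := by
  rw [leftSubalgebra, AlgHom.mem_equalizer]; simp [rhoFree, e]; rfl

theorem Kinv_mem (j : Fin N) : e (Kinv j) ∈ leftSubalgebra hc := by
  rw [leftSubalgebra, AlgHom.mem_equalizer]; simp [rhoFree, e]; rfl

theorem g2_mem : e g2 ∈ leftSubalgebra hc := by
  rw [leftSubalgebra, AlgHom.mem_equalizer]; simp [rhoFree, e]; rfl

theorem g2inv_mem : e g2inv ∈ leftSubalgebra hc := by
  rw [leftSubalgebra, AlgHom.mem_equalizer]; simp [rhoFree, e]; rfl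

theorem D_mem : e D ∈ leftSubalgebra hc := by
  rw [leftSubalgebra, AlgHom.mem_equalizer]; simp [rhoFree, e]; rfl

theorem Dinv_mem : e Dinv ∈ leftSubalgebra hc := by
  rw [leftSubalgebra, AlgHom.mem_equalizer]; simp [rhoFree, e]; rfl

theorem gammaHalf_mem (m : ℤ) : gammaHalf m ∈ leftSubalgebra hc := by
  rw [gammaHalf]
  split_ifs
  · exact pow_mem (g2_mem hc) _
  · exact pow_mem (g2inv_mem hc) _

theorem Ppos_mem (i : Fin N) (n : ℕ) : Ppos d i n ∈ leftSubalgebra hc := by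
  induction n using Nat.strong_induction_on with
  | _ n ih =>
    cases n with
    | zero => rw [Ppos]; exact one_mem _
    | succ n =>
      rw [Ppos]
      exact Subalgebra.smul_mem _ (sum_mem fun l _ => Subalgebra.smul_mem _
        (mul_mem (h_mem hc _ _) (ih _ (by omega))) _) _

theorem Pneg_mem (i : Fin N) (n : ℕ) : Pneg d i n ∈ leftSubalgebra hc := by
  induction n using Nat.strong_induction_on with
  | _ n ih =>
    cases n with
    | zero => rw [Pneg]; exact one_mem _
    | succ n =>
      rw [Pneg]
      exact Subalgebra.smul_mem _ (sum_mem fun l _ => Subalgebra.smul_mem _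
        (mul_mem (h_mem hc _ _) (ih _ (by omega))) _) _

theorem psiEl_mem (i : Fin N) (m : ℤ) : psiEl d i m ∈ leftSubalgebra hc := by
  rw [psiEl]
  split_ifs
  · exact mul_mem (K_mem hc i) (Ppos_mem hc i _)
  · exact zero_mem _

theorem phiEl_mem (i : Fin N) (m : ℤ) : phiEl d i m ∈ leftSubalgebra hc := by
  rw [phiEl]
  split_ifs
  · exact mul_mem (Kinv_mem hc i) (Pneg_mem hc i _)
  · exact zero_mem _

theorem rhoFree_minusRel {x y : FA N} (hxy : MinusRel d A x y) :
    rhoFree hc x = rhoFree hc y := by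
  have h0 : x ∈ leftSubalgebra hc → y ∈ leftSubalgebra hc → rhoFree hc x = rhoFree hc y :=
    fun hx hy => LinearMap.ext fun b => by
      rw [rhoFree_apply hc hx, rhoFree_apply hc hy, (borelQuot d A).rel hxy]
  have hxm := xm_mem hc
  have hh := h_mem hc
  have hK := K_mem hc
  have hKi := Kinv_mem hc
  have hg := g2_mem hc
  have hgi := g2inv_mem hc
  have hD := D_mem hc
  have hDi := Dinv_mem hc
  have hgH := gammaHalf_mem hc
  have hsm : ∀ (r : Fq) {x : FA N}, x ∈ leftSubalgebra hc → r • x ∈ leftSubalgebra hc :=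
    fun r _ hx => Subalgebra.smul_mem _ hx r
  cases hxy with
  | g2_comm x =>
    cases x with
    | xp i k =>
      refine LinearMap.ext fun b => ?_
      rw [map_mul, map_mul, Module.End.mul_apply, Module.End.mul_apply, rhoFree_apply hc hg,
        rhoFree_apply hc hg, rhoFree_xp, raise_g2_mul]
    | _ => apply h0 <;> apply mul_mem <;> simp only [hxm, hh, hK, hKi, hg, hgi, hD, hDi]
  | g2inv_comm x =>
    cases x with
    | xp i k =>
      refine LinearMap.ext fun b => ?_
      rw [map_mul, map_mul, Module.End.mul_apply, Module.End.mul_apply, rhoFree_apply hc hgi,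
        rhoFree_apply hc hgi, rhoFree_xp, raise_g2inv_mul]
    | _ => apply h0 <;> apply mul_mem <;> simp only [hxm, hh, hK, hKi, hg, hgi, hD, hDi]
  | h_h a b s l hs hl =>
    apply h0
    · exact sub_mem (mul_mem (hh _ _) (hh _ _)) (mul_mem (hh _ _) (hh _ _))
    · split_ifs
      · exact hsm _ (sub_mem (hgH _) (hgH _))
      · exact zero_mem _
  | dserre i j hij ks l =>
    rw [sum_dsTerm_eq (hc.pos i)] at h0 ⊢
    simp only [Bool.false_eq_true, if_false] at h0 ⊢
    exact h0 (permSum_mem _ _ (fun s => hxm _ _) (hxm _ _)) (zero_mem _)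
  | _ =>
    apply h0 <;> repeat first
      | apply hxm | apply hh | apply hK | apply hKi | apply hg | apply hgi | apply hD | apply hDi
      | apply hgH | apply one_mem | apply zero_mem | apply sub_mem | apply hsm | apply mul_mem

theorem rhoFree_tildeRel {x y : FA N} (hxy : TildeRel d A x y) :
    rhoFree hc x = rhoFree hc y := by
  have H := borelQuot d A
  cases hxy with
  | minus hxy => exact rhoFree_minusRel hc hxy
  | D_xp i r =>
    refine LinearMap.ext fun b => ?_
    rw [map_mul, map_mul, Module.End.mul_apply, Module.End.mul_apply, map_smul,
      LinearMap.smul_apply, rhoFree_apply hc (D_mem hc), rhoFree_apply hc (Dinv_mem hc), rhoFree_xp,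
      raise_Dinv_mul, mul_smul_comm, ← mul_assoc, H.D_mul_Dinv, one_mul]
  | K_xp i j r =>
    refine LinearMap.ext fun b => ?_
    rw [map_mul, map_mul, Module.End.mul_apply, Module.End.mul_apply, map_smul,
      LinearMap.smul_apply, rhoFree_apply hc (K_mem hc i), rhoFree_apply hc (Kinv_mem hc i),
      rhoFree_xp, raise_Kinv_mul, mul_smul_comm, ← mul_assoc, H.K_mul_Kinv, one_mul]
  | h_xp i j k l hk =>
    refine LinearMap.ext fun b => ?_
    rw [map_sub, map_mul, map_mul, LinearMap.sub_apply, Module.End.mul_apply, Module.End.mul_apply,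
      map_smul, LinearMap.smul_apply, map_mul, Module.End.mul_apply, rhoFree_apply hc (h_mem hc i k),
      rhoFree_apply hc (h_mem hc i k), rhoFree_apply hc (gammaHalf_mem hc _), rhoFree_xp, rhoFree_xp,
      raise_h_mul, sub_sub_cancel, (borelQuot d A).map_gammaHalf, add_comm l k]
  | xp_xm i j k l =>
    refine LinearMap.ext fun b => ?_
    rw [map_sub, map_mul, map_mul, LinearMap.sub_apply, Module.End.mul_apply, Module.End.mul_apply,
      rhoFree_apply hc (xm_mem hc j l), rhoFree_apply hc (xm_mem hc j l), rhoFree_xp, raise_xm_mul,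
      add_sub_cancel_left]
    by_cases hij : i = j
    · subst hij
      rw [if_pos rfl, map_smul, LinearMap.smul_apply, map_sub, LinearMap.sub_apply,
        rhoFree_apply hc (mul_mem (gammaHalf_mem hc _) (psiEl_mem hc i _)),
        rhoFree_apply hc (mul_mem (gammaHalf_mem hc _) (phiEl_mem hc i _)), bracket_self, map_mul,
        map_mul, (borelQuot d A).map_gammaHalf, (borelQuot d A).map_gammaHalf, ← sub_mul,
        smul_mul_assoc]
    · rw [if_neg hij, psiPart, phiPart, if_neg (Ne.symm hij), if_neg (Ne.symm hij), add_zero,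
        zero_mul, map_zero, LinearMap.zero_apply]

end DrinfeldSerre

namespace DrinfeldSerre

section Triangular

variable {S : Type*} [Ring S] [Algebra Fq S]

/-- The image of the subalgebra generated by the Cartan generators. -/
def cartanPart (Φ : FA N →ₐ[Fq] S) : Subalgebra Fq S :=
  Algebra.adjoin Fq {b | ∃ x : Gen N, (∀ i r, x ≠ xp i r) ∧ (∀ i r, x ≠ xm i r) ∧ Φ (e x) = b}

/-- The image of the subalgebra generated by the `x^-` and `γ^{±1/2}`. -/
def minusPart (Φ : FA N →ₐ[Fq] S) : Subalgebra Fq S :=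
  Algebra.adjoin Fq {b | Φ (e g2) = b ∨ Φ (e g2inv) = b ∨ ∃ j l, Φ (e (xm j l)) = b}

variable {d A} {Φ : FA N →ₐ[Fq] S}

theorem xm_mem_minusPart (j : Fin N) (l : ℤ) : Φ (e (xm j l)) ∈ minusPart Φ :=
  Algebra.subset_adjoin (.inr (.inr ⟨j, l, rfl⟩))

theorem g2_mem_minusPart : Φ (e g2) ∈ minusPart Φ := Algebra.subset_adjoin (.inl rfl)

theorem g2inv_mem_minusPart : Φ (e g2inv) ∈ minusPart Φ := Algebra.subset_adjoin (.inr (.inl rfl))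

theorem mem_cartanPart {x : Gen N} (h1 : ∀ i r, x ≠ xp i r) (h2 : ∀ i r, x ≠ xm i r) :
    Φ (e x) ∈ cartanPart Φ := Algebra.subset_adjoin ⟨x, h1, h2, rfl⟩

variable (H : IsMinusQuot d A Φ)

theorem gamma_zpow_mem_minusPart (m : ℤ) : ↑(H.gamma ^ m) ∈ minusPart Φ := by
  rw [← H.map_gammaHalf, gammaHalf]
  split_ifs <;> rw [map_pow]
  · exact pow_mem g2_mem_minusPart _
  · exact pow_mem g2inv_mem_minusPart _

include H

theorem commute_g2inv (s : S) : Commute s (Φ (e g2inv)) := (H.central s).units_inv_right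

theorem conj_mem_minusPart {u v : S} (huv : u * v = 1) (hvu : v * u = 1)
    (hx : ∀ j l, u * Φ (e (xm j l)) * v ∈ minusPart Φ) {n : S} (hn : n ∈ minusPart Φ) :
    u * n * v ∈ minusPart Φ := by
  induction hn using Algebra.adjoin_induction with
  | mem x hm =>
    rcases hm with rfl | rfl | ⟨j, l, rfl⟩
    · have h1 : u * Φ (e g2) = Φ (e g2) * u := H.central u
      rw [h1, mul_assoc, huv, mul_one]
      exact g2_mem_minusPart
    · have h1 : u * Φ (e g2inv) = Φ (e g2inv) * u := commute_g2inv H u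
      rw [h1, mul_assoc, huv, mul_one]
      exact g2inv_mem_minusPart
    · exact hx j l
  | algebraMap r =>
    rw [← Algebra.commutes, mul_assoc, huv, mul_one]
    exact Subalgebra.algebraMap_mem _ r
  | add a b _ _ ha hb => rw [mul_add, add_mul]; exact add_mem ha hb
  | mul a b _ _ ha hb =>
    have h1 : u * a * v * (u * b * v) = u * a * (v * u) * b * v := by simp only [mul_assoc]
    rw [hvu, mul_one, mul_assoc u a b] at h1
    rw [← h1]
    exact mul_mem ha hb

theorem h_bracket_mem_minusPart (i : Fin N) {s : ℤ} (hs : s ≠ 0) {n : S}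
    (hn : n ∈ minusPart Φ) : Φ (e (h i s)) * n - n * Φ (e (h i s)) ∈ minusPart Φ := by
  induction hn using Algebra.adjoin_induction with
  | mem x hm =>
    rcases hm with rfl | rfl | ⟨j, l, rfl⟩
    · have h1 : Φ (e (h i s)) * Φ (e g2) = Φ (e g2) * Φ (e (h i s)) := H.central _
      rw [h1, sub_self]
      exact zero_mem _
    · have h1 : Φ (e (h i s)) * Φ (e g2inv) = Φ (e g2inv) * Φ (e (h i s)) := commute_g2inv H _
      rw [h1, sub_self]
      exact zero_mem _
    · rw [H.h_xm i j hs]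
      exact Subalgebra.smul_mem _
        (mul_mem (gamma_zpow_mem_minusPart H _) (xm_mem_minusPart _ _)) _
  | algebraMap r =>
    rw [← Algebra.commutes, sub_self]
    exact zero_mem _
  | add a b _ _ ha hb => rw [mul_add, add_mul, add_sub_add_comm]; exact add_mem ha hb
  | mul a b ha' hb' ha hb =>
    have h1 : Φ (e (h i s)) * (a * b) - a * b * Φ (e (h i s))
        = (Φ (e (h i s)) * a - a * Φ (e (h i s))) * b
          + a * (Φ (e (h i s)) * b - b * Φ (e (h i s))) := by noncomm_ring
    rw [h1]
    exact add_mem (mul_mem ha hb') (mul_mem ha' hb)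

theorem span_minusPart_mul_cartanPart (hxp : ∀ i r, Φ (e (xp i r)) = 0) (b : S) :
    b ∈ Submodule.span Fq {y | ∃ n ∈ minusPart Φ, ∃ c ∈ cartanPart Φ, n * c = y} := by
  obtain ⟨a, rfl⟩ := H.surjective b
  set P := Submodule.span Fq {y | ∃ n ∈ minusPart Φ, ∃ c ∈ cartanPart Φ, n * c = y} with hP
  have hmul : ∀ x : Gen N, (∀ n ∈ minusPart Φ, ∀ c ∈ cartanPart Φ, Φ (e x) * (n * c) ∈ P) →
      ∀ b ∈ P, Φ (e x) * b ∈ P := fun x hx b hb => by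
    induction hb using Submodule.span_induction with
    | mem y hy => obtain ⟨n, hn, c, hc, rfl⟩ := hy; exact hx n hn c hc
    | zero => rw [mul_zero]; exact zero_mem _
    | add y z _ _ hy hz => rw [mul_add]; exact add_mem hy hz
    | smul r y _ hy => rw [mul_smul_comm]; exact P.smul_mem r hy
  have hmem : ∀ {n c : S}, n ∈ minusPart Φ → c ∈ cartanPart Φ → n * c ∈ P :=
    fun hn hc => Submodule.subset_span ⟨_, hn, _, hc, rfl⟩
  have hunit : ∀ {u v n c : S}, u * v = 1 → v * u = 1 → u ∈ cartanPart Φ →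
      (∀ j l, u * Φ (e (xm j l)) * v ∈ minusPart Φ) → n ∈ minusPart Φ → c ∈ cartanPart Φ →
      u * (n * c) ∈ P := fun {u v n c} huv hvu hu hx hn hc => by
    have h1 : u * (n * c) = u * n * v * (u * c) := by
      rw [mul_assoc (u * n), ← mul_assoc v, hvu, one_mul, mul_assoc]
    rw [h1]
    exact hmem (conj_mem_minusPart H huv hvu hx hn) (mul_mem hu hc)
  have key : ∀ a : FA N, ∀ b ∈ P, Φ a * b ∈ P := fun a => by
    induction a using FreeAlgebra.induction with
    | grade0 r =>
      intro b hb
      rw [AlgHom.commutes, ← Algebra.smul_def]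
      exact P.smul_mem r hb
    | mul a b ha hb => intro c hc; rw [map_mul, mul_assoc]; exact ha _ (hb c hc)
    | add a b ha hb => intro c hc; rw [map_add, add_mul]; exact add_mem (ha c hc) (hb c hc)
    | grade1 x =>
      refine hmul x fun n hn c hc => ?_
      cases x with
      | xp i r => rw [hxp, zero_mul]; exact zero_mem _
      | xm i r => rw [← mul_assoc]; exact hmem (mul_mem (xm_mem_minusPart _ _) hn) hc
      | g2 => rw [← mul_assoc]; exact hmem (mul_mem g2_mem_minusPart hn) hc
      | g2inv => rw [← mul_assoc]; exact hmem (mul_mem g2inv_mem_minusPart hn) hc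
      | h i s =>
        by_cases hs : s = 0
        · rw [hs, H.rel (.h_zero i), map_zero, zero_mul]; exact zero_mem _
        have h1 : Φ (e (h i s)) * (n * c)
            = (Φ (e (h i s)) * n - n * Φ (e (h i s))) * c + n * (Φ (e (h i s)) * c) := by
          noncomm_ring
        rw [h1]
        exact add_mem (hmem (h_bracket_mem_minusPart H i hs hn) hc)
          (hmem hn (mul_mem (mem_cartanPart (by simp) (by simp)) hc))
      | K i =>
        refine hunit (H.K_mul_Kinv i) (H.Kinv_mul_K i) (mem_cartanPart (by simp) (by simp))
          (fun j l => ?_) hn hc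
        rw [H.K_mul_xm, smul_mul_assoc, mul_assoc, H.K_mul_Kinv, mul_one]
        exact Subalgebra.smul_mem _ (xm_mem_minusPart _ _) _
      | Kinv i =>
        refine hunit (H.Kinv_mul_K i) (H.K_mul_Kinv i) (mem_cartanPart (by simp) (by simp))
          (fun j l => ?_) hn hc
        rw [H.Kinv_mul_xm, smul_mul_assoc, mul_assoc, H.Kinv_mul_K, mul_one]
        exact Subalgebra.smul_mem _ (xm_mem_minusPart _ _) _
      | D =>
        refine hunit H.D_mul_Dinv H.Dinv_mul_D (mem_cartanPart (by simp) (by simp))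
          (fun j l => ?_) hn hc
        rw [H.D_mul_xm, smul_mul_assoc, mul_assoc, H.D_mul_Dinv, mul_one]
        exact Subalgebra.smul_mem _ (xm_mem_minusPart _ _) _
      | Dinv =>
        refine hunit H.Dinv_mul_D H.D_mul_Dinv (mem_cartanPart (by simp) (by simp))
          (fun j l => ?_) hn hc
        rw [H.Dinv_mul_xm, smul_mul_assoc, mul_assoc, H.Dinv_mul_D, mul_one]
        exact Subalgebra.smul_mem _ (xm_mem_minusPart _ _) _
  have h1 : (1 : S) ∈ P := by
    rw [← mul_one (1 : S)]
    exact hmem (one_mem _) (one_mem _)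
  simpa using key a 1 h1

theorem end_eq_zero_of_commute (hxp : ∀ i r, Φ (e (xp i r)) = 0) {t : Module.End Fq S}
    (hx : ∀ j l b, t (Φ (e (xm j l)) * b) = Φ (e (xm j l)) * t b)
    (hg : ∀ b, t (Φ (e g2) * b) = Φ (e g2) * t b)
    (hgi : ∀ b, t (Φ (e g2inv) * b) = Φ (e g2inv) * t b)
    (h0 : ∀ c ∈ cartanPart Φ, t c = 0) : t = 0 := by
  have hn : ∀ n ∈ minusPart Φ, ∀ b, t (n * b) = n * t b := fun n hn => by
    induction hn using Algebra.adjoin_induction with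
    | mem x hm =>
      rcases hm with rfl | rfl | ⟨j, l, rfl⟩
      exacts [hg, hgi, hx j l]
    | algebraMap r => intro b; rw [← Algebra.smul_def, map_smul, Algebra.smul_def]
    | add a b _ _ ha hb => intro c; rw [add_mul, map_add, ha, hb, add_mul]
    | mul a b _ _ ha hb => intro c; rw [mul_assoc, ha, hb, mul_assoc]
  refine LinearMap.ext fun b => ?_
  induction span_minusPart_mul_cartanPart H hxp b using Submodule.span_induction with
  | mem y hy =>
    obtain ⟨n, hn', c, hc, rfl⟩ := hy
    rw [hn n hn', h0 c hc, mul_zero, LinearMap.zero_apply]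
  | zero => rw [map_zero, map_zero]
  | add y z _ _ hy hz => rw [map_add, hy, hz, map_add]
  | smul r y _ hy => rw [map_smul, hy, map_smul]

end Triangular

end DrinfeldSerre

namespace DrinfeldSerre

variable {d A}
variable (hc : CartanDatum d A)

theorem raise_cartanPart {c : Borel d A} (h0 : c ∈ cartanPart (borelMap d A)) (i : Fin N) (k : ℤ) :
    raise hc i k c = 0 := by
  suffices h1 : ∀ y, (∀ k, raise hc i k y = 0) → ∀ k, raise hc i k (c * y) = 0 by
    simpa using h1 1 (raise_one hc i) k
  induction h0 using Algebra.adjoin_induction with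
  | mem x hx =>
    obtain ⟨x, h1, h2, rfl⟩ := hx
    intro y hy k
    cases x with
    | xp j r => exact absurd rfl (h1 j r)
    | xm j r => exact absurd rfl (h2 j r)
    | h j s => rw [raise_h_mul, hy, hy, mul_zero, mul_zero, smul_zero, sub_zero]
    | K j => rw [raise_K_mul, hy, mul_zero, smul_zero]
    | Kinv j => rw [raise_Kinv_mul, hy, mul_zero, smul_zero]
    | g2 => rw [raise_g2_mul, hy, mul_zero]
    | g2inv => rw [raise_g2inv_mul, hy, mul_zero]
    | D => rw [raise_D_mul, hy, mul_zero, smul_zero]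
    | Dinv => rw [raise_Dinv_mul, hy, mul_zero, smul_zero]
  | algebraMap r =>
    intro y hy k
    rw [← Algebra.smul_def, map_smul, hy, smul_zero]
  | add a b _ _ ha hb => intro y hy k; rw [add_mul, map_add, ha y hy, hb y hy, add_zero]
  | mul a b _ _ ha hb => intro y hy k; rw [mul_assoc]; exact ha _ (hb y hy) k

theorem list_prod_apply_eq {M : Type*} [AddCommGroup M] [Module Fq M] {m : M}
    (l : List (Module.End Fq M)) (hl : ∀ t ∈ l, t m = 0) : l.prod m = 0 ∨ l.prod m = m := by
  induction l with
  | nil => right; rfl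
  | cons t l ih =>
    left
    rw [List.prod_cons, Module.End.mul_apply]
    rcases ih fun t ht => hl t (List.mem_cons_of_mem _ ht) with h1 | h1
    · rw [h1, map_zero]
    · rw [h1, hl t List.mem_cons_self]

theorem permSum_apply_eq_zero {M : Type*} [AddCommGroup M] [Module Fq M] {m : M} (q : Fq) {n : ℕ}
    {x : Fin n → Module.End Fq M} {v : Module.End Fq M} (hx : ∀ s, x s m = 0) (hv : v m = 0) :
    permSum q n x v m = 0 := by
  simp only [permSum, LinearMap.sum_apply, LinearMap.smul_apply, Module.End.mul_apply]
  refine Finset.sum_eq_zero fun σ _ => Finset.sum_eq_zero fun r _ => ?_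
  rcases list_prod_apply_eq (m := m) (((List.finRange n).drop r).map fun t => x (σ t)) (by
    intro t ht
    obtain ⟨s, _, rfl⟩ := List.mem_map.mp ht
    exact hx _) with h1 | h1
  · rw [h1, map_zero, map_zero, smul_zero]
  · rw [h1, hv, map_zero, smul_zero]

/-- The image of the free algebra in the endomorphisms. -/
def RhoRange : Type := (rhoFree hc).range

instance : Ring (RhoRange hc) := inferInstanceAs (Ring (rhoFree hc).range)

instance : Algebra Fq (RhoRange hc) := inferInstanceAs (Algebra Fq (rhoFree hc).range)

/-- The action of the free algebra, with values in its range. -/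
def rhoRange : FA N →ₐ[Fq] RhoRange hc := (rhoFree hc).rangeRestrict

theorem rhoRange_tildeRel ⦃x y : FA N⦄ (hxy : TildeRel d A x y) : rhoRange hc x = rhoRange hc y :=
  Subtype.ext (rhoFree_tildeRel hc hxy)

theorem rhoQuot : IsMinusQuot d A (rhoRange hc) where
  surjective := (rhoFree hc).rangeRestrict_surjective
  rel _ _ hxy := rhoRange_tildeRel hc (.minus hxy)

theorem rhoFree_eq_zero {a : FA N}
    (h1 : ∀ j l, Commute (rhoRange hc a) (rhoRange hc (e (xm j l))))
    (h2 : ∀ c ∈ cartanPart (borelMap d A), rhoFree hc a c = 0) : rhoFree hc a = 0 := by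
  have hcomm : ∀ x ∈ leftSubalgebra hc, Commute (rhoRange hc a) (rhoRange hc x) → ∀ b,
      rhoFree hc a (borelMap d A x * b) = borelMap d A x * rhoFree hc a b := fun x hx hxa b => by
    have h3 := congrArg (fun t => t.val b) hxa.eq
    rw [← rhoFree_apply hc hx, ← rhoFree_apply hc hx]
    exact h3
  exact end_eq_zero_of_commute (borelQuot d A) (borelMap_xp d A)
    (fun j l => hcomm _ (xm_mem hc j l) (h1 j l))
    (hcomm _ (g2_mem hc) ((rhoQuot hc).central _))
    (hcomm _ (g2inv_mem hc) (commute_g2inv (rhoQuot hc) _)) h2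

theorem rhoFree_serre_p (i j : Fin N) (k l : ℤ) :
    rhoFree hc (e (xp i (k+1)) * e (xp j l) - qp d A i j • (e (xp j l) * e (xp i (k+1))))
      = rhoFree hc (qp d A i j • (e (xp i k) * e (xp j (l+1))) - e (xp j (l+1)) * e (xp i k)) := by
  rw [← sub_eq_zero, ← map_sub]
  refine rhoFree_eq_zero hc
    (serre_p_commute (rhoQuot hc) (rhoRange_tildeRel hc) hc.pos hc.symm i j k l) fun c h0 => ?_
  have h1 : ∀ a j k, rhoFree hc (a * e (xp j k)) c = 0 := fun a j k => by
    rw [map_mul, Module.End.mul_apply, rhoFree_xp, raise_cartanPart hc h0, map_zero]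
  simp only [map_sub, map_smul, LinearMap.sub_apply, LinearMap.smul_apply, h1, smul_zero, sub_zero]

theorem rhoRange_qc_xp (i j : Fin N) : QC (qp d A i j) (fun r => rhoRange hc (e (xp i r)))
    (fun r => rhoRange hc (e (xp j r))) := fun k l => by
  have h1 : rhoRange hc _ = rhoRange hc _ := Subtype.ext (rhoFree_serre_p hc i j k l)
  simp only [map_sub, map_mul, map_smul] at h1
  rw [sub_eq_sub_iff_add_eq_add, add_comm (_ • _) (_ • _), ← smul_add] at h1
  exact h1

theorem rhoFree_dserre_p {i j : Fin N} (hij : i ≠ j) (ks : Fin (1 - A i j).toNat → ℤ) (l : ℤ) :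
    rhoFree hc (permSum (qi d i) (1 - A i j).toNat (fun s => e (xp i (ks s))) (e (xp j l))) = 0 := by
  refine rhoFree_eq_zero hc (dserre_p_commute (rhoQuot hc) (rhoRange_tildeRel hc) hc.pos hc.diag
    hc.off hc.symm (rhoRange_qc_xp hc) hij ks l) fun c h0 => ?_
  rw [map_permSum]
  refine permSum_apply_eq_zero _ (fun s => ?_) ?_ <;>
    rw [rhoFree_xp, raise_cartanPart hc h0]

theorem rhoFree_qRel ⦃x y : FA N⦄ (hxy : QRel N d A x y) : rhoFree hc x = rhoFree hc y := by
  cases hxy with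
  | serre_p i j k l => exact rhoFree_serre_p hc i j k l
  | dserre pm i j hij ks l =>
    cases pm with
    | false => exact rhoFree_minusRel hc (.dserre i j hij ks l)
    | true =>
      rw [sum_dsTerm_eq (hc.pos i), map_zero]
      simpa using rhoFree_dserre_p hc hij ks l
  | D_xp i r => exact rhoFree_tildeRel hc (.D_xp i r)
  | K_xp i j r => exact rhoFree_tildeRel hc (.K_xp i j r)
  | h_xp i j k l hk => exact rhoFree_tildeRel hc (.h_xp i j k l hk)
  | xp_xm i j k l => exact rhoFree_tildeRel hc (.xp_xm i j k l)
  | _ => apply rhoFree_minusRel; constructor <;> assumption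

/-- The action of the quantum affine algebra on the algebra without `x^+`. -/
def rho : Uq N d A →ₐ[Fq] Module.End Fq (Borel d A) :=
  RingQuot.liftAlgHom Fq ⟨rhoFree hc, rhoFree_qRel hc⟩

theorem rho_mk (a : FA N) : rho hc (RingQuot.mkAlgHom Fq (QRel N d A) a) = rhoFree hc a :=
  RingQuot.liftAlgHom_mkAlgHom_apply _ _ _ _

theorem rho_mk_one {a : FA N} (ha : a ∈ leftSubalgebra hc) :
    rho hc (RingQuot.mkAlgHom Fq (QRel N d A) a) 1 = borelMap d A a := by
  rw [rho_mk, rhoFree_apply hc ha, mul_one]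

end DrinfeldSerre

namespace DrinfeldSerre

section Weight

variable {S : Type*} [Ring S] [Algebra Fq S]

/-- The variant of `Φ` which kills the `x^+` and rescales the `K_i` by `2`. -/
def rescale (Φ : FA N →ₐ[Fq] S) : FA N →ₐ[Fq] S :=
  FreeAlgebra.lift Fq fun
    | xp _ _ => 0
    | K i => (2 : Fq) • Φ (e (K i))
    | Kinv i => (2 : Fq)⁻¹ • Φ (e (Kinv i))
    | x => Φ (e x)

variable {d A} (Φ : FA N →ₐ[Fq] S)

theorem rescale_xp (i : Fin N) (k : ℤ) : rescale Φ (e (xp i k)) = 0 := by simp [rescale, e]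

theorem rescale_xm (i : Fin N) (k : ℤ) : rescale Φ (e (xm i k)) = Φ (e (xm i k)) := by
  simp [rescale, e]

theorem rescale_h (i : Fin N) (k : ℤ) : rescale Φ (e (h i k)) = Φ (e (h i k)) := by
  simp [rescale, e]

theorem rescale_K (i : Fin N) : rescale Φ (e (K i)) = (2 : Fq) • Φ (e (K i)) := by
  simp [rescale, e]

theorem rescale_Kinv (i : Fin N) : rescale Φ (e (Kinv i)) = (2 : Fq)⁻¹ • Φ (e (Kinv i)) := by
  simp [rescale, e]

theorem rescale_g2 : rescale Φ (e g2) = Φ (e g2) := by simp [rescale, e]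

theorem rescale_g2inv : rescale Φ (e g2inv) = Φ (e g2inv) := by simp [rescale, e]

theorem rescale_D : rescale Φ (e D) = Φ (e D) := by simp [rescale, e]

theorem rescale_Dinv : rescale Φ (e Dinv) = Φ (e Dinv) := by simp [rescale, e]

theorem rescale_gammaHalf (m : ℤ) : rescale Φ (gammaHalf m) = Φ (gammaHalf m) := by
  rw [gammaHalf]
  split_ifs
  · rw [map_pow, map_pow, rescale_g2]
  · rw [map_pow, map_pow, rescale_g2inv]

theorem rescale_Ppos (i : Fin N) (n : ℕ) : rescale Φ (Ppos d i n) = Φ (Ppos d i n) := by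
  induction n using Nat.strong_induction_on with
  | _ n ih =>
    cases n with
    | zero => rw [Ppos, map_one, map_one]
    | succ n =>
      simp only [Ppos, map_smul, map_sum, map_mul, rescale_h]
      exact congrArg _ (Finset.sum_congr rfl fun l _ => by rw [ih _ (by omega)])

theorem rescale_Pneg (i : Fin N) (n : ℕ) : rescale Φ (Pneg d i n) = Φ (Pneg d i n) := by
  induction n using Nat.strong_induction_on with
  | _ n ih =>
    cases n with
    | zero => rw [Pneg, map_one, map_one]
    | succ n =>
      simp only [Pneg, map_smul, map_sum, map_mul, rescale_h]
      exact congrArg _ (Finset.sum_congr rfl fun l _ => by rw [ih _ (by omega)])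

theorem rescale_psiEl (i : Fin N) (m : ℤ) :
    rescale Φ (psiEl d i m) = (2 : Fq) • Φ (psiEl d i m) := by
  rw [psiEl]
  split_ifs
  · rw [map_mul, map_mul, rescale_K, rescale_Ppos, smul_mul_assoc]
  · rw [map_zero, map_zero, smul_zero]

theorem rescale_phiEl (i : Fin N) (m : ℤ) :
    rescale Φ (phiEl d i m) = (2 : Fq)⁻¹ • Φ (phiEl d i m) := by
  rw [phiEl]
  split_ifs
  · rw [map_mul, map_mul, rescale_Kinv, rescale_Pneg, smul_mul_assoc]
  · rw [map_zero, map_zero, smul_zero]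

variable {Φ}

theorem rescale_minusRel (hd : ∀ i, 0 < d i) (H : IsMinusQuot d A Φ) {x y : FA N}
    (hxy : MinusRel d A x y) : rescale Φ x = rescale Φ y := by
  have h2 : (2 : Fq) ≠ 0 := two_ne_zero
  have h0 := H.rel hxy
  cases hxy with
  | K_Kinv i =>
    rw [map_mul, rescale_K, rescale_Kinv, smul_mul_smul_comm, mul_inv_cancel₀ h2, one_smul,
      H.K_mul_Kinv, map_one]
  | Kinv_K i =>
    rw [map_mul, rescale_K, rescale_Kinv, smul_mul_smul_comm, inv_mul_cancel₀ h2, one_smul,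
      H.Kinv_mul_K, map_one]
  | K_xm i j r =>
    rw [map_mul, map_mul] at h0
    rw [map_mul, map_mul, rescale_K, rescale_Kinv, rescale_xm, smul_mul_assoc, smul_mul_smul_comm,
      mul_inv_cancel₀ h2, one_smul, h0, map_smul, map_smul, rescale_xm]
  | K_comm_K i j =>
    rw [map_mul, map_mul] at h0
    rw [map_mul, map_mul, rescale_K, rescale_K, smul_mul_smul_comm, smul_mul_smul_comm, h0]
  | K_comm_D i =>
    rw [map_mul, map_mul] at h0
    rw [map_mul, map_mul, rescale_K, rescale_D, smul_mul_assoc, mul_smul_comm, h0]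
  | K_comm_h i j s =>
    rw [map_mul, map_mul] at h0
    rw [map_mul, map_mul, rescale_K, rescale_h, smul_mul_assoc, mul_smul_comm, h0]
  | g2_comm x =>
    rw [map_mul, map_mul] at h0
    rw [map_mul, map_mul, rescale_g2]
    cases x with
    | xp i k => rw [rescale_xp, zero_mul, mul_zero]
    | K i => rw [rescale_K, mul_smul_comm, h0, smul_mul_assoc]
    | Kinv i => rw [rescale_Kinv, mul_smul_comm, h0, smul_mul_assoc]
    | g2 => rw [rescale_g2]
    | _ => simpa only [rescale_xm, rescale_h, rescale_g2, rescale_g2inv, rescale_D, rescale_Dinv]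
  | g2inv_comm x =>
    rw [map_mul, map_mul] at h0
    rw [map_mul, map_mul, rescale_g2inv]
    cases x with
    | xp i k => rw [rescale_xp, zero_mul, mul_zero]
    | K i => rw [rescale_K, mul_smul_comm, h0, smul_mul_assoc]
    | Kinv i => rw [rescale_Kinv, mul_smul_comm, h0, smul_mul_assoc]
    | g2inv => rw [rescale_g2inv]
    | _ => simpa only [rescale_xm, rescale_h, rescale_g2, rescale_g2inv, rescale_D, rescale_Dinv]
  | h_h i j k l hk hl =>
    split_ifs at h0 ⊢ <;>
    simpa only [map_sub, map_mul, map_smul, map_zero, rescale_h, gammaPow, rescale_gammaHalf]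
      using h0
  | dserre i j hij ks l =>
    rw [sum_dsTerm_eq (hd i)] at h0 ⊢
    simpa only [Bool.false_eq_true, if_false, map_permSum, map_zero, rescale_xm] using h0
  | _ =>
    simpa only [map_sub, map_mul, map_smul, map_zero, map_one, rescale_xm, rescale_h, rescale_g2,
      rescale_g2inv, rescale_D, rescale_Dinv, rescale_gammaHalf] using h0

/-- The map from the algebra without `x^+` induced by `rescale`. -/
def borelRescale (hd : ∀ i, 0 < d i) (H : IsMinusQuot d A Φ) : Borel d A →ₐ[Fq] S :=
  RingQuot.liftAlgHom Fq ⟨rescale Φ, fun _ _ hxy => by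
    cases hxy with
    | minus hxy => exact rescale_minusRel hd H hxy
    | xp i r => rw [rescale_xp, map_zero]⟩

theorem borelRescale_borelMap (hd : ∀ i, 0 < d i) (H : IsMinusQuot d A Φ) (a : FA N) :
    borelRescale hd H (borelMap d A a) = rescale Φ a :=
  RingQuot.liftAlgHom_mkAlgHom_apply _ _ _ _

variable (hc : CartanDatum d A)

variable (Φ) in
/-- The image of the elements without `x^+` which are multiplied by `c` by rescaling. -/
def weightSpace (c : Fq) : Submodule Fq S :=
  ((Subalgebra.toSubmodule (leftSubalgebra hc)) ⊓
    LinearMap.eqLocus (rescale Φ).toLinearMap (c • Φ.toLinearMap)).map Φ.toLinearMap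

theorem mem_weightSpace {c : Fq} {a : FA N} (h1 : a ∈ leftSubalgebra hc)
    (h2 : rescale Φ a = c • Φ a) : Φ a ∈ weightSpace Φ hc c := ⟨a, ⟨h1, h2⟩, rfl⟩

theorem mul_mem_weightSpace {c c' : Fq} {s t : S} (hs : s ∈ weightSpace Φ hc c)
    (ht : t ∈ weightSpace Φ hc c') : s * t ∈ weightSpace Φ hc (c * c') := by
  obtain ⟨a, ⟨h1, h2⟩, rfl⟩ := hs
  obtain ⟨b, ⟨h3, h4⟩, rfl⟩ := ht
  have h2 : rescale Φ a = c • Φ a := h2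
  have h4 : rescale Φ b = c' • Φ b := h4
  have h5 : Φ (a * b) ∈ weightSpace Φ hc (c * c') := mem_weightSpace hc (mul_mem h1 h3) (by
    rw [map_mul, map_mul, h2, h4, smul_mul_smul_comm])
  rwa [map_mul] at h5

theorem psi_mem_weightSpace (i : Fin N) (m : ℤ) : Φ (psiEl d i m) ∈ weightSpace Φ hc 2 :=
  mem_weightSpace hc (psiEl_mem hc i m) (rescale_psiEl Φ i m)

theorem phi_mem_weightSpace (i : Fin N) (m : ℤ) : Φ (phiEl d i m) ∈ weightSpace Φ hc 2⁻¹ :=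
  mem_weightSpace hc (phiEl_mem hc i m) (rescale_phiEl Φ i m)

theorem minusPart_le_weightSpace {s : S} (hs : s ∈ minusPart Φ) : s ∈ weightSpace Φ hc 1 := by
  induction hs using Algebra.adjoin_induction with
  | mem x hx =>
    rcases hx with rfl | rfl | ⟨j, l, rfl⟩
    · exact mem_weightSpace hc (g2_mem hc) (by rw [rescale_g2, one_smul])
    · exact mem_weightSpace hc (g2inv_mem hc) (by rw [rescale_g2inv, one_smul])
    · exact mem_weightSpace hc (xm_mem hc j l) (by rw [rescale_xm, one_smul])
  | algebraMap r =>
    have h1 : Φ (algebraMap Fq _ r) ∈ weightSpace Φ hc 1 :=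
      mem_weightSpace hc (Subalgebra.algebraMap_mem _ r) (by
        rw [AlgHom.commutes, AlgHom.commutes, one_smul])
    rwa [AlgHom.commutes] at h1
  | add a b _ _ ha hb => exact add_mem ha hb
  | mul a b _ _ ha hb => rw [← one_mul (1 : Fq)]; exact mul_mem_weightSpace hc ha hb

theorem eq_zero_of_mem_weightSpace (H : IsMinusQuot d A Φ)
    (hΦ : ∀ a ∈ leftSubalgebra hc, ∀ b ∈ leftSubalgebra hc, Φ a = Φ b →
      borelMap d A a = borelMap d A b)
    {s : S} (h1 : s ∈ weightSpace Φ hc 2) (h2 : s ∈ weightSpace Φ hc 2⁻¹) : s = 0 := by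
  obtain ⟨a, ⟨ha, ha2⟩, rfl⟩ := h1
  obtain ⟨b, ⟨hb, hb2⟩, hab⟩ := h2
  have ha2 : rescale Φ a = (2 : Fq) • Φ a := ha2
  have hb2 : rescale Φ b = (2 : Fq)⁻¹ • Φ b := hb2
  have hab : Φ b = Φ a := hab
  have h3 := congrArg (borelRescale hc.pos H) (hΦ b hb a ha hab)
  rw [borelRescale_borelMap, borelRescale_borelMap, ha2, hb2, hab, ← sub_eq_zero, ← sub_smul] at h3
  exact (smul_eq_zero.mp h3).resolve_left (by norm_num)

end Weight

end DrinfeldSerre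

namespace DrinfeldSerre

theorem sum_range_eq_of_eq_zero {M : Type*} [AddCommMonoid M] {f : ℕ → M} {m n : ℕ}
    (hm : ∀ r, m ≤ r → f r = 0) (hn : ∀ r, n ≤ r → f r = 0) :
    ∑ r ∈ Finset.range m, f r = ∑ r ∈ Finset.range n, f r := by
  rcases le_total m n with hmn | hmn
  · exact Finset.sum_subset (Finset.range_mono hmn) fun r _ hr => hm r (by simpa using hr)
  · exact (Finset.sum_subset (Finset.range_mono hmn) fun r _ hr => hn r (by simpa using hr)).symm

section Comparison

variable {S : Type*} [Ring S] [Algebra Fq S] {d A} {Φ : FA N →ₐ[Fq] S}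

theorem CartanRel.current_mul_sum_phi {w : Sˣ} {i : Fin N} {b : Fq} {x : ℤ → S} (hb : b ≠ 0)
    (H : CartanRel d Φ w i b x) (l : ℤ) {M : ℕ} {y : ℕ → S} (hy : ∀ n, M ≤ n → y n = 0) :
    x l * ∑ n ∈ Finset.range M, Φ (phiEl d i (-n)) * ↑(w ^ (n : ℤ)) * y n
      = ∑ t ∈ Finset.range M, Φ (phiEl d i (-t)) * ↑(w ^ (t : ℤ)) *
          ∑ s ∈ Finset.range M,
            (b * twistCoeff b s) • (↑(w ^ (2 * s : ℤ)) * (x (l - s) * y (t + s))) := by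
  set F : ℕ → ℕ → S := fun t s => Φ (phiEl d i (-t)) * ↑(w ^ (t : ℤ)) *
    ((b * twistCoeff b s) • (↑(w ^ (2 * s : ℤ)) * (x (l - s) * y (t + s)))) with hF
  have h1 : ∀ n ∈ Finset.range M, x l * (Φ (phiEl d i (-n)) * ↑(w ^ (n : ℤ)) * y n)
      = ∑ s ∈ Finset.range (n + 1), F (n - s) s := fun n _ => by
    rw [← mul_assoc, ← mul_assoc, H.current_mul_phi hb, Finset.sum_mul, Finset.sum_mul]
    refine Finset.sum_congr rfl fun s hs => ?_
    have hsn : s ≤ n := Nat.lt_succ_iff.mp (Finset.mem_range.mp hs)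
    have h2 : ((w ^ (s : ℤ) : Sˣ) : S) * ↑(w ^ (n : ℤ))
        = ↑(w ^ ((n - s : ℕ) : ℤ)) * ↑(w ^ (2 * s : ℤ)) := by
      rw [← Units.val_mul, ← Units.val_mul, ← zpow_add, ← zpow_add]
      congr 2
      omega
    simp only [hF, smul_mul_assoc, mul_smul_comm, Nat.sub_add_cancel hsn]
    congr 1
    simp only [mul_assoc]
    rw [← mul_assoc (x (l - s)), H.comm, mul_assoc, ← mul_assoc (↑(w ^ (s : ℤ)) : S), h2, mul_assoc]
  rw [Finset.mul_sum, Finset.sum_congr rfl h1,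
    Finset.sum_congr rfl fun n _ => (Finset.sum_range_reflect (fun s => F (n - s) s) (n + 1)).symm]
  have h3 : ∀ n ∈ Finset.range M, ∑ s ∈ Finset.range (n + 1),
      F (n - (n + 1 - 1 - s)) (n + 1 - 1 - s) = ∑ s ∈ Finset.range (n + 1), F s (n - s) :=
    fun n _ => Finset.sum_congr rfl fun s hs => by
      have hsn : s ≤ n := Nat.lt_succ_iff.mp (Finset.mem_range.mp hs)
      rw [Nat.add_sub_cancel, Nat.sub_sub_self hsn]
  rw [Finset.sum_congr rfl h3, Finset.sum_range_diag_flip]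
  refine Finset.sum_congr rfl fun t _ => ?_
  rw [Finset.mul_sum]
  refine Finset.sum_subset (Finset.range_mono (Nat.sub_le _ _)) fun s _ hs => ?_
  rw [Finset.mem_range, not_lt] at hs
  simp only [hF, hy (t + s) (by omega), mul_zero, smul_zero]

variable (H : IsMinusQuot d A Φ)

theorem eq_zero_of_sum_phi_eq_zero (i : Fin N) (k : ℤ) (M : ℕ) {v : ℤ → S}
    (hv : ∀ l, k + M < l → v l = 0)
    (h0 : ∀ l, k ≤ l →
      ∑ t ∈ Finset.range M, Φ (phiEl d i (-t)) * ↑(H.gamma ^ (t : ℤ)) * v (l + t) = 0)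
    (hM : 0 < M) : v k = 0 := by
  suffices h1 : ∀ n : ℕ, ∀ l, k ≤ l → k + M < l + n → v l = 0 from
    h1 (M + 1) k le_rfl (by push_cast; omega)
  intro n
  induction n with
  | zero => intro l _ hl; exact hv l (by simpa using hl)
  | succ n ih =>
    intro l hkl hl
    obtain ⟨M, rfl⟩ : ∃ M', M = M' + 1 := ⟨M - 1, by omega⟩
    have h2 := h0 l hkl
    rw [Finset.sum_range_succ', Finset.sum_eq_zero fun t _ => by
      rw [ih (l + (t + 1 : ℕ)) (by omega) (by push_cast at hl ⊢; omega), mul_zero], zero_add,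
      phiEl_neg_natCast, Pneg, mul_one, Nat.cast_zero, zpow_zero, Units.val_one, mul_one,
      add_zero] at h2
    rw [← one_mul (v l), ← H.K_mul_Kinv i, mul_assoc, h2, mul_zero]

variable (hc : CartanDatum d A)

theorem sum_phi_eq_of_bracket
    (hΦ : ∀ a ∈ leftSubalgebra hc, ∀ b ∈ leftSubalgebra hc, Φ a = Φ b →
      borelMap d A a = borelMap d A b)
    {i j : Fin N} {k m : ℤ} {E P : S} {a a' b b' : ℤ → S} {M₁ M₂ M₃ M₄ : ℕ}
    (hP : P ∈ minusPart Φ) (ha : ∀ l, a l ∈ minusPart Φ) (ha' : ∀ l, a' l ∈ minusPart Φ)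
    (hb : ∀ l, b l ∈ minusPart Φ) (hb' : ∀ l, b' l ∈ minusPart Φ)
    (h1 : E * P - P * E = (qi d j - (qi d j)⁻¹)⁻¹ •
      (∑ p ∈ Finset.range M₁, Φ (psiEl d j p) * ↑(H.gamma ^ (p : ℤ)) * a (k - p)
        - ∑ r ∈ Finset.range M₂, Φ (phiEl d j (-r)) * ↑(H.gamma ^ (r : ℤ)) * b (k + r)))
    (h2 : E * (Φ (e (xm i m)) * P) - Φ (e (xm i m)) * P * E = (qi d j - (qi d j)⁻¹)⁻¹ •
      (∑ p ∈ Finset.range M₃, Φ (psiEl d j p) * ↑(H.gamma ^ (p : ℤ)) * a' (k - p)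
        - ∑ r ∈ Finset.range M₄, Φ (phiEl d j (-r)) * ↑(H.gamma ^ (r : ℤ)) * b' (k + r)))
    (h3 : E * Φ (e (xm i m)) - Φ (e (xm i m)) * E =
      if j = i then (qi d j - (qi d j)⁻¹)⁻¹ •
        (↑(H.gamma ^ (k - m)) * Φ (psiEl d j (k + m)) - ↑(H.gamma ^ (m - k)) * Φ (phiEl d j (k + m)))
      else 0) :
    ∑ r ∈ Finset.range M₄, Φ (phiEl d j (-r)) * ↑(H.gamma ^ (r : ℤ)) * b' (k + r)
      = (if j = i then ↑(H.gamma ^ (m - k)) * Φ (phiEl d j (k + m)) * P else 0)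
        + Φ (e (xm i m)) *
          ∑ r ∈ Finset.range M₂, Φ (phiEl d j (-r)) * ↑(H.gamma ^ (r : ℤ)) * b (k + r) := by
  have hpsi : ∀ (a : ℤ → S), (∀ l, a l ∈ minusPart Φ) → ∀ M : ℕ,
      ∑ p ∈ Finset.range M, Φ (psiEl d j p) * ↑(H.gamma ^ (p : ℤ)) * a (k - p)
        ∈ weightSpace Φ hc 2 := fun a ha M => sum_mem fun p _ => by
    simpa using mul_mem_weightSpace hc (mul_mem_weightSpace hc (psi_mem_weightSpace hc j p)
      (minusPart_le_weightSpace hc (gamma_zpow_mem_minusPart H p)))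
      (minusPart_le_weightSpace hc (ha (k - p)))
  have hphi : ∀ (a : ℤ → S), (∀ l, a l ∈ minusPart Φ) → ∀ M : ℕ,
      ∑ r ∈ Finset.range M, Φ (phiEl d j (-r)) * ↑(H.gamma ^ (r : ℤ)) * a (k + r)
        ∈ weightSpace Φ hc 2⁻¹ := fun a ha M => sum_mem fun r _ => by
    simpa using mul_mem_weightSpace hc (mul_mem_weightSpace hc (phi_mem_weightSpace hc j (-r))
      (minusPart_le_weightSpace hc (gamma_zpow_mem_minusPart H r)))
      (minusPart_le_weightSpace hc (ha (k + r)))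
  have hX : ∀ {c : Fq} {s : S}, s ∈ weightSpace Φ hc c →
      Φ (e (xm i m)) * s ∈ weightSpace Φ hc c := fun hs => by
    simpa using mul_mem_weightSpace hc (minusPart_le_weightSpace hc (xm_mem_minusPart i m)) hs
  have hδ : ∀ (c : Fq) (n : ℤ) {s : S}, s ∈ weightSpace Φ hc c →
      (if j = i then ↑(H.gamma ^ n) * s * P else 0) ∈ weightSpace Φ hc c := fun c n s hs => by
    split_ifs
    · simpa using mul_mem_weightSpace hc (mul_mem_weightSpace hc
        (minusPart_le_weightSpace hc (gamma_zpow_mem_minusPart H n)) hs)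
        (minusPart_le_weightSpace hc hP)
    · exact zero_mem _
  have hA := hpsi a ha M₁
  have hA' := hpsi a' ha' M₃
  have hB := hphi b hb M₂
  have hB' := hphi b' hb' M₄
  have hD1 := hδ _ (k - m) (psi_mem_weightSpace hc j (k + m))
  have hD2 := hδ _ (m - k) (phi_mem_weightSpace hc j (k + m))
  have hD : (E * Φ (e (xm i m)) - Φ (e (xm i m)) * E) * P = (qi d j - (qi d j)⁻¹)⁻¹ •
      ((if j = i then ↑(H.gamma ^ (k - m)) * Φ (psiEl d j (k + m)) * P else 0)
        - if j = i then ↑(H.gamma ^ (m - k)) * Φ (phiEl d j (k + m)) * P else 0) := by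
    rw [h3]
    split_ifs
    · rw [smul_mul_assoc, sub_mul]
    · rw [zero_mul, sub_zero, smul_zero]
  have hE : E * (Φ (e (xm i m)) * P) - Φ (e (xm i m)) * P * E
      = (E * Φ (e (xm i m)) - Φ (e (xm i m)) * E) * P + Φ (e (xm i m)) * (E * P - P * E) := by
    noncomm_ring
  rw [h2, hD, h1, mul_smul_comm, ← smul_add] at hE
  have hE := smul_right_injective S (inv_ne_zero (qi_sub_inv_ne_zero (hc.pos j))) hE
  simp only [mul_sub] at hE
  generalize (∑ p ∈ Finset.range M₁, Φ (psiEl d j p) * ↑(H.gamma ^ (p : ℤ)) * a (k - p)) = sA at *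
  generalize (∑ p ∈ Finset.range M₃, Φ (psiEl d j p) * ↑(H.gamma ^ (p : ℤ)) * a' (k - p)) = sA' at *
  generalize (∑ r ∈ Finset.range M₂, Φ (phiEl d j (-r)) * ↑(H.gamma ^ (r : ℤ)) * b (k + r)) = sB
    at *
  generalize (∑ r ∈ Finset.range M₄, Φ (phiEl d j (-r)) * ↑(H.gamma ^ (r : ℤ)) * b' (k + r)) = sB'
    at *
  generalize (if j = i then ↑(H.gamma ^ (k - m)) * Φ (psiEl d j (k + m)) * P else 0) = t1 at *
  generalize (if j = i then ↑(H.gamma ^ (m - k)) * Φ (phiEl d j (k + m)) * P else 0) = t2 at *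
  have h4 : sB' - (t2 + Φ (e (xm i m)) * sB) = sA' - (t1 + Φ (e (xm i m)) * sA) := by
    rw [sub_eq_iff_eq_add] at hE
    rw [hE]
    abel
  refine sub_eq_zero.mp (eq_zero_of_mem_weightSpace hc H hΦ ?_ ?_)
  · rw [h4]; exact sub_mem hA' (add_mem hD1 (hX hA))
  · exact sub_mem hB' (add_mem hD2 (hX hB))

include hc in
/-- The recursion obtained by comparing the `φ`-parts determines the lowest component. -/
theorem eq_of_sum_phi_eq (i j : Fin N) (k m : ℤ) {P : S} {b b' : ℤ → S} {M : ℕ}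
    (hb : ∀ l, k + M < l → b l = 0) (hb' : ∀ l, k + M < l → b' l = 0) (hm : -m ≤ k + M)
    (h0 : ∀ l, k ≤ l →
      ∑ r ∈ Finset.range (M + 1), Φ (phiEl d j (-r)) * ↑(H.gamma ^ (r : ℤ)) * b' (l + r)
        = (if j = i then ↑(H.gamma ^ (m - l)) * Φ (phiEl d j (l + m)) * P else 0)
          + Φ (e (xm i m)) *
            ∑ r ∈ Finset.range (M + 1), Φ (phiEl d j (-r)) * ↑(H.gamma ^ (r : ℤ)) * b (l + r)) :
    b' k = (if i = j ∧ k = -m then ↑(H.gamma ^ (-(2 * k))) * P else 0)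
      + ∑ r ∈ Finset.range (M + 1), gcoef (qp d A i j) r •
          (↑(H.gamma ^ (2 * r : ℤ)) * (Φ (e (xm i (m - r))) * b (k + r))) := by
  set δ : ℤ → S := fun l => if i = j ∧ l = -m then ↑(H.gamma ^ (-(2 * l))) * P else 0 with hδ
  set R : ℤ → S := fun l => ∑ r ∈ Finset.range (M + 1), gcoef (qp d A i j) r •
    (↑(H.gamma ^ (2 * r : ℤ)) * (Φ (e (xm i (m - r))) * b (l + r))) with hR
  suffices h1 : b' k - (δ k + R k) = 0 from sub_eq_zero.mp h1
  refine eq_zero_of_sum_phi_eq_zero H j k (M + 1) (v := fun l => b' l - (δ l + R l))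
    (fun l hl => ?_) (fun l hl => ?_) M.succ_pos
  · push_cast at hl
    have h1 : R l = 0 := Finset.sum_eq_zero fun r _ => by
      rw [hb _ (by omega), mul_zero, mul_zero, smul_zero]
    have h2 : δ l = 0 := if_neg fun h => by omega
    rw [hb' l (by omega), h1, h2, add_zero, sub_zero]
  · have h1 := (H.cartanRel_xm hc.pos j i).current_mul_sum_phi (inv_ne_zero (qp_ne_zero d A j i)) m
      (M := M + 1) (y := fun n => b (l + n)) (fun n hn => hb _ (by omega))
    have h2 : ∑ t ∈ Finset.range (M + 1), Φ (phiEl d j (-t)) * ↑(H.gamma ^ (t : ℤ)) * δ (l + t)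
        = if j = i then ↑(H.gamma ^ (m - l)) * Φ (phiEl d j (l + m)) * P else 0 := by
      by_cases hij : j = i
      · rw [if_pos hij]
        rcases lt_or_ge 0 (l + m) with hlm | hlm
        · rw [phiEl_of_pos d j hlm, map_zero, mul_zero, zero_mul]
          exact Finset.sum_eq_zero fun t _ => by
            rw [hδ]; dsimp only; rw [if_neg (by omega), mul_zero]
        · obtain ⟨t, ht⟩ : ∃ t : ℕ, l + t = -m := ⟨(-m - l).toNat, by omega⟩
          rw [Finset.sum_eq_single t]
          · rw [hδ]
            dsimp only
            rw [if_pos ⟨hij.symm, ht⟩, show l + m = -(t : ℤ) by omega, mul_assoc, mul_assoc,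
              ← mul_assoc (↑(H.gamma ^ (t : ℤ)) : S), ← Units.val_mul, ← zpow_add,
              show (t : ℤ) + -(2 * (l + t)) = m - l by omega, ← mul_assoc, ← mul_assoc,
              (H.central_zpow (m - l) _).eq]
          · intro t' _ htt
            rw [hδ]; dsimp only; rw [if_neg (by omega), mul_zero]
          · intro h
            exact absurd (Finset.mem_range.mpr (by omega)) h
      · rw [if_neg hij]
        exact Finset.sum_eq_zero fun t _ => by
          rw [hδ]; dsimp only; rw [if_neg fun h => hij h.1.symm, mul_zero]
    have h3 : ∑ t ∈ Finset.range (M + 1), Φ (phiEl d j (-t)) * ↑(H.gamma ^ (t : ℤ)) * R (l + t)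
        = Φ (e (xm i m)) *
            ∑ r ∈ Finset.range (M + 1), Φ (phiEl d j (-r)) * ↑(H.gamma ^ (r : ℤ)) * b (l + r) := by
      rw [h1]
      refine Finset.sum_congr rfl fun t _ => congrArg _ (Finset.sum_congr rfl fun s _ => ?_)
      rw [gcoef_eq (qp_ne_zero d A i j), qp_symm hc.symm i j, Nat.cast_add, add_assoc]
    simp only [mul_sub, mul_add, Finset.sum_sub_distrib, Finset.sum_add_distrib]
    rw [h0 l hl, h2, h3, sub_self]

end Comparison

end DrinfeldSerre

namespace DrinfeldSerre

variable {d A}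

theorem uqQuot : IsMinusQuot d A (RingQuot.mkAlgHom Fq (QRel N d A)) where
  surjective := RingQuot.mkAlgHom_surjective Fq (QRel N d A)
  rel _ _ hxy := RingQuot.mkAlgHom_rel Fq hxy.qRel

theorem borelMap_eq_of_mk_eq (hc : CartanDatum d A) (a : FA N) (ha : a ∈ leftSubalgebra hc)
    (b : FA N) (hb : b ∈ leftSubalgebra hc)
    (hab : RingQuot.mkAlgHom Fq (QRel N d A) a = RingQuot.mkAlgHom Fq (QRel N d A) b) :
    borelMap d A a = borelMap d A b := by
  rw [← rho_mk_one hc ha, ← rho_mk_one hc hb, hab]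

theorem Nq_le_minusPart : Nq d A ≤ minusPart (RingQuot.mkAlgHom Fq (QRel N d A)) := by
  refine Algebra.adjoin_mono fun x hx => ?_
  rcases hx with (rfl | rfl) | ⟨p, rfl⟩
  exacts [.inl rfl, .inr (.inl rfl), .inr (.inr ⟨p.1, p.2, rfl⟩)]

theorem coe_gN (m : ℤ) : (gN d A m : Uq N d A) = ↑((uqQuot (d := d) (A := A)).gamma ^ m) := by
  rw [← uqQuot.map_gammaHalf, gN, gammaHalf]
  split_ifs <;> rw [map_pow] <;> rfl

theorem gU_eq (m : ℤ) : gU d A m = ↑((uqQuot (d := d) (A := A)).gamma ^ m) :=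
  uqQuot.map_gammaHalf m

theorem bracket_xp_xm (i j : Fin N) (k m : ℤ) :
    G d A (xp j k) * G d A (xm i m) - G d A (xm i m) * G d A (xp j k)
      = if j = i then (qi d j - (qi d j)⁻¹)⁻¹ •
          (↑((uqQuot (d := d) (A := A)).gamma ^ (k - m)) * psiU d A j (k + m)
            - ↑((uqQuot (d := d) (A := A)).gamma ^ (m - k)) * phiU d A j (k + m))
        else 0 := by
  have h1 := RingQuot.mkAlgHom_rel Fq (QRel.xp_xm (d := d) (A := A) j i k m)
  rw [map_sub, map_mul, map_mul] at h1
  refine h1.trans ?_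
  split_ifs
  · rw [map_smul, map_sub, map_mul, map_mul, uqQuot.map_gammaHalf, uqQuot.map_gammaHalf]; rfl
  · exact map_zero _

end DrinfeldSerre

/-- `Ω_{φ_j}(k)(x^-_{i,m} P) = δ_{ij} δ_{k,-m} γ^{-k} P +
∑_{r ≥ 0} g_{i,j}(r) γ^r x^-_{i,m-r} (Ω_{φ_j}(k+r)(P))`,
with only finitely many nonzero summands. -/
theorem omega_phi_commutation
    (hN : 0 < N)
    (hdpos : ∀ i, 0 < d i)
    (hgcd : Finset.univ.gcd (fun i => (d i).natAbs) = 1)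
    (hdiag : ∀ i, A i i = 2)
    (hoff : ∀ i j, i ≠ j → A i j ≤ 0)
    (hsym : ∀ i j, d i * A i j = d j * A j i)
    (Ωψ Ωφ : Fin N → ℤ → ((Nq d A) →ₗ[Fq] (Nq d A)))
    (hfam : IsOmegaFamily d A Ωψ Ωφ)
    (i j : Fin N) (k m : ℤ) (P : Nq d A) :
    ∃ M : ℕ, (∀ r : ℕ, M < r → Ωφ j (k + (r : ℤ)) P = 0) ∧
      Ωφ j k (xmN d A i m * P) =
        (if i = j ∧ k = -m then gN d A (-(2 * k)) * P else 0) +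
        ∑ r ∈ Finset.range (M + 1),
          gcoef (qp d A i j) r •
            (gN d A (2 * (r : ℤ)) * (xmN d A i (m - (r : ℤ)) * Ωφ j (k + (r : ℤ)) P)) := by
  have hc : DrinfeldSerre.CartanDatum d A := ⟨hdpos, hdiag, hoff, hsym⟩
  obtain ⟨-, hφ, hbr⟩ := hfam
  obtain ⟨B, hB⟩ := hφ j P
  obtain ⟨B', hB'⟩ := hφ j (xmN d A i m * P)
  obtain ⟨M, hMB, hMB', hm⟩ : ∃ M : ℕ, B ≤ k + M ∧ B' ≤ k + M ∧ -m ≤ k + M :=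
    ⟨(max (max B B') (-m) - k).toNat, by omega, by omega, by omega⟩
  refine ⟨M, fun r hr => hB _ (by omega), ?_⟩
  have key := DrinfeldSerre.eq_of_sum_phi_eq DrinfeldSerre.uqQuot hc i j k m (P := (P : Uq N d A))
    (b := fun l => (Ωφ j l P : Uq N d A)) (b' := fun l => (Ωφ j l (xmN d A i m * P) : Uq N d A))
    (M := M) (fun l hl => by rw [hB l (by omega)]; rfl) (fun l hl => by rw [hB' l (by omega)]; rfl)
    hm (fun l hl => ?_)
  · refine Subtype.ext (key.trans ?_)
    rw [Subalgebra.coe_add, AddSubmonoidClass.coe_finsetSum]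
    refine congrArg₂ _ ?_ (Finset.sum_congr rfl fun r _ => ?_)
    · split_ifs
      · rw [Subalgebra.coe_mul, DrinfeldSerre.coe_gN]
      · rfl
    · rw [Subalgebra.coe_smul, Subalgebra.coe_mul, Subalgebra.coe_mul, DrinfeldSerre.coe_gN]
      rfl
  · obtain ⟨M₁, h1, h1'⟩ := hbr j l P
    obtain ⟨M₂, h2, h2'⟩ := hbr j l (xmN d A i m * P)
    have hmem : ∀ Q : Nq d A, (Q : Uq N d A) ∈
      DrinfeldSerre.minusPart (RingQuot.mkAlgHom Fq (QRel N d A)) :=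
        fun Q => DrinfeldSerre.Nq_le_minusPart Q.2
    rw [DrinfeldSerre.sum_range_eq_of_eq_zero (m := M₁ + 1) (n := M + 1)
      (f := fun r => phiU d A j (-r) * gU d A r *
        (Ωφ j (l + r) P : Uq N d A))
      (fun r hr => by rw [(h1 r hr).2]; exact mul_zero (_ : Uq N d A))
      (fun r hr => by rw [hB _ (by omega)]; exact mul_zero (_ : Uq N d A))] at h1'
    rw [DrinfeldSerre.sum_range_eq_of_eq_zero (m := M₂ + 1) (n := M + 1)
      (f := fun r => phiU d A j (-r) * gU d A r *
        (Ωφ j (l + r) (xmN d A i m * P) : Uq N d A))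
      (fun r hr => by rw [(h2 r hr).2]; exact mul_zero (_ : Uq N d A))
      (fun r hr => by rw [hB' _ (by omega)]; exact mul_zero (_ : Uq N d A))] at h2'
    simp only [DrinfeldSerre.gU_eq] at h1' h2'
    exact DrinfeldSerre.sum_phi_eq_of_bracket DrinfeldSerre.uqQuot hc
      (DrinfeldSerre.borelMap_eq_of_mk_eq hc) (a := fun l => (Ωψ j l P : Uq N d A))
      (a' := fun l => (Ωψ j l (xmN d A i m * P) : Uq N d A))
      (b := fun l => (Ωφ j l P : Uq N d A)) (b' := fun l => (Ωφ j l (xmN d A i m * P) : Uq N d A))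
      (hmem P) (fun l => hmem _) (fun l => hmem _) (fun l => hmem _) (fun l => hmem _)
      h1' h2' (DrinfeldSerre.bracket_xp_xm i j l m)

end
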